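/- There exist constants γ ∈ (0,1] and N, depending only on δ, K, and d, such that for any operator L ∈ 𝔏_{δ,K} and any function u ∈ W^{1,2}_{d+1,loc}(C_{2,1}) ∩ C(C̄_{2,1}) one has ∫_{C_{1,1}(1,0)} |D²u|^γ dx dt ≤ N (∫_{C_{2,1}} |Lu|^{d+1} dx dt)^{γ/(d+1)} + N sup_{∂'C_{2,1}} |u|^γ. -/

import Mathlib

open MeasureTheory ENNReal Set

noncomputable section

/-- The Frobenius norm of a matrix, used as `|D²u|`. -/
def frobNorm {d : ℕ} (m : Matrix (Fin d) (Fin d) ℝ) : ℝ :=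
  Real.sqrt (∑ i, ∑ j, (m i j) ^ 2)

namespace LinEst

abbrev E (d : ℕ) := EuclideanSpace ℝ (Fin d)
abbrev Z (d : ℕ) := ℝ × EuclideanSpace ℝ (Fin d)

variable {d : ℕ}

/-- the quadratic form of a matrix -/
def quad (H : Matrix (Fin d) (Fin d) ℝ) (ξ : E d) : ℝ := ∑ i, ∑ j, H i j * ξ i * ξ j

/-- contraction `a^{ij} H_{ij}` -/
def ctr (a H : Matrix (Fin d) (Fin d) ℝ) : ℝ := ∑ i, ∑ j, a i j * H i j

lemma ctr_add (a H G : Matrix (Fin d) (Fin d) ℝ) : ctr a (H + G) = ctr a H + ctr a G := by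
  simp [ctr, mul_add, Finset.sum_add_distrib]

lemma ctr_sub (a H G : Matrix (Fin d) (Fin d) ℝ) : ctr a (H - G) = ctr a H - ctr a G := by
  simp [ctr, mul_sub, Finset.sum_sub_distrib]

lemma ctr_smul (a H : Matrix (Fin d) (Fin d) ℝ) (s : ℝ) : ctr a (s • H) = s * ctr a H := by
  simp only [ctr, Finset.mul_sum, Matrix.smul_apply, smul_eq_mul]
  refine Finset.sum_congr rfl fun i _ => Finset.sum_congr rfl fun j _ => by ring

lemma ctr_one (a : Matrix (Fin d) (Fin d) ℝ) : ctr a 1 = a.trace := by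
  simp [ctr, Matrix.one_apply, Matrix.trace]

lemma one_ctr (a : Matrix (Fin d) (Fin d) ℝ) : ctr 1 a = a.trace := by
  simp [ctr, Matrix.one_apply, Matrix.trace]

lemma quad_eq (H : Matrix (Fin d) (Fin d) ℝ) (ξ : E d) :
    quad H ξ = (ξ : Fin d → ℝ) ⬝ᵥ (H.mulVec (ξ : Fin d → ℝ)) := by
  simp only [quad, dotProduct, Matrix.mulVec, Finset.mul_sum]
  refine Finset.sum_congr rfl fun i _ => Finset.sum_congr rfl fun j _ => by ring

lemma psd_of_quad {H : Matrix (Fin d) (Fin d) ℝ} (hs : H.IsSymm)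
    (h : ∀ ξ : E d, 0 ≤ quad H ξ) : H.PosSemidef := by
  refine Matrix.PosSemidef.of_dotProduct_mulVec_nonneg ?_ ?_
  · rw [Matrix.IsHermitian, Matrix.conjTranspose_eq_transpose_of_trivial]; exact hs
  · intro x
    have := h (WithLp.toLp 2 x)
    rw [quad_eq] at this
    simpa using this

lemma ctr_eq_trace (a H : Matrix (Fin d) (Fin d) ℝ) (hs : H.IsSymm) :
    ctr a H = (a * H).trace := by
  simp only [ctr, Matrix.trace, Matrix.diag, Matrix.mul_apply]
  refine Finset.sum_congr rfl fun i _ => Finset.sum_congr rfl fun j _ => ?_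
  rw [hs.apply]

open scoped MatrixOrder in
open scoped Matrix.Norms.L2Operator in
lemma ctr_nonneg {a H : Matrix (Fin d) (Fin d) ℝ} (ha : a.PosSemidef) (hH : H.PosSemidef) :
    0 ≤ ctr a H := by
  have hs : H.IsSymm := by
    have := hH.1
    rwa [Matrix.IsHermitian, Matrix.conjTranspose_eq_transpose_of_trivial] at this
  rw [ctr_eq_trace a H hs]
  obtain ⟨B, hB⟩ : ∃ B : Matrix (Fin d) (Fin d) ℝ, H = star B * B :=
    CStarAlgebra.nonneg_iff_eq_star_mul_self.1 hH.nonneg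
  rw [Matrix.star_eq_conjTranspose] at hB
  rw [hB, ← mul_assoc, Matrix.trace_mul_comm, ← mul_assoc]
  exact (ha.mul_mul_conjTranspose_same B).trace_nonneg

lemma quad_one (ξ : E d) : quad (1 : Matrix (Fin d) (Fin d) ℝ) ξ = ‖ξ‖ ^ 2 := by
  rw [EuclideanSpace.real_norm_sq_eq]
  simp [quad, Matrix.one_apply, pow_two]

lemma quad_sub (A B : Matrix (Fin d) (Fin d) ℝ) (ξ : E d) :
    quad (A - B) ξ = quad A ξ - quad B ξ := by
  simp [quad, sub_mul, Finset.sum_sub_distrib]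

lemma quad_add (A B : Matrix (Fin d) (Fin d) ℝ) (ξ : E d) :
    quad (A + B) ξ = quad A ξ + quad B ξ := by
  simp [quad, add_mul, Finset.sum_add_distrib]

lemma quad_smul (A : Matrix (Fin d) (Fin d) ℝ) (s : ℝ) (ξ : E d) :
    quad (s • A) ξ = s * quad A ξ := by
  simp only [quad, Finset.mul_sum, Matrix.smul_apply, smul_eq_mul]
  refine Finset.sum_congr rfl fun i _ => Finset.sum_congr rfl fun j _ => by ring

/-- the class `S_δ` -/
def Ell (δ : ℝ) (a : Matrix (Fin d) (Fin d) ℝ) : Prop :=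
  a.IsSymm ∧ ∀ ξ : E d, δ * ‖ξ‖ ^ 2 ≤ quad a ξ ∧ quad a ξ ≤ δ⁻¹ * ‖ξ‖ ^ 2

lemma Ell.ctr_ge {δ : ℝ} {a H : Matrix (Fin d) (Fin d) ℝ} (ha : Ell δ a) (hH : H.PosSemidef) :
    δ * H.trace ≤ ctr a H := by
  have h1 : (a - δ • (1 : Matrix (Fin d) (Fin d) ℝ)).PosSemidef := by
    refine psd_of_quad (ha.1.sub ((Matrix.isSymm_one).smul δ)) fun ξ => ?_
    rw [quad_sub, quad_smul, quad_one]
    linarith [(ha.2 ξ).1]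
  have h2 := ctr_nonneg hH h1
  have h3 : ctr H (a - δ • (1 : Matrix (Fin d) (Fin d) ℝ)) = ctr a H - δ * H.trace := by
    rw [ctr_sub, ctr_smul, ctr_one]
    congr 1
    simp only [ctr]
    refine Finset.sum_congr rfl fun i _ => Finset.sum_congr rfl fun j _ => by ring
  linarith

lemma Ell.entry_diag {δ : ℝ} {a : Matrix (Fin d) (Fin d) ℝ} (ha : Ell δ a) (i : Fin d) :
    δ ≤ a i i ∧ a i i ≤ δ⁻¹ := by
  have := ha.2 (EuclideanSpace.single i 1)
  simpa [quad, Pi.single_apply] using this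

lemma Ell.trace_le {δ : ℝ} {a : Matrix (Fin d) (Fin d) ℝ} (ha : Ell δ a) :
    a.trace ≤ d * δ⁻¹ := by
  simp only [Matrix.trace, Matrix.diag]
  calc ∑ i, a i i ≤ ∑ _i : Fin d, δ⁻¹ := Finset.sum_le_sum fun i _ => (ha.entry_diag i).2
    _ = d * δ⁻¹ := by simp

lemma Ell.trace_nonneg {δ : ℝ} (hδ : 0 < δ) {a : Matrix (Fin d) (Fin d) ℝ} (ha : Ell δ a) :
    0 ≤ a.trace := by
  simp only [Matrix.trace, Matrix.diag]
  exact Finset.sum_nonneg fun i _ => hδ.le.trans (ha.entry_diag i).1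

lemma psd_entry {H : Matrix (Fin d) (Fin d) ℝ} (hH : H.PosSemidef) (i j : Fin d) :
    |H i j| ≤ H.trace := by
  have hs : ∀ i j, H i j = H j i := by
    have := hH.1
    rw [Matrix.IsHermitian, Matrix.conjTranspose_eq_transpose_of_trivial] at this
    intro i j
    exact (Matrix.IsSymm.apply this i j).symm
  have hd : ∀ k, 0 ≤ H k k := fun k => hH.diag_nonneg
  have htr : ∀ k, H k k ≤ H.trace := fun k =>
    Finset.single_le_sum (f := fun k => H k k) (fun k _ => hd k) (Finset.mem_univ k)
  by_cases hij : i = j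
  · subst hij; rw [abs_of_nonneg (hd i)]; exact htr i
  have h2 : H i i + H j j ≤ H.trace := by
    have := Finset.sum_le_sum_of_subset_of_nonneg (f := fun k => H k k)
      (Finset.subset_univ {i, j}) (fun k _ _ => hd k)
    rwa [Finset.sum_pair hij] at this
  have key : ∀ s : ℝ, 0 ≤ H i i + 2 * s * H i j + s ^ 2 * H j j := by
    intro s
    have := hH.dotProduct_mulVec_nonneg (Pi.single i 1 + s • Pi.single j 1)
    simp [Matrix.mulVec_add, Matrix.mulVec_smul, add_dotProduct, dotProduct_add, smul_dotProduct,
      dotProduct_smul] at this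
    have e := hs j i
    rw [e] at this
    linarith
  have k1 := key 1
  have k2 := key (-1)
  rw [abs_le]; constructor <;> nlinarith

lemma psd_det {H : Matrix (Fin d) (Fin d) ℝ} (hH : H.PosSemidef) :
    |H.det| ≤ (d.factorial : ℝ) * H.trace ^ d := by
  have := Matrix.det_le (A := H) (abv := AbsoluteValue.abs) (x := H.trace)
    (fun i j => by simpa using psd_entry hH i j)
  simpa using this

lemma psd_frob {H : Matrix (Fin d) (Fin d) ℝ} (hH : H.PosSemidef) :
    frobNorm H ≤ d * H.trace := by
  have ht := hH.trace_nonneg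
  rw [frobNorm]
  apply Real.sqrt_le_iff.2
  refine ⟨by positivity, ?_⟩
  calc ∑ i, ∑ j, H i j ^ 2 ≤ ∑ _i : Fin d, ∑ _j : Fin d, H.trace ^ 2 := by
        refine Finset.sum_le_sum fun i _ => Finset.sum_le_sum fun j _ => ?_
        exact sq_le_sq' (by linarith [abs_le.1 (psd_entry hH i j)]) (abs_le.1 (psd_entry hH i j)).2
    _ = (d * H.trace) ^ 2 := by simp; ring

/-- First and second order spatial jet of `w`. -/
structure JetAt (w : Z d → ℝ) (wt : Z d → ℝ) (G : Z d → E d) (H : Z d → Matrix (Fin d) (Fin d) ℝ)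
    (z : Z d) : Prop where
  hw : HasFDerivAt w ((wt z) • ContinuousLinearMap.fst ℝ ℝ (E d) +
    (innerSL ℝ (G z)).comp (ContinuousLinearMap.snd ℝ ℝ (E d))) z
  hG : ∃ q : E d, HasFDerivAt G ((ContinuousLinearMap.fst ℝ ℝ (E d)).smulRight q +
    (Matrix.toEuclideanCLM (𝕜 := ℝ) (H z)).comp (ContinuousLinearMap.snd ℝ ℝ (E d))) z
  sym : (H z).IsSymm

lemma inner_toE (H : Matrix (Fin d) (Fin d) ℝ) (ξ : E d) :
    inner ℝ (Matrix.toEuclideanCLM (𝕜 := ℝ) H ξ) ξ = quad H ξ := by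
  rw [quad_eq, real_inner_comm]
  rw [Matrix.inner_toEuclideanCLM]

lemma det_jet (x q : E d) (s : ℝ) (H : Matrix (Fin d) (Fin d) ℝ)
    (A : Z d →L[ℝ] Z d)
    (hA : ∀ τ ξ, A (τ, ξ) = (s * τ - inner ℝ (τ • q + Matrix.toEuclideanCLM (𝕜 := ℝ) H ξ) x,
      τ • q + Matrix.toEuclideanCLM (𝕜 := ℝ) H ξ)) :
    A.det = s * H.det := by
  let f1 : Module.Dual ℝ (Z d) := -((innerSL ℝ x).toLinearMap ∘ₗ LinearMap.snd ℝ ℝ (E d))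
  let f2 : Module.Dual ℝ (Z d) := LinearMap.fst ℝ ℝ (E d)
  let T1 := LinearMap.transvection f1 ((1 : ℝ), (0 : E d))
  let T2 := LinearMap.transvection f2 ((0 : ℝ), q)
  let D1 : Z d →ₗ[ℝ] Z d := LinearMap.prodMap (s • LinearMap.id) LinearMap.id
  let D2 : Z d →ₗ[ℝ] Z d := LinearMap.prodMap LinearMap.id (Matrix.toEuclideanCLM (𝕜 := ℝ) H).toLinearMap
  have hcomp : A.toLinearMap = T1 ∘ₗ D1 ∘ₗ T2 ∘ₗ D2 := by
    apply LinearMap.ext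
    rintro ⟨τ, ξ⟩
    have := hA τ ξ
    simp only [ContinuousLinearMap.coe_coe, this]
    simp [T1, T2, D1, D2, f1, f2, LinearMap.transvection.apply, real_inner_comm, inner_add_right, inner_smul_right]
    constructor
    · ring
    · rw [add_comm]
  rw [ContinuousLinearMap.det, hcomp, LinearMap.det_comp, LinearMap.det_comp, LinearMap.det_comp]
  have e1 : LinearMap.det T1 = 1 := by
    rw [LinearMap.transvection.det]; simp [f1]
  have e2 : LinearMap.det T2 = 1 := by
    rw [LinearMap.transvection.det]; simp [f2]
  have e3 : LinearMap.det D1 = s := by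
    simp [D1, LinearMap.det_prodMap]
  have e4 : LinearMap.det D2 = H.det := by
    have : LinearMap.det (Matrix.toEuclideanCLM (𝕜 := ℝ) H).toLinearMap = H.det := by
      exact LinearMap.det_toLpLin 2 H
    simp [D2, LinearMap.det_prodMap, this]
  rw [e1, e2, e3, e4]; ring

end LinEst

namespace LinEst
variable {d : ℕ}

instance instHaarZ : (volume : Measure (Z d)).IsAddHaarMeasure := by
  rw [Measure.volume_eq_prod]; infer_instance

lemma second_deriv_min {f g : ℝ → ℝ} {c : ℝ} (hf : ∀ᶠ s in nhds (0 : ℝ), HasDerivAt f (g s) s)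
    (hg : HasDerivAt g c 0) (hm : IsLocalMin f 0) : 0 ≤ c := by
  by_contra hc
  push Not at hc
  have hd : deriv f =ᶠ[nhds 0] g := hf.mono fun s hs => hs.deriv
  have h0 : deriv f 0 = 0 := hm.deriv_eq_zero
  have h2 : deriv (deriv f) 0 = c := by rw [hd.deriv_eq]; exact hg.deriv
  have hmax := isLocalMax_of_deriv_deriv_neg (by rw [h2]; exact hc) h0
    (hf.self_of_nhds).continuousAt
  have hconst : f =ᶠ[nhds 0] fun _ => f 0 := by
    filter_upwards [hm, hmax] with s h1 h2 using le_antisymm h2 h1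
  have h3 : g =ᶠ[nhds 0] fun _ => 0 := by
    filter_upwards [hd, hconst.eventuallyEq_nhds] with s h1 h2
    rw [← h1, h2.deriv_eq]; simp
  have h4 : deriv g 0 = 0 := by rw [h3.deriv_eq]; simp
  rw [hg.deriv] at h4
  linarith

lemma right_deriv_nonneg {f : ℝ → ℝ} {c t t1 : ℝ} (ht : t < t1) (hf : HasDerivAt f c t)
    (hm : ∀ s ∈ Icc t t1, f t ≤ f s) : 0 ≤ c := by
  have h1 := hf.hasDerivWithinAt (s := Ioi t)
  have h2 := hasDerivWithinAt_iff_tendsto_slope' (by simp) |>.1 h1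
  refine ge_of_tendsto h2 ?_
  filter_upwards [Ioo_mem_nhdsGT ht] with s hs
  rw [slope_def_field]
  exact div_nonneg (sub_nonneg.2 (hm s ⟨hs.1.le, hs.2.le⟩)) (sub_nonneg.2 hs.1.le)

lemma JetAt.derivT {w wt : Z d → ℝ} {G H} {z : Z d} (h : JetAt w wt G H z) :
    HasDerivAt (fun t => w (t, z.2)) (wt z) z.1 := by
  have h1 : HasDerivAt (fun t : ℝ => ((t, z.2) : Z d)) ((1 : ℝ), (0 : E d)) z.1 :=
    (hasDerivAt_id _).prodMk (hasDerivAt_const _ _)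
  have := h.hw.comp_hasDerivAt z.1 h1
  simpa [Function.comp_def] using this

lemma JetAt.derivX {w wt : Z d → ℝ} {G H} {t : ℝ} {x ξ : E d} {s : ℝ}
    (h : JetAt w wt G H (t, x + s • ξ)) :
    HasDerivAt (fun s : ℝ => w (t, x + s • ξ)) (inner ℝ (G (t, x + s • ξ)) ξ) s := by
  have h1 : HasDerivAt (fun s : ℝ => ((t, x + s • ξ) : Z d)) ((0 : ℝ), (1 : ℝ) • ξ) s :=
    (hasDerivAt_const _ _).prodMk (((hasDerivAt_id s).smul_const ξ).const_add x)
  have := h.hw.comp_hasDerivAt s h1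
  simpa [Function.comp_def] using this

lemma JetAt.derivXX {w wt : Z d → ℝ} {G H} {t : ℝ} {x ξ : E d}
    (h : JetAt w wt G H (t, x)) :
    HasDerivAt (fun s : ℝ => inner ℝ (G (t, x + s • ξ)) ξ) (quad (H (t, x)) ξ) 0 := by
  obtain ⟨q, hq⟩ := h.hG
  have h1 : HasDerivAt (fun s : ℝ => ((t, x + s • ξ) : Z d)) ((0 : ℝ), (1 : ℝ) • ξ) 0 :=
    (hasDerivAt_const _ _).prodMk (((hasDerivAt_id (0:ℝ)).smul_const ξ).const_add x)
  have h2 : (t, x) = ((t, x + (0:ℝ) • ξ) : Z d) := by simp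
  have h3 := hq
  nth_rewrite 2 [h2] at h3
  have := HasFDerivAt.comp_hasDerivAt (0:ℝ) h3 h1
  have h5 := this.inner ℝ (hasDerivAt_const (0:ℝ) ξ)
  simpa [inner_toE] using h5

/-- Properties of the contact set. -/
structure Contact (w wt : Z d → ℝ) (G : Z d → E d) (H : Z d → Matrix (Fin d) (Fin d) ℝ)
    (x1 : E d) (R t0 t1 m p0 : ℝ) (z : Z d) : Prop where
  t0le : t0 ≤ z.1
  ltt1 : z.1 < t1
  mem : z.2 ∈ Metric.ball x1 R
  neg : w z < 0
  jet : JetAt w wt G H z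
  wt_nonneg : 0 ≤ wt z
  psd : (H z).PosSemidef
  gle : ‖G z‖ ≤ p0
  above : ∀ t ∈ Icc z.1 t1, ∀ x ∈ Metric.closedBall x1 R, w z + inner ℝ (G z) (x - z.2) ≤ w (t, x)
  lneg : ∀ x, w z + inner ℝ (G z) (x - z.2) ≤ - (m / 4) + p0 * ‖x - x1‖

/-- Parabolic ABP. -/
lemma abp (x1 : E d) {R t0 t1 m p0 : ℝ} (hR : 0 < R) (ht : t0 < t1) (hm : 0 < m) (hp : 0 < p0)
    (hp0 : p0 * (8 * R) ≤ m) (w wt : Z d → ℝ) (G : Z d → E d) (H : Z d → Matrix (Fin d) (Fin d) ℝ)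
    (hc : ContinuousOn w (Icc t0 t1 ×ˢ Metric.closedBall x1 R))
    (hb : ∀ t ∈ Icc t0 t1, ∀ x ∈ Metric.sphere x1 R, 0 ≤ w (t, x))
    (htop : ∀ x ∈ Metric.closedBall x1 R, 0 ≤ w (t1, x))
    (x0 : E d) (hx0 : x0 ∈ Metric.closedBall x1 R) (hw0 : w (t0, x0) ≤ -m)
    (hj : ∀ t ∈ Ico t0 t1, ∀ x ∈ Metric.ball x1 R, w (t, x) < 0 → JetAt w wt G H (t, x)) :
    ∃ S : Set (Z d), IsCompact S ∧ (∀ z ∈ S, Contact w wt G H x1 R t0 t1 m p0 z) ∧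
      ENNReal.ofReal (m / 4) * volume (Metric.closedBall (0 : E d) p0) ≤
        ∫⁻ z in S, ENNReal.ofReal |wt z * (H z).det| := by
  set B := Metric.closedBall x1 R with hB
  set K := Icc t0 t1 ×ˢ B with hK
  have hKc : IsCompact K := isCompact_Icc.prod (isCompact_closedBall x1 R)
  set V : Set (Z d) := Icc (-(m/2)) (-(m/4)) ×ˢ Metric.closedBall (0 : E d) p0 with hV
  have hVc : IsCompact V := isCompact_Icc.prod (isCompact_closedBall _ _)
  let l : Z d → E d → ℝ := fun v x => v.1 + inner ℝ v.2 (x - x1)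
  have hlc : Continuous fun q : Z d × E d => l q.1 q.2 := by fun_prop
  have hl_le : ∀ v ∈ V, ∀ x, l v x ≤ -(m/4) + p0 * ‖x - x1‖ := by
    intro v hv x
    have h1 : inner ℝ v.2 (x - x1) ≤ ‖v.2‖ * ‖x - x1‖ := real_inner_le_norm _ _
    have h2 : ‖v.2‖ ≤ p0 := by simpa using hv.2
    have h3 := hv.1.2
    have := mul_le_mul_of_nonneg_right h2 (norm_nonneg (x - x1))
    simp only [l]; linarith
  have hl_neg : ∀ v ∈ V, ∀ x ∈ B, l v x < 0 := by
    intro v hv x hx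
    have h1 := hl_le v hv x
    have h2 : ‖x - x1‖ ≤ R := by simpa [dist_eq_norm, hB] using hx
    have := mul_le_mul_of_nonneg_left h2 hp.le
    linarith
  let T : Set (Z d × Z d) := (K ×ˢ V) ∩ ({q | q ∈ K ×ˢ V ∧ w q.1 - l q.2 q.1.2 = 0} ∩
    ⋂ (t ∈ Icc t0 t1) (x ∈ B), {q | q ∈ K ×ˢ V ∧ w (max t q.1.1, x) - l q.2 x ∈ Ici 0})
  have hKVc : IsCompact (K ×ˢ V) := hKc.prod hVc
  have hTc : IsCompact T := by
    refine hKVc.inter_right (IsClosed.inter ?_ ?_)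
    · have : ContinuousOn (fun q : Z d × Z d => w q.1 - l q.2 q.1.2) (K ×ˢ V) := by
        refine ContinuousOn.sub (hc.comp continuousOn_fst fun q hq => hq.1) ?_
        exact (hlc.comp (by fun_prop : Continuous fun q : Z d × Z d => (q.2, q.1.2))).continuousOn
      exact this.preimage_isClosed_of_isClosed hKVc.isClosed isClosed_singleton
    · refine isClosed_biInter fun t htt => isClosed_biInter fun x hx => ?_
      have : ContinuousOn (fun q : Z d × Z d => w (max t q.1.1, x) - l q.2 x) (K ×ˢ V) := by
        refine ContinuousOn.sub (hc.comp (by fun_prop) fun q hq => ?_) ?_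
        · exact ⟨⟨le_max_of_le_left htt.1, max_le htt.2 hq.1.1.2⟩, hx⟩
        exact (hlc.comp (by fun_prop : Continuous fun q : Z d × Z d => (q.2, x))).continuousOn
      exact this.preimage_isClosed_of_isClosed hKVc.isClosed isClosed_Ici
  let S : Set (Z d) := Prod.fst '' T
  have hSc : IsCompact S := hTc.image continuous_fst
  have hS : ∀ z ∈ S, z ∈ K ∧ ∃ v ∈ V, w z = l v z.2 ∧ ∀ t ∈ Icc z.1 t1, ∀ x ∈ B, l v x ≤ w (t, x) := by
    rintro z ⟨q, ⟨⟨hq1, hq2⟩, ⟨-, hq3⟩, hq4⟩, rfl⟩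
    refine ⟨hq1, q.2, hq2, sub_eq_zero.1 hq3, fun t htt x hx => ?_⟩
    simp only [mem_iInter] at hq4
    have := (hq4 t ⟨hq1.1.1.trans htt.1, htt.2⟩ x hx).2
    rw [max_eq_left htt.1] at this
    simpa using this
  have hCon : ∀ z ∈ S, Contact w wt G H x1 R t0 t1 m p0 z ∧
      ∃ v ∈ V, w z - inner ℝ (G z) (z.2 - x1) = v.1 ∧ G z = v.2 := by
    rintro ⟨t, x⟩ hz
    obtain ⟨hzK, v, hv, he, ha⟩ := hS _ hz
    have hneg : w (t, x) < 0 := by rw [he]; exact hl_neg v hv _ hzK.2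
    have ht1 : t < t1 := by
      rcases hzK.1.2.lt_or_eq with h | h
      · exact h
      · exfalso; simp only at h; rw [h] at hneg; linarith [htop x hzK.2]
    have hxb : x ∈ Metric.ball x1 R := by
      rcases (Metric.mem_closedBall.1 hzK.2).lt_or_eq with h | h
      · exact h
      · exfalso; linarith [hb t hzK.1 x h]
    have hjet := hj t ⟨hzK.1.1, ht1⟩ x hxb hneg
    have hminx : ∀ ξ ∈ B, w (t, x) - l v x ≤ w (t, ξ) - l v ξ := by
      intro ξ hξ
      have := ha t ⟨le_rfl, ht1.le⟩ ξ hξ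
      simp only at he
      linarith
    have hnear : ∀ ξ : E d, ∀ᶠ s in nhds (0:ℝ), x + s • ξ ∈ Metric.ball x1 R := by
      intro ξ
      have : Filter.Tendsto (fun s : ℝ => x + s • ξ) (nhds 0) (nhds x) := by
        have : Continuous fun s : ℝ => x + s • ξ := by fun_prop
        simpa using this.tendsto 0
      exact this.eventually (Metric.isOpen_ball.mem_nhds hxb)
    have hminline : ∀ ξ : E d, IsLocalMin (fun s : ℝ => w (t, x + s • ξ) - l v (x + s • ξ)) 0 := by
      intro ξ
      filter_upwards [hnear ξ] with s hs
      simpa using hminx _ (Metric.ball_subset_closedBall hs)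
    have hlder : ∀ (ξ : E d) (s : ℝ), HasDerivAt (fun s : ℝ => l v (x + s • ξ)) (inner ℝ v.2 ξ) s := by
      intro ξ s
      have h1 : HasDerivAt (fun s : ℝ => x + s • ξ - x1) ((1:ℝ) • ξ) s :=
        (((hasDerivAt_id s).smul_const ξ).const_add x).sub_const x1
      have := ((hasDerivAt_const s v.2).inner ℝ h1).const_add v.1
      simpa [l] using this
    have hjet0 : ∀ ξ : E d, JetAt w wt G H (t, x + (0:ℝ) • ξ) := by intro ξ; simpa using hjet
    have hGp : G (t, x) = v.2 := by
      apply ext_inner_right ℝ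
      intro ξ
      have h1 := ((hjet0 ξ).derivX).sub (hlder ξ 0)
      have := (hminline ξ).hasDerivAt_eq_zero h1
      simp at this
      linarith
    have hwt : 0 ≤ wt (t, x) := by
      refine right_deriv_nonneg ht1 hjet.derivT fun s hs => ?_
      have := ha s hs x hzK.2
      simp only at he ⊢
      rw [he]; exact this
    have hpsd : (H (t, x)).PosSemidef := by
      refine psd_of_quad hjet.sym fun ξ => ?_
      refine second_deriv_min (f := fun s : ℝ => w (t, x + s • ξ) - l v (x + s • ξ))
        (g := fun s : ℝ => inner ℝ (G (t, x + s • ξ)) ξ - inner ℝ v.2 ξ) ?_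
        (hjet.derivXX.sub_const _) (hminline ξ)
      have hcont : ContinuousAt (fun s : ℝ => w (t, x + s • ξ)) 0 := (hjet0 ξ).derivX.continuousAt
      have hneg' : ∀ᶠ s in nhds (0:ℝ), w (t, x + s • ξ) < 0 :=
        hcont.eventually (gt_mem_nhds (by simpa using hneg))
      filter_upwards [hneg', hnear ξ] with s h1 h2
      exact ((hj t ⟨hzK.1.1, ht1⟩ _ h2 h1).derivX).sub (hlder ξ s)
    have hlin : ∀ y, w (t, x) + inner ℝ (G (t, x)) (y - x) = l v y := by
      intro y
      have : y - x1 = (y - x) + (x - x1) := by abel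
      simp only [l, this, inner_add_right] at he ⊢
      rw [he, hGp]; ring
    refine ⟨⟨hzK.1.1, ht1, hxb, hneg, hjet, hwt, hpsd, ?_, ?_, ?_⟩, v, hv, ?_, hGp⟩
    · rw [hGp]; simpa using hv.2
    · intro s hs y hy
      simp only; rw [hlin]; exact ha s hs y hy
    · intro y; simp only; rw [hlin]; exact hl_le v hv y
    · have := hlin x1
      have e : x1 - x = -(x - x1) := by abel
      simp only [e, inner_neg_right] at this
      simp only
      rw [sub_eq_add_neg, this]; simp [l]
  refine ⟨S, hSc, fun z hz => (hCon z hz).1, ?_⟩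
  -- surjectivity
  let Φ : Z d → Z d := fun z => (w z - inner ℝ (G z) (z.2 - x1), G z)
  have hsurj : V ⊆ Φ '' S := by
    intro v hv
    let C : Set (Z d) := {z | z ∈ K ∧ w z - l v z.2 ∈ Iic 0}
    have hCc : IsCompact C := by
      refine hKc.of_isClosed_subset ?_ fun z hz => hz.1
      have : ContinuousOn (fun z : Z d => w z - l v z.2) K :=
        hc.sub (hlc.comp (by fun_prop : Continuous fun z : Z d => (v, z.2))).continuousOn
      exact this.preimage_isClosed_of_isClosed hKc.isClosed isClosed_Iic
    have hCne : C.Nonempty := by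
      refine ⟨(t0, x0), ⟨⟨le_rfl, ht.le⟩, hx0⟩, ?_⟩
      have h1 : -(‖v.2‖ * ‖x0 - x1‖) ≤ inner ℝ v.2 (x0 - x1) := by
        have := abs_real_inner_le_norm v.2 (x0 - x1)
        linarith [abs_le.1 this]
      have h2 : ‖v.2‖ ≤ p0 := by simpa using hv.2
      have h3 : ‖x0 - x1‖ ≤ R := by simpa [dist_eq_norm, hB] using hx0
      have h4 : ‖v.2‖ * ‖x0 - x1‖ ≤ p0 * R := mul_le_mul h2 h3 (norm_nonneg _) hp.le
      have h5 := hv.1.1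
      simp only [mem_Iic, l]
      nlinarith
    obtain ⟨z, hzC, hzm⟩ := hCc.exists_isMaxOn hCne continuous_fst.continuousOn
    have key : ∀ t ∈ Icc z.1 t1, ∀ x ∈ B, l v x ≤ w (t, x) := by
      intro t htt x hx
      by_contra hcon
      push Not at hcon
      have hcts : ContinuousOn (fun s => w (s, x) - l v x) (Icc t t1) := by
        refine ContinuousOn.sub (hc.comp (by fun_prop) ?_) continuousOn_const
        intro s hs
        exact ⟨⟨(hzC.1.1.1.trans htt.1).trans hs.1, hs.2⟩, hx⟩
      have h1 : (0:ℝ) ∈ Icc (w (t, x) - l v x) (w (t1, x) - l v x) :=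
        ⟨by linarith, by linarith [htop x hx, hl_neg v hv x hx]⟩
      obtain ⟨s, hs, hs0⟩ := intermediate_value_Icc htt.2 hcts h1
      have hsC : (s, x) ∈ C := ⟨⟨⟨(hzC.1.1.1.trans htt.1).trans hs.1, hs.2⟩, hx⟩, le_of_eq hs0⟩
      have h2 : s ≤ z.1 := hzm hsC
      have h3 : s = t := le_antisymm (h2.trans htt.1) hs.1
      simp only [h3] at hs0
      linarith
    have hze : w z = l v z.2 := by
      refine le_antisymm (by simpa using hzC.2) ?_
      exact key z.1 ⟨le_rfl, hzC.1.1.2⟩ z.2 hzC.1.2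
    have hzS : z ∈ S := by
      refine ⟨(z, v), ⟨⟨hzC.1, hv⟩, ⟨⟨hzC.1, hv⟩, sub_eq_zero.2 hze⟩, ?_⟩, rfl⟩
      simp only [mem_iInter]
      intro t htt x hx
      refine ⟨⟨hzC.1, hv⟩, ?_⟩
      have := key (max t z.1) ⟨le_max_right _ _, max_le htt.2 hzC.1.1.2⟩ x hx
      simpa using this
    obtain ⟨hcz, v', hv', h1, h2⟩ := hCon z hzS
    refine ⟨z, hzS, ?_⟩
    -- `G z = v.2` by minimality; rerun through the contact argument
    have hmin : ∀ x ∈ B, l v x ≤ w (z.1, x) := key z.1 ⟨le_rfl, hzC.1.1.2⟩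
    have hG : G z = v.2 := by
      apply ext_inner_right ℝ
      intro ξ
      have hjet0 : JetAt w wt G H (z.1, z.2 + (0:ℝ) • ξ) := by simpa using hcz.jet
      have hl : HasDerivAt (fun s : ℝ => l v (z.2 + s • ξ)) (inner ℝ v.2 ξ) 0 := by
        have h1 : HasDerivAt (fun s : ℝ => z.2 + s • ξ - x1) ((1:ℝ) • ξ) 0 :=
          (((hasDerivAt_id (0:ℝ)).smul_const ξ).const_add z.2).sub_const x1
        have := ((hasDerivAt_const (0:ℝ) v.2).inner ℝ h1).const_add v.1
        simpa [l] using this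
      have hmn : IsLocalMin (fun s : ℝ => w (z.1, z.2 + s • ξ) - l v (z.2 + s • ξ)) 0 := by
        have : Filter.Tendsto (fun s : ℝ => z.2 + s • ξ) (nhds 0) (nhds z.2) := by
          have : Continuous fun s : ℝ => z.2 + s • ξ := by fun_prop
          simpa using this.tendsto 0
        filter_upwards [this.eventually (Metric.isOpen_ball.mem_nhds hcz.mem)] with s hs
        have := hmin _ (Metric.ball_subset_closedBall hs)
        simp only [zero_smul, add_zero]
        linarith
      have := hmn.hasDerivAt_eq_zero (hjet0.derivX.sub hl)
      simp at this
      linarith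
    simp only [Φ]
    rw [hG, hze]
    simp [l]
  have hder : ∀ z, ∃ A : Z d →L[ℝ] Z d, z ∈ S → HasFDerivAt Φ A z ∧ A.det = wt z * (H z).det := by
    intro z
    by_cases hz : z ∈ S
    swap
    · exact ⟨0, fun h => absurd h hz⟩
    have hjet := (hCon z hz).1.jet
    obtain ⟨q, hq⟩ := hjet.hG
    have h1 : HasFDerivAt (fun z : Z d => z.2 - x1) (ContinuousLinearMap.snd ℝ ℝ (E d)) z :=
      hasFDerivAt_snd.sub_const x1
    have h2 := (hjet.hw.sub (hq.inner ℝ h1)).prodMk hq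
    refine ⟨_, fun _ => ⟨h2, ?_⟩⟩
    refine det_jet (z.2 - x1) q (wt z) (H z) _ fun τ ξ => ?_
    ext
    · simp [fderivInnerCLM_apply]
      ring
    · simp
  choose A hA using hder
  calc ENNReal.ofReal (m / 4) * volume (Metric.closedBall (0 : E d) p0) = volume V := by
        rw [hV, Measure.volume_eq_prod, Measure.prod_prod, Real.volume_Icc]
        congr 2; ring
    _ ≤ volume (Φ '' S) := measure_mono hsurj
    _ ≤ ∫⁻ z in S, ENNReal.ofReal |(A z).det| :=
        addHaar_image_le_lintegral_abs_det_fderiv volume hSc.measurableSet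
          fun z hz => (hA z hz).1.hasFDerivWithinAt
    _ = ∫⁻ z in S, ENNReal.ofReal |wt z * (H z).det| := by
        refine setLIntegral_congr_fun hSc.measurableSet fun z hz => ?_
        simp only [(hA z hz).2]

end LinEst

namespace LinEst
variable {d : ℕ}

lemma JetAt.sub {w wt : Z d → ℝ} {G H} {w' wt' : Z d → ℝ} {G' H'} {z : Z d}
    (h : JetAt w wt G H z) (h' : JetAt w' wt' G' H' z) :
    JetAt (fun z => w z - w' z) (fun z => wt z - wt' z) (fun z => G z - G' z)
      (fun z => H z - H' z) z := by
  refine ⟨?_, ?_, h.sym.sub h'.sym⟩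
  · refine (h.hw.sub h'.hw).congr_fderiv ?_
    ext <;> simp [inner_sub_left]
  · obtain ⟨q, hq⟩ := h.hG
    obtain ⟨q', hq'⟩ := h'.hG
    refine ⟨q - q', (hq.sub hq').congr_fderiv ?_⟩
    ext <;> simp [map_sub]

lemma JetAt.poly (α k e : ℝ) (p x0 : E d) (z : Z d) :
    JetAt (fun z => α + inner ℝ p (z.2 - x0) + k / 2 * ‖z.2 - x0‖ ^ 2 + e * z.1) (fun _ => e)
      (fun z => p + k • (z.2 - x0)) (fun _ => k • (1 : Matrix (Fin d) (Fin d) ℝ)) z := by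
  have h1 : HasFDerivAt (fun z : Z d => z.2 - x0) (ContinuousLinearMap.snd ℝ ℝ (E d)) z :=
      hasFDerivAt_snd.sub_const x0
  refine ⟨?_, ⟨0, ?_⟩, Matrix.isSymm_one.smul k⟩
  · have h2 := ((((hasFDerivAt_const p z).inner ℝ h1).const_add α).add
      ((h1.norm_sq).const_mul (k/2))).add ((hasFDerivAt_fst (p := z)).const_mul e)
    refine h2.congr_fderiv ?_
    ext
    · simp [fderivInnerCLM_apply]
    · simp [fderivInnerCLM_apply, inner_add_left, inner_smul_left]
      ring
  · have h2 := (h1.const_smul k).const_add p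
    refine h2.congr_fderiv ?_
    ext <;> simp [map_smul]

lemma JetAt.congr {w wt : Z d → ℝ} {G H} {w' wt' : Z d → ℝ} {G' H'} {z : Z d}
    (h : JetAt w wt G H z) (h1 : w = w') (h2 : wt = wt') (h3 : G = G') (h4 : H = H') :
    JetAt w' wt' G' H' z := by
  subst h1 h2 h3 h4; exact h

/-- ABP constant -/
def cA (d : ℕ) (δ : ℝ) : ℝ :=
  4 * (d.factorial : ℝ) * (δ⁻¹) ^ (d + 1) / (volume (Metric.closedBall (0 : E d) 1)).toReal

lemma vol_ball_pos (d : ℕ) : 0 < (volume (Metric.closedBall (0 : E d) 1)).toReal := by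
  refine ENNReal.toReal_pos (Metric.measure_closedBall_pos _ _ one_pos).ne' ?_
  exact measure_closedBall_lt_top.ne

lemma cA_pos {δ : ℝ} (hδ : 0 < δ) : 0 < cA d δ := by
  have := vol_ball_pos d
  unfold cA; positivity

lemma Contact.det_le {w wt : Z d → ℝ} {G H} {x1 : E d} {R t0 t1 m p0 : ℝ} {z : Z d}
    (h : Contact w wt G H x1 R t0 t1 m p0 z) {δ : ℝ} (hδ : 0 < δ) (hδ1 : δ ≤ 1)
    {a : Matrix (Fin d) (Fin d) ℝ} (ha : Ell δ a) {F : ℝ} (hF : wt z + ctr a (H z) ≤ F) :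
    |wt z * (H z).det| ≤ (d.factorial : ℝ) * (δ⁻¹) ^ (d + 1) * F ^ (d + 1) := by
  have h1 := psd_det h.psd
  have h2 := ha.ctr_ge h.psd
  have h3 := h.psd.trace_nonneg
  have h4 := h.wt_nonneg
  have hF' : δ * (wt z + (H z).trace) ≤ F := by nlinarith
  have h5 : wt z + (H z).trace ≤ δ⁻¹ * F := by
    rw [inv_mul_eq_div, le_div_iff₀ hδ]; linarith
  rw [abs_mul, abs_of_nonneg h4]
  calc wt z * |(H z).det| ≤ wt z * ((d.factorial : ℝ) * (H z).trace ^ d) := by gcongr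
    _ = (d.factorial : ℝ) * (wt z * (H z).trace ^ d) := by ring
    _ ≤ (d.factorial : ℝ) * ((wt z + (H z).trace) * (wt z + (H z).trace) ^ d) := by
        gcongr <;> linarith
    _ = (d.factorial : ℝ) * (wt z + (H z).trace) ^ (d + 1) := by ring
    _ ≤ (d.factorial : ℝ) * (δ⁻¹ * F) ^ (d + 1) := by gcongr
    _ = _ := by rw [mul_pow]; ring

lemma abp_F (x1 : E d) {R t0 t1 m p0 : ℝ} (hm : 0 < m) (hp : 0 < p0)
    {w wt : Z d → ℝ} {G : Z d → E d} {H : Z d → Matrix (Fin d) (Fin d) ℝ}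
    {S : Set (Z d)} (hSc : IsCompact S) (hS : ∀ z ∈ S, Contact w wt G H x1 R t0 t1 m p0 z)
    (hI : ENNReal.ofReal (m / 4) * volume (Metric.closedBall (0 : E d) p0) ≤
        ∫⁻ z in S, ENNReal.ofReal |wt z * (H z).det|)
    {δ : ℝ} (hδ : 0 < δ) (hδ1 : δ ≤ 1) (a : Z d → Matrix (Fin d) (Fin d) ℝ) (ha : ∀ z, Ell δ (a z))
    (f : Z d → ℝ) (hf0 : ∀ z, 0 ≤ f z) (c : ℝ) (hc : 0 ≤ c)
    (hF : ∀ z ∈ S, wt z + ctr (a z) (H z) ≤ f z + c)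
    {b : ℝ} (hb : 0 ≤ b) (hfb : ∫⁻ z in S, ENNReal.ofReal (f z) ^ (d + 1) ≤ ENNReal.ofReal b) :
    m * p0 ^ d ≤ cA d δ * 2 ^ d * (b + c ^ (d + 1) * (volume S).toReal) := by
  have hω := vol_ball_pos d
  set ω := (volume (Metric.closedBall (0 : E d) 1)).toReal with hωd
  have hvol : volume (Metric.closedBall (0 : E d) p0) = ENNReal.ofReal (p0 ^ d * ω) := by
    rw [Measure.addHaar_closedBall' _ _ hp.le, hωd, ENNReal.ofReal_mul (by positivity),
      ENNReal.ofReal_toReal measure_closedBall_lt_top.ne]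
    simp
  set k := (d.factorial : ℝ) * (δ⁻¹) ^ (d + 1) with hk
  have hk0 : 0 < k := by positivity
  have hSfin : volume S ≠ ⊤ := hSc.measure_lt_top.ne
  have hle : ∫⁻ z in S, ENNReal.ofReal |wt z * (H z).det| ≤
      ENNReal.ofReal (k * 2 ^ d * (b + c ^ (d + 1) * (volume S).toReal)) := by
    calc ∫⁻ z in S, ENNReal.ofReal |wt z * (H z).det|
        ≤ ∫⁻ z in S, (ENNReal.ofReal (k * 2 ^ d) * ENNReal.ofReal (f z) ^ (d + 1) +
            ENNReal.ofReal (k * 2 ^ d * c ^ (d + 1))) := by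
          refine setLIntegral_mono' hSc.measurableSet fun z hz => ?_
          rw [← ENNReal.ofReal_pow (hf0 z), ← ENNReal.ofReal_mul (by positivity),
            ← ENNReal.ofReal_add (by have := hf0 z; positivity) (by positivity)]
          apply ENNReal.ofReal_le_ofReal
          refine ((hS z hz).det_le hδ hδ1 (ha z) (hF z hz)).trans ?_
          have := add_pow_le (hf0 z) hc (d + 1)
          simp only [Nat.add_sub_cancel] at this
          calc k * (f z + c) ^ (d + 1) ≤ k * (2 ^ d * (f z ^ (d + 1) + c ^ (d + 1))) := by gcongr
            _ = _ := by ring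
      _ = ENNReal.ofReal (k * 2 ^ d) * (∫⁻ z in S, ENNReal.ofReal (f z) ^ (d + 1)) +
            ENNReal.ofReal (k * 2 ^ d * c ^ (d + 1)) * volume S := by
          rw [lintegral_add_right _ measurable_const, lintegral_const_mul' _ _ ENNReal.ofReal_ne_top,
            setLIntegral_const]
      _ ≤ ENNReal.ofReal (k * 2 ^ d) * ENNReal.ofReal b +
            ENNReal.ofReal (k * 2 ^ d * c ^ (d + 1)) * ENNReal.ofReal (volume S).toReal := by
          rw [ENNReal.ofReal_toReal hSfin]
          gcongr
      _ = _ := by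
          rw [← ENNReal.ofReal_mul (by positivity), ← ENNReal.ofReal_mul (by positivity),
            ← ENNReal.ofReal_add (by positivity) (by positivity)]
          congr 1; ring
  have h1 := hI.trans hle
  rw [hvol, ← ENNReal.ofReal_mul (by positivity),
    ENNReal.ofReal_le_ofReal_iff (by positivity)] at h1
  have h2 : cA d δ = 4 * k / ω := by rw [cA, hk, hωd]; ring
  rw [h2]
  have : m * p0 ^ d * ω ≤ 4 * k * 2 ^ d * (b + c ^ (d + 1) * (volume S).toReal) := by nlinarith
  calc m * p0 ^ d = m * p0 ^ d * ω / ω := by field_simp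
    _ ≤ 4 * k * 2 ^ d * (b + c ^ (d + 1) * (volume S).toReal) / ω := by gcongr
    _ = _ := by ring

/-- one-sided equation with terminal orientation -/
structure Sub (δ K T ϱ : ℝ) (v vt : Z d → ℝ) (G : Z d → E d) (H : Z d → Matrix (Fin d) (Fin d) ℝ)
    (a : Z d → Matrix (Fin d) (Fin d) ℝ) (f : Z d → ℝ) : Prop where
  jet : ∀ z, JetAt v vt G H z
  ell : ∀ z, Ell δ (a z)
  bd : ∀ t ∈ Icc 0 T, ∀ x ∈ Metric.closedBall (0 : E d) ϱ, |v (t, x)| ≤ 1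
  f0 : ∀ z, 0 ≤ f z
  fm : Measurable f
  eq : ∀ t ∈ Icc 0 T, ∀ x ∈ Metric.closedBall (0 : E d) ϱ,
    vt (t, x) + ctr (a (t, x)) (H (t, x)) ≤ f (t, x) + K * ‖G (t, x)‖
  fint : ∫⁻ z in Icc 0 T ×ˢ Metric.closedBall (0 : E d) ϱ, ENNReal.ofReal (f z) ^ (d + 1) ≤ 1

/-- points touched from below by a concave paraboloid of opening `M` -/
def AM (T ϱ : ℝ) (v : Z d → ℝ) (G : Z d → E d) (M : ℝ) : Set (Z d) :=
  {z | z.1 ∈ Icc 0 T ∧ z.2 ∈ Metric.closedBall (0 : E d) (ϱ - 1) ∧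
    ∀ t ∈ Icc z.1 T, ∀ x ∈ Metric.closedBall (0 : E d) ϱ,
      v z + inner ℝ (G z) (x - z.2) - M / 2 * ‖x - z.2‖ ^ 2 - M * (t - z.1) ≤ v (t, x)}

variable {δ K T ϱ : ℝ} {v vt : Z d → ℝ} {G : Z d → E d} {H : Z d → Matrix (Fin d) (Fin d) ℝ}
    {a : Z d → Matrix (Fin d) (Fin d) ℝ} {f : Z d → ℝ}

lemma Sub.cont (h : Sub δ K T ϱ v vt G H a f) : Continuous v :=
  continuous_iff_continuousAt.2 fun z => (h.jet z).hw.continuousAt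

lemma Sub.contG (h : Sub δ K T ϱ v vt G H a f) : Continuous G :=
  continuous_iff_continuousAt.2 fun z => by
    obtain ⟨q, hq⟩ := (h.jet z).hG
    exact hq.continuousAt

lemma AM.grad (h : Sub δ K T ϱ v vt G H a f) {M : ℝ} (hM : 0 ≤ M) {z : Z d}
    (hz : z ∈ AM T ϱ v G M) : ‖G z‖ ≤ 2 + M / 2 := by
  obtain ⟨h1, h2, h3⟩ := hz
  have hz2 : ‖z.2‖ ≤ ϱ - 1 := by simpa using h2
  by_cases h0 : G z = 0
  · rw [h0, norm_zero]; linarith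
  have hn : 0 < ‖G z‖ := norm_pos_iff.2 h0
  set e := (‖G z‖)⁻¹ • G z with he
  have hen : ‖e‖ = 1 := by rw [he, norm_smul, norm_inv, norm_norm]; field_simp
  have hx : z.2 + e ∈ Metric.closedBall (0 : E d) ϱ := by
    have := norm_add_le z.2 e
    simp; linarith
  have h4 := h3 z.1 ⟨le_rfl, h1.2⟩ (z.2 + e) hx
  have h5 := abs_le.1 (h.bd z.1 h1 _ hx)
  have h6 := abs_le.1 (h.bd z.1 h1 z.2 (by simp; linarith))
  have h7 : inner ℝ (G z) e = ‖G z‖ := by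
    rw [he, inner_smul_right, real_inner_self_eq_norm_sq]; field_simp
  simp [h7, hen] at h4
  linarith [h5.2, h6.1]

end LinEst

namespace LinEst
variable {d : ℕ}
variable {δ K T ϱ : ℝ} {v vt : Z d → ℝ} {G : Z d → E d} {H : Z d → Matrix (Fin d) (Fin d) ℝ}
    {a : Z d → Matrix (Fin d) (Fin d) ℝ} {f : Z d → ℝ}

lemma AM.closed (h : Sub δ K T ϱ v vt G H a f) (M : ℝ) : IsClosed (AM T ϱ v G M) := by
  have hv := h.cont
  have hG := h.contG
  have : AM T ϱ v G M = {z : Z d | z.1 ∈ Icc 0 T} ∩ ({z : Z d | z.2 ∈ Metric.closedBall (0 : E d) (ϱ - 1)} ∩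
    ⋂ (t ∈ Icc 0 T) (x ∈ Metric.closedBall (0 : E d) ϱ), {z : Z d |
      v z + inner ℝ (G z) (x - z.2) - M / 2 * ‖x - z.2‖ ^ 2 - M * (max t z.1 - z.1) ≤ v (max t z.1, x)}) := by
    ext z
    simp only [AM, mem_ofPred_eq, mem_inter_iff, mem_iInter]
    refine and_congr_right fun h1 => and_congr_right fun h2 => ⟨fun h3 t ht x hx => ?_, fun h3 t ht x hx => ?_⟩
    · exact h3 _ ⟨le_max_right _ _, max_le ht.2 h1.2⟩ x hx
    · have := h3 t ⟨h1.1.trans ht.1, ht.2⟩ x hx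
      rwa [max_eq_left ht.1] at this
  rw [this]
  refine (isClosed_Icc.preimage continuous_fst).inter
    ((Metric.isClosed_closedBall.preimage continuous_snd).inter ?_)
  refine isClosed_biInter fun t _ => isClosed_biInter fun x _ => isClosed_le ?_ ?_ <;> fun_prop

lemma AM.vt_ge (h : Sub δ K T ϱ v vt G H a f) {M : ℝ} {z : Z d} (hz : z ∈ AM T ϱ v G M)
    (hT : z.1 < T) : -M ≤ vt z := by
  obtain ⟨h1, h2, h3⟩ := hz
  have hz2 : ‖z.2‖ ≤ ϱ - 1 := by simpa using h2
  have h4 := ((h.jet z).derivT).add ((hasDerivAt_id z.1).const_mul M)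
  have := right_deriv_nonneg hT h4 fun s hs => ?_
  · simp at this; linarith
  · have := h3 s hs z.2 (by simp; linarith)
    simp at this ⊢
    linarith

lemma AM.psd (h : Sub δ K T ϱ v vt G H a f) {M : ℝ} {z : Z d} (hz : z ∈ AM T ϱ v G M) :
    (H z + M • (1 : Matrix (Fin d) (Fin d) ℝ)).PosSemidef := by
  obtain ⟨h1, h2, h3⟩ := hz
  have hz2 : ‖z.2‖ ≤ ϱ - 1 := by simpa using h2
  obtain ⟨t, x⟩ := z
  refine psd_of_quad ((h.jet _).sym.add (Matrix.isSymm_one.smul M)) fun ξ => ?_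
  rw [quad_add, quad_smul, quad_one]
  refine second_deriv_min
    (f := fun s : ℝ => v (t, x + s • ξ) - s * inner ℝ (G (t, x)) ξ + s ^ 2 * (M / 2 * ‖ξ‖ ^ 2))
    (g := fun s : ℝ => inner ℝ (G (t, x + s • ξ)) ξ - inner ℝ (G (t, x)) ξ + s * (M * ‖ξ‖ ^ 2))
    (Filter.Eventually.of_forall fun s => ?_) ?_ ?_
  · have := (((h.jet (t, x + s • ξ)).derivX).sub ((hasDerivAt_id s).mul_const (inner ℝ (G (t, x)) ξ))).add
      (((hasDerivAt_id s).pow 2).mul_const (M / 2 * ‖ξ‖ ^ 2))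
    refine this.congr_deriv ?_
    simp; ring
  · have := (((h.jet (t, x)).derivXX (ξ := ξ)).sub_const (inner ℝ (G (t, x)) ξ)).add
      ((hasDerivAt_id (0:ℝ)).mul_const (M * ‖ξ‖ ^ 2))
    exact this.congr_deriv (by simp)
  · have : Filter.Tendsto (fun s : ℝ => x + s • ξ) (nhds 0) (nhds x) := by
      have : Continuous fun s : ℝ => x + s • ξ := by fun_prop
      simpa using this.tendsto 0
    have hx : x ∈ Metric.ball (0 : E d) ϱ := by
      simp at hz2 ⊢; linarith
    filter_upwards [this.eventually (Metric.isOpen_ball.mem_nhds hx)] with s hs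
    have := h3 t ⟨le_rfl, h1.2⟩ _ (Metric.ball_subset_closedBall hs)
    simp [norm_smul, inner_smul_right, mul_pow] at this ⊢
    linarith

lemma frob_le_of_entry {A : Matrix (Fin d) (Fin d) ℝ} {k : ℝ} (hk : 0 ≤ k) (h : ∀ i j, |A i j| ≤ k) :
    frobNorm A ≤ d * k := by
  rw [frobNorm]
  apply Real.sqrt_le_iff.2
  refine ⟨by positivity, ?_⟩
  calc ∑ i, ∑ j, A i j ^ 2 ≤ ∑ _i : Fin d, ∑ _j : Fin d, k ^ 2 := by
        refine Finset.sum_le_sum fun i _ => Finset.sum_le_sum fun j _ => ?_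
        exact sq_le_sq' (by linarith [abs_le.1 (h i j)]) (abs_le.1 (h i j)).2
    _ = (d * k) ^ 2 := by simp; ring

/-- constant in the operator bound -/
def cL (d : ℕ) (δ K : ℝ) : ℝ := 3 * K + 2 * (1 + d * δ⁻¹)

lemma cL_pos (hδ : 0 < δ) (hK : 0 ≤ K) : 0 < cL d δ K := by
  unfold cL; positivity

lemma AM.frob (h : Sub δ K T ϱ v vt G H a f) (hδ : 0 < δ) (hK : 0 ≤ K) {M : ℝ} (hM : 1 ≤ M)
    {z : Z d} (hz : z ∈ AM T ϱ v G M) (hT : z.1 < T) :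
    frobNorm (H z) ≤ d * (δ⁻¹ * (f z + cL d δ K * M) + M) := by
  have h1 := AM.vt_ge h hz hT
  have h2 := AM.psd h hz
  have h3 := (h.ell z).ctr_ge h2
  rw [ctr_add, ctr_smul, ctr_one] at h3
  have h4 := (h.ell z).trace_le
  have hz2 : ‖z.2‖ ≤ ϱ - 1 := by simpa using hz.2.1
  have h5 := h.eq z.1 hz.1 z.2 (by simp; linarith)
  have h6 := AM.grad h (by linarith) hz
  have h7 : K * ‖G z‖ ≤ K * (2 + M / 2) := by gcongr
  have h8 : M * (a z).trace ≤ M * (d * δ⁻¹) := by gcongr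
  have h9 := h2.trace_nonneg
  have hf := h.f0 z
  have hcl := cL_pos (d := d) hδ hK
  have h10 : (H z + M • (1 : Matrix (Fin d) (Fin d) ℝ)).trace ≤ δ⁻¹ * (f z + cL d δ K * M) := by
    rw [inv_mul_eq_div, le_div_iff₀ hδ, cL]
    have e1 : K * (2 + M / 2) ≤ 3 * K * M := by nlinarith
    have e2 : 0 ≤ d * δ⁻¹ * M := by positivity
    simp only [Prod.mk.eta] at h5
    nlinarith
  refine frob_le_of_entry (by positivity) fun i j => ?_
  have h11 := psd_entry h2 i j
  have h12 : H z i j = (H z + M • (1 : Matrix (Fin d) (Fin d) ℝ)) i j - M * (1 : Matrix (Fin d) (Fin d) ℝ) i j := by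
    simp
  have h13 : |M * (1 : Matrix (Fin d) (Fin d) ℝ) i j| ≤ M := by
    by_cases hij : i = j
    · subst hij; simp; rw [abs_of_nonneg]; linarith
    · simp [hij]; linarith
  rw [h12]
  refine (abs_sub _ _).trans ?_
  linarith

/-- Step 2: from a minorising paraboloid and a nearby point to many points of the next contact set. -/
lemma step2 (h : Sub δ K T ϱ v vt G H a f) (hδ : 0 < δ) (hδ1 : δ ≤ 1) (hK : 0 ≤ K)
    {M M2 R t0 τ1 α : ℝ} {p x0 x1 : E d} (hM : 0 ≤ M) (hMM : M ≤ M2) (hM2 : 1 ≤ M2) (hR : 0 < R)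
    (hP : ∀ t ∈ Icc t0 T, ∀ x ∈ Metric.closedBall (0 : E d) ϱ,
      α + inner ℝ p (x - x0) - M / 2 * ‖x - x0‖ ^ 2 - M * (t - t0) ≤ v (t, x))
    (ht0 : t0 ≤ τ1) (hτ0 : 0 ≤ τ1) (hτT : τ1 + R ^ 2 / 4 ≤ T) (hx1 : ‖x1‖ + R ≤ ϱ - 1)
    (hclose : v (τ1, x1) - (α + inner ℝ p (x1 - x0) - M / 2 * ‖x1 - x0‖ ^ 2 - M * (τ1 - t0)) ≤
      M2 * R ^ 2 / 8)
    {b : ℝ} (hb : 0 ≤ b)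
    (hfb : ∫⁻ z in Ico τ1 (τ1 + R ^ 2 / 4) ×ˢ Metric.ball x1 R, ENNReal.ofReal (f z) ^ (d + 1)
      ≤ ENNReal.ofReal b) :
    ∃ S : Set (Z d), IsCompact S ∧ S ⊆ Ico τ1 (τ1 + R ^ 2 / 4) ×ˢ Metric.ball x1 R ∧
      S ⊆ AM T ϱ v G (M + M2) ∧
      M2 ^ (d + 1) * R ^ (d + 2) / (8 * 64 ^ d) ≤
        cA d δ * 2 ^ d * (b + (cL d δ K * M2) ^ (d + 1) * (volume S).toReal) := by
  have hR2 : 0 < R ^ 2 := by positivity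
  set τ2 := τ1 + R ^ 2 / 4 with hτ2
  have hM2' : 0 < M2 := by linarith
  let pP : Z d → ℝ := fun z => (α + M * t0) + inner ℝ p (z.2 - x0) + (-M) / 2 * ‖z.2 - x0‖ ^ 2 + (-M) * z.1
  let pQ : Z d → ℝ := fun z => (M2 * (R ^ 2 / 4) + M2 * τ1) + inner ℝ (0 : E d) (z.2 - x1) + (-M2) / 2 * ‖z.2 - x1‖ ^ 2 + (-M2) * z.1
  let w : Z d → ℝ := fun z => v z - pP z - pQ z
  let wt : Z d → ℝ := fun z => vt z - (-M) - (-M2)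
  let Gw : Z d → E d := fun z => G z - (p + (-M) • (z.2 - x0)) - (0 + (-M2) • (z.2 - x1))
  let Hw : Z d → Matrix (Fin d) (Fin d) ℝ := fun z => H z - (-M) • 1 - (-M2) • 1
  have hjet : ∀ z, JetAt w wt Gw Hw z := fun z =>
    ((h.jet z).sub (JetAt.poly _ _ _ _ _ z)).sub (JetAt.poly _ _ _ _ _ z)
  have hwc : Continuous w := continuous_iff_continuousAt.2 fun z => (hjet z).hw.continuousAt
  have hPv : ∀ t ∈ Icc t0 T, ∀ x ∈ Metric.closedBall (0 : E d) ϱ, pP (t, x) ≤ v (t, x) := by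
    intro t ht x hx
    have := hP t ht x hx
    simp only [pP]; linarith
  have hball : ∀ x ∈ Metric.closedBall x1 R, x ∈ Metric.closedBall (0 : E d) ϱ := by
    intro x hx
    rw [mem_closedBall_iff_norm] at hx
    have := norm_le_norm_add_norm_sub' x x1
    simp; linarith
  have hQ : ∀ t x, pQ (t, x) = M2 * (R ^ 2 / 4 - ‖x - x1‖ ^ 2 / 2 - (t - τ1)) := by
    intro t x; simp only [pQ, inner_zero_left]; ring
  obtain ⟨S, hSc, hS, hI⟩ := abp x1 (R := R) (t0 := τ1) (t1 := τ2) (m := M2 * R ^ 2 / 8)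
    (p0 := M2 * R / 64) hR (by linarith) (by positivity) (by positivity) (by nlinarith) w wt Gw Hw
    hwc.continuousOn
    (by
      intro t ht x hx
      have h1 := hPv t ⟨ht0.trans ht.1, ht.2.trans hτT⟩ x (hball x (Metric.sphere_subset_closedBall hx))
      have h2 : ‖x - x1‖ = R := by simpa [dist_eq_norm] using hx
      have h3 : pQ (t, x) ≤ 0 := by
        rw [hQ, h2]
        exact mul_nonpos_of_nonneg_of_nonpos hM2'.le (by linarith [ht.1])
      simp only [w]; linarith)
    (by
      intro x hx
      have h1 := hPv τ2 ⟨by linarith, hτT⟩ x (hball x hx)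
      have h3 : pQ (τ2, x) ≤ 0 := by
        rw [hQ]
        exact mul_nonpos_of_nonneg_of_nonpos hM2'.le (by nlinarith [sq_nonneg ‖x - x1‖])
      simp only [w]; linarith)
    x1 (Metric.mem_closedBall_self hR.le)
    (by
      have e : pQ (τ1, x1) = M2 * (R ^ 2 / 4) := by rw [hQ]; simp
      simp only [w, e]
      simp only [pP]; linarith)
    (fun t _ x _ _ => hjet (t, x))
  have hSsub : S ⊆ Ico τ1 τ2 ×ˢ Metric.ball x1 R := fun z hz =>
    ⟨⟨(hS z hz).t0le, (hS z hz).ltt1⟩, (hS z hz).mem⟩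
  have hSA : S ⊆ AM T ϱ v G (M + M2) := by
    intro z hz
    have hz' := hS z hz
    refine ⟨⟨hτ0.trans hz'.t0le, hz'.ltt1.le.trans hτT⟩, ?_, ?_⟩
    · have h1 := mem_ball_iff_norm.1 hz'.mem
      have := norm_le_norm_add_norm_sub' z.2 x1
      simp; linarith
    intro t ht x hx
    -- exact expansion
    have hexp : v z + inner ℝ (G z) (x - z.2) - (M + M2) / 2 * ‖x - z.2‖ ^ 2 - (M + M2) * (t - z.1)
        = pP (t, x) + pQ (t, x) + (w z + inner ℝ (Gw z) (x - z.2)) := by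
      have e0 : x - x0 = (x - z.2) + (z.2 - x0) := by abel
      have e1 : x - x1 = (x - z.2) + (z.2 - x1) := by abel
      simp only [w, pP, pQ, Gw, e0, e1]
      generalize x - z.2 = y
      generalize z.2 - x0 = y0
      generalize z.2 - x1 = y1
      simp only [inner_sub_left, inner_add_left, real_inner_smul_left,
        norm_add_sq_real, inner_add_right, inner_zero_left]
      rw [real_inner_comm y y0, real_inner_comm y y1]
      ring
    rw [hexp]
    by_cases hin : t ≤ τ2 ∧ x ∈ Metric.closedBall x1 R
    · have := hz'.above t ⟨ht.1, hin.1⟩ x hin.2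
      have e : w (t, x) = v (t, x) - pP (t, x) - pQ (t, x) := rfl
      linarith
    · have h1 := hPv t ⟨ht0.trans (hz'.t0le.trans ht.1), ht.2⟩ x hx
      have h2 := hz'.lneg x
      have h3 : pQ (t, x) + (-(M2 * R ^ 2 / 8 / 4) + M2 * R / 64 * ‖x - x1‖) ≤ 0 := by
        rw [hQ]
        have ht1 : τ1 ≤ t := hz'.t0le.trans ht.1
        have hn := norm_nonneg (x - x1)
        have hkey : (R ^ 2 / 4 - ‖x - x1‖ ^ 2 / 2 - (t - τ1)) + (-(R ^ 2 / 8 / 4) + R / 64 * ‖x - x1‖) ≤ 0 := by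
          by_cases hxx : ‖x - x1‖ ≤ R
          · have : τ2 < t := by
              by_contra hcon
              exact hin ⟨not_lt.1 hcon, mem_closedBall_iff_norm.2 hxx⟩
            nlinarith
          · push Not at hxx
            nlinarith
        calc _ = M2 * ((R ^ 2 / 4 - ‖x - x1‖ ^ 2 / 2 - (t - τ1)) + (-(R ^ 2 / 8 / 4) + R / 64 * ‖x - x1‖)) := by ring
          _ ≤ 0 := mul_nonpos_of_nonneg_of_nonpos hM2'.le hkey
      linarith
  refine ⟨S, hSc, hSsub, hSA, ?_⟩
  have hcl := cL_pos (d := d) hδ hK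
  have := abp_F x1 (by positivity) (by positivity) hSc hS hI hδ hδ1 a h.ell f h.f0 (cL d δ K * M2)
    (by positivity) (fun z hz => ?_) hb ((lintegral_mono_set hSsub).trans hfb)
  · calc _ = M2 * R ^ 2 / 8 * (M2 * R / 64) ^ d := by
          rw [div_pow, mul_pow]; field_simp; ring
      _ ≤ _ := this
  · have hzS := hSsub hz
    have h1 := AM.grad h (by linarith) (hSA hz)
    have h2 := h.eq z.1 ⟨hτ0.trans hzS.1.1, hzS.1.2.le.trans hτT⟩ z.2 (hball _ (Metric.ball_subset_closedBall hzS.2))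
    have h4 := (h.ell z).trace_le
    have h5 : ctr (a z) (Hw z) = ctr (a z) (H z) + (M + M2) * (a z).trace := by
      simp only [Hw, ctr_sub, ctr_smul, ctr_one]; ring
    rw [h5]
    simp only [wt, cL]
    simp only [Prod.mk.eta] at h2
    have h6 : K * ‖G z‖ ≤ K * (3 * M2) := by gcongr; linarith
    have h7 : (M + M2) * (a z).trace ≤ (2 * M2) * (d * δ⁻¹) := by
      have := (h.ell z).trace_nonneg hδ
      gcongr; linarith
    linarith

end LinEst

namespace LinEst
variable {d : ℕ}

lemma toE_vecMulVec (X ξ : E d) :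
    Matrix.toEuclideanCLM (𝕜 := ℝ) (Matrix.vecMulVec (X : Fin d → ℝ) (X : Fin d → ℝ)) ξ = (inner ℝ X ξ) • X := by
  ext i
  rw [Matrix.ofLp_toEuclideanCLM]
  simp only [Matrix.vecMulVec_apply, Matrix.mulVec, dotProduct, PiLp.inner_apply, Finset.sum_mul, PiLp.smul_apply,
    smul_eq_mul]
  refine Finset.sum_congr rfl fun j _ => by simp; ring

def kap (μ c τ : ℝ) (t : ℝ) : ℝ := 1 / 16 + μ * c * (τ - t)
def gg (μ c τ : ℝ) (y1 : E d) (z : Z d) : ℝ := kap μ c τ z.1 - c * ‖z.2 - y1‖ ^ 2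
def phi (n : ℕ) (μ c τ : ℝ) (y1 : E d) (z : Z d) : ℝ :=
  c⁻¹ * ((kap μ c τ z.1)⁻¹) ^ (n + 1) * (gg μ c τ y1 z) ^ 2
def phit (n : ℕ) (μ c τ : ℝ) (y1 : E d) (z : Z d) : ℝ :=
  μ * ((n + 1) * ((kap μ c τ z.1)⁻¹) ^ (n + 2) * (gg μ c τ y1 z) ^ 2
    - 2 * ((kap μ c τ z.1)⁻¹) ^ (n + 1) * gg μ c τ y1 z)
def phiG (n : ℕ) (μ c τ : ℝ) (y1 : E d) (z : Z d) : E d :=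
  (-4 * ((kap μ c τ z.1)⁻¹) ^ (n + 1) * gg μ c τ y1 z) • (z.2 - y1)
def phiH (n : ℕ) (μ c τ : ℝ) (y1 : E d) (z : Z d) : Matrix (Fin d) (Fin d) ℝ :=
  ((kap μ c τ z.1)⁻¹) ^ (n + 1) • ((8 * c) • Matrix.vecMulVec ((z.2 - y1 : E d) : Fin d → ℝ) ((z.2 - y1 : E d) : Fin d → ℝ)
    - (4 * gg μ c τ y1 z) • (1 : Matrix (Fin d) (Fin d) ℝ))

lemma jet_phi (n : ℕ) {μ c τ : ℝ} (hc : 0 < c) (y1 : E d) (z : Z d) (hk : 0 < kap μ c τ z.1) :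
    JetAt (phi n μ c τ y1) (phit n μ c τ y1) (phiG n μ c τ y1) (phiH n μ c τ y1) z := by
  have hX : HasFDerivAt (fun z : Z d => z.2 - y1) (ContinuousLinearMap.snd ℝ ℝ (E d)) z :=
      hasFDerivAt_snd.sub_const y1
  have hkd : HasDerivAt (kap μ c τ) (-(μ * c)) z.1 := by
    have := ((((hasDerivAt_id z.1).const_sub τ).const_mul (μ * c)).const_add (1/16))
    refine this.congr_deriv (by simp)
  have hAd : HasDerivAt (fun t => ((kap μ c τ t)⁻¹) ^ (n + 1))
      ((n + 1) * (μ * c) * ((kap μ c τ z.1)⁻¹) ^ (n + 2)) z.1 := by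
    refine ((hkd.inv hk.ne').pow (n + 1)).congr_deriv ?_
    simp only [Pi.inv_apply]
    push_cast
    generalize hκ : kap μ c τ z.1 = κ at hk
    rw [pow_add, neg_neg, div_eq_mul_inv, ← inv_pow]
    ring
  have hA : HasFDerivAt (fun z : Z d => ((kap μ c τ z.1)⁻¹) ^ (n + 1))
      (((n + 1) * (μ * c) * ((kap μ c τ z.1)⁻¹) ^ (n + 2)) • ContinuousLinearMap.fst ℝ ℝ (E d)) z :=
    HasDerivAt.comp_hasFDerivAt z hAd hasFDerivAt_fst
  have hk' : HasFDerivAt (fun z : Z d => kap μ c τ z.1) ((-(μ * c)) • ContinuousLinearMap.fst ℝ ℝ (E d)) z :=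
    HasDerivAt.comp_hasFDerivAt (h₂ := kap μ c τ) z hkd hasFDerivAt_fst
  have hg : HasFDerivAt (gg μ c τ y1) ((-(μ * c)) • ContinuousLinearMap.fst ℝ ℝ (E d) -
      c • ((2 : ℕ) • (innerSL ℝ (z.2 - y1)).comp (ContinuousLinearMap.snd ℝ ℝ (E d)))) z := by
    refine (hk'.sub ((hX.norm_sq).const_mul c)).congr_fderiv ?_
    ext <;> simp
  have hw : HasFDerivAt (phi n μ c τ y1) ((phit n μ c τ y1 z) • ContinuousLinearMap.fst ℝ ℝ (E d) +
      (innerSL ℝ (phiG n μ c τ y1 z)).comp (ContinuousLinearMap.snd ℝ ℝ (E d))) z := by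
    have h1 := ((hA.mul (hg.pow 2)).const_mul c⁻¹)
    refine HasFDerivAt.congr_of_eventuallyEq (f := fun y : Z d => c⁻¹ * (((kap μ c τ y.1)⁻¹) ^ (n + 1) * (gg μ c τ y1 y) ^ 2)) ?_ ?_
    · refine h1.congr_fderiv ?_
      apply ContinuousLinearMap.ext
      rintro ⟨s, ξ⟩
      simp [phit, phiG, inner_smul_left]
      field_simp
      ring
    · filter_upwards with y
      simp [phi]; ring
  have hGG : HasFDerivAt (phiG n μ c τ y1) ((ContinuousLinearMap.fst ℝ ℝ (E d)).smulRight
      ((-4 * ((n + 1) * (μ * c) * ((kap μ c τ z.1)⁻¹) ^ (n + 2) * gg μ c τ y1 z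
        - ((kap μ c τ z.1)⁻¹) ^ (n + 1) * (μ * c))) • (z.2 - y1)) +
      (Matrix.toEuclideanCLM (𝕜 := ℝ) (phiH n μ c τ y1 z)).comp (ContinuousLinearMap.snd ℝ ℝ (E d))) z := by
    have h1 := ((hA.mul hg).const_mul (-4)).smul hX
    refine HasFDerivAt.congr_of_eventuallyEq (f := fun y : Z d => (-4 * (((kap μ c τ y.1)⁻¹) ^ (n + 1) * gg μ c τ y1 y)) • (y.2 - y1)) ?_ ?_
    · refine h1.congr_fderiv ?_
      apply ContinuousLinearMap.ext
      rintro ⟨s, ξ⟩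
      simp only [phiH, map_smul, map_sub, map_one, ContinuousLinearMap.add_apply, ContinuousLinearMap.comp_apply,
        ContinuousLinearMap.smul_apply, ContinuousLinearMap.sub_apply, toE_vecMulVec, ContinuousLinearMap.smulRight_apply,
        ContinuousLinearMap.coe_fst', ContinuousLinearMap.coe_snd', ContinuousLinearMap.one_apply]
      simp only [innerSL_apply_apply, nsmul_eq_mul, smul_eq_mul, Pi.mul_apply, inner_sub_left]
      module
    · filter_upwards with y
      simp only [phiG]; congr 1; ring
  refine ⟨hw, ⟨_, hGG⟩, ?_⟩
  refine Matrix.IsSymm.smul (Matrix.IsSymm.sub (Matrix.IsSymm.smul ?_ _) (Matrix.isSymm_one.smul _)) _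
  ext i j
  simp [Matrix.vecMulVec_apply, mul_comm]

lemma quad_ctr (a : Matrix (Fin d) (Fin d) ℝ) (X : E d) :
    ctr a (Matrix.vecMulVec (X : Fin d → ℝ) (X : Fin d → ℝ)) = quad a X := by
  simp only [ctr, quad, Matrix.vecMulVec_apply]
  refine Finset.sum_congr rfl fun i _ => Finset.sum_congr rfl fun j _ => by ring

/-- The barrier inequality. -/
lemma phi_ineq (n : ℕ) {μ c τ δ K ρ κm : ℝ} (hc : 0 < c) (hμ : 0 < μ) (hδ : 0 < δ) (hK : 0 ≤ K)
    (y1 : E d) (z : Z d) (hk : 1 / 16 ≤ kap μ c τ z.1) (hkm : kap μ c τ z.1 ≤ κm)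
    (hg : 0 < gg μ c τ y1 z) (hρ : ‖z.2 - y1‖ ≤ ρ) (hρ0 : 0 ≤ ρ)
    (hn : (2 * μ + 8 * δ + 4 * (d * δ⁻¹) + 4 * K * ρ) ^ 2 ≤ 16 * ((n + 1) * μ * δ))
    {a : Matrix (Fin d) (Fin d) ℝ} (ha : Ell δ a) :
    δ / 4 * (κm⁻¹) ^ (n + 1) + K * ‖phiG n μ c τ y1 z‖ ≤
      phit n μ c τ y1 z + ctr a (phiH n μ c τ y1 z) := by
  have hG : ‖phiG n μ c τ y1 z‖ ≤ 4 * ((kap μ c τ z.1)⁻¹) ^ (n + 1) * gg μ c τ y1 z * ρ := by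
    have hk0 : 0 < kap μ c τ z.1 := by linarith
    rw [phiG, norm_smul]
    have : ‖-4 * ((kap μ c τ z.1)⁻¹) ^ (n + 1) * gg μ c τ y1 z‖ = 4 * ((kap μ c τ z.1)⁻¹) ^ (n + 1) * gg μ c τ y1 z := by
      rw [Real.norm_eq_abs, abs_mul, abs_mul, abs_of_pos hg, abs_of_pos (by positivity : 0 < (kap μ c τ z.1)⁻¹ ^ (n + 1))]
      norm_num
    rw [this]; gcongr
  have hH : ctr a (phiH n μ c τ y1 z) = ((kap μ c τ z.1)⁻¹) ^ (n + 1) *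
      (8 * c * quad a (z.2 - y1) - 4 * gg μ c τ y1 z * a.trace) := by
    rw [phiH, ctr_smul, ctr_sub, ctr_smul, ctr_smul, quad_ctr, ctr_one]
  have hX : c * ‖z.2 - y1‖ ^ 2 = kap μ c τ z.1 - gg μ c τ y1 z := by simp [gg]
  rw [hH, phit]
  have h1 := (ha.2 (z.2 - y1)).1
  have h2 := ha.trace_le
  set κ := kap μ c τ z.1
  set g := gg μ c τ y1 z
  have hk0 : 0 < κ := by linarith
  set A := (κ⁻¹) ^ (n + 1) with hA
  have hA0 : 0 < A := by positivity
  have hA2 : (κ⁻¹) ^ (n + 2) = A * κ⁻¹ := by rw [hA]; ring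
  have hAm : (κm⁻¹) ^ (n + 1) ≤ A := by
    have : 0 ≤ κm⁻¹ := by
      have : 0 < κm := by linarith
      positivity
    rw [hA]; gcongr
  rw [hA2]
  set B := 2 * μ + 8 * δ + 4 * (d * δ⁻¹) + 4 * K * ρ with hB
  have hquad : 0 ≤ (n + 1) * μ * g ^ 2 * κ⁻¹ - B * g + 4 * δ * κ := by
    set y := g * κ⁻¹ with hy
    have hyg : g = y * κ := by rw [hy]; field_simp
    have hpos : 0 < (n + 1) * μ := by positivity
    have : 0 ≤ (n + 1) * μ * y ^ 2 - B * y + 4 * δ := by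
      have e : 0 ≤ (2 * ((n + 1) * μ) * y - B) ^ 2 := sq_nonneg _
      by_contra hcon
      push Not at hcon
      nlinarith
    have e2 : (n + 1) * μ * g ^ 2 * κ⁻¹ - B * g + 4 * δ * κ = κ * ((n + 1) * μ * y ^ 2 - B * y + 4 * δ) := by
      rw [hyg]; field_simp
    rw [e2]; positivity
  have h3 : 8 * c * quad a (z.2 - y1) ≥ 8 * δ * (κ - g) := by
    rw [← hX]; nlinarith
  have h4 : 4 * g * a.trace ≤ 4 * g * (d * δ⁻¹) := by gcongr
  have h5 : K * ‖phiG n μ c τ y1 z‖ ≤ K * (4 * A * g * ρ) := by gcongr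
  have h6 : δ / 4 * (κm⁻¹) ^ (n + 1) ≤ A * (4 * δ * κ) := by
    calc δ / 4 * (κm⁻¹) ^ (n + 1) ≤ δ / 4 * A := by gcongr
      _ = A * (4 * δ * (1 / 16)) := by ring
      _ ≤ _ := by gcongr
  have h7 : A * (8 * δ * (κ - g) - 4 * g * (d * δ⁻¹)) ≤ A * (8 * c * quad a (z.2 - y1) - 4 * g * a.trace) := by
    gcongr
  have h8 : 0 ≤ A * ((n + 1) * μ * g ^ 2 * κ⁻¹ - B * g + 4 * δ * κ) := by positivity
  rw [hB] at h8
  linarith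

end LinEst

namespace LinEst
variable {d : ℕ}

lemma JetAt.const_mul {w wt : Z d → ℝ} {G H} {z : Z d} (h : JetAt w wt G H z) (s : ℝ) :
    JetAt (fun z => s * w z) (fun z => s * wt z) (fun z => s • G z) (fun z => s • H z) z := by
  refine ⟨?_, ?_, h.sym.smul s⟩
  · refine (h.hw.const_mul s).congr_fderiv ?_
    ext <;> simp
  · obtain ⟨q, hq⟩ := h.hG
    refine ⟨s • q, (hq.const_smul s).congr_fderiv ?_⟩
    ext <;> simp [map_smul]

lemma JetAt.congr_local {w wt : Z d → ℝ} {G H} {w' : Z d → ℝ} {z : Z d}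
    (h : JetAt w wt G H z) (h1 : w' =ᶠ[nhds z] w) : JetAt w' wt G H z :=
  ⟨h.hw.congr_of_eventuallyEq h1, h.hG, h.sym⟩

set_option maxHeartbeats 2000000 in
lemma step1 (d : ℕ) {δ K Λ D : ℝ} (hδ : 0 < δ) (hδ1 : δ ≤ 1) (hK : 0 ≤ K) (hΛ : 1 ≤ Λ) (hD : 0 ≤ D) :
    ∃ ρ C1 : ℝ, 1 ≤ ρ ∧ 1 ≤ C1 ∧ ∀ {T ϱ : ℝ} {v vt : Z d → ℝ} {G : Z d → E d}
      {H : Z d → Matrix (Fin d) (Fin d) ℝ} {a : Z d → Matrix (Fin d) (Fin d) ℝ} {f : Z d → ℝ},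
      Sub δ K T ϱ v vt G H a f → ∀ {M r τ1 b : ℝ} {z0 : Z d} {y1 : E d}, 1 ≤ M → 0 < r → r ≤ 1 →
      z0 ∈ AM T ϱ v G M → z0.1 + r ^ 2 / 4 ≤ τ1 → τ1 ≤ z0.1 + Λ * r ^ 2 → τ1 ≤ T →
      ‖z0.2 - y1‖ ≤ D * r → ‖y1‖ + ρ * r ≤ ϱ → 0 ≤ b →
      ∫⁻ z in Ico z0.1 τ1 ×ˢ Metric.ball y1 (ρ * r), ENNReal.ofReal (f z) ^ (d + 1) ≤ ENNReal.ofReal b →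
      cA d δ * 2 ^ d * b < M ^ (d + 1) * r ^ (d + 2) →
      ∃ x1, ‖x1 - y1‖ ≤ r / 4 ∧
        v (τ1, x1) - (v z0 + inner ℝ (G z0) (x1 - z0.2) - M / 2 * ‖x1 - z0.2‖ ^ 2 - M * (τ1 - z0.1))
          ≤ C1 * M * r ^ 2 := by
  set μ := 4 * D ^ 2 + 1 with hμd
  have hμ : 0 < μ := by positivity
  set κm := 1 / 16 + μ * Λ with hκmd
  have hκm : 1 ≤ κm := by nlinarith [sq_nonneg D]
  set ρ := 1 + κm with hρd
  have hρ2 : 2 ≤ ρ := by linarith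
  have hρκ : κm ≤ ρ ^ 2 := by nlinarith
  have hDρ : D ≤ ρ := by
    have : μ ≤ μ * Λ := le_mul_of_one_le_right hμ.le hΛ
    linarith [sq_nonneg (2 * D - 1)]
  set B := 2 * μ + 8 * δ + 4 * (d * δ⁻¹) + 4 * K * ρ with hB
  obtain ⟨n, hn⟩ := exists_nat_ge (B ^ 2 / (16 * (μ * δ)))
  have hn' : B ^ 2 ≤ 16 * ((n + 1) * μ * δ) := by
    rw [div_le_iff₀ (by positivity)] at hn
    have : 0 < μ * δ := by positivity
    have e : 16 * ((n + 1) * μ * δ) = n * (16 * (μ * δ)) + 16 * (μ * δ) := by ring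
    rw [e]; linarith
  set c6 := K * (4 + ρ + D) + 1 + d * δ⁻¹ with hc6
  have hc60 : 0 ≤ c6 := by positivity
  set Kp := (κm⁻¹) ^ (n + 1) with hKp
  have hKp0 : 0 < Kp := by positivity
  set lam := Kp⁻¹ * (4 * c6 / δ + 2048 * ρ) with hlam
  have hlam0 : 0 < lam := by positivity
  have hlam1 : c6 ≤ lam * (δ / 4 * Kp) := by
    have : lam * (δ / 4 * Kp) = c6 + 512 * ρ * δ := by rw [hlam]; field_simp; ring
    rw [this]; have : 0 ≤ 512 * ρ * δ := by positivity
    linarith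
  have hlam2 : 8 * ρ ≤ lam * Kp / 256 := by
    have : lam * Kp / 256 = 8 * ρ + c6 / (64 * δ) := by rw [hlam]; field_simp; ring
    rw [this]; have : 0 ≤ c6 / (64 * δ) := by positivity
    linarith
  refine ⟨ρ, lam * 16 ^ (n + 1) / 256 + 1, by linarith, ?_, ?_⟩
  · have : 0 ≤ lam * 16 ^ (n + 1) / 256 := by positivity
    linarith
  intro T ϱ v vt G H a f h M r τ1 b z0 y1 hM hr hr1 hz0 hτ1 hτ2 hτT hx0 hy1 hb hfb hbM
  by_contra hcon
  push Not at hcon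
  obtain ⟨t0, x0⟩ := z0
  simp only at hτ1 hτ2 hx0 hfb hcon
  have hr2 : 0 < r ^ 2 := by positivity
  set c := (r ^ 2)⁻¹ with hc
  have hc0 : 0 < c := by positivity
  have hcr : c * r ^ 2 = 1 := by rw [hc]; field_simp
  have hgrad := AM.grad h (by linarith) hz0
  obtain ⟨⟨ht00, -⟩, hx0b, hP⟩ := hz0
  simp only at ht00 hx0b hP
  set p := G (t0, x0) with hp
  set α := v (t0, x0) with hα
  let pP : Z d → ℝ := fun z => (α + M * t0) + inner ℝ p (z.2 - x0) + (-M) / 2 * ‖z.2 - x0‖ ^ 2 + (-M) * z.1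
  have hPe : ∀ t x, pP (t, x) = α + inner ℝ p (x - x0) - M / 2 * ‖x - x0‖ ^ 2 - M * (t - t0) := by
    intro t x; simp only [pP]; ring
  have hPv : ∀ t ∈ Icc t0 T, ∀ x ∈ Metric.closedBall (0 : E d) ϱ, pP (t, x) ≤ v (t, x) := by
    intro t ht x hx; rw [hPe]; exact hP t ht x hx
  have hball : ∀ x ∈ Metric.closedBall y1 (ρ * r), x ∈ Metric.closedBall (0 : E d) ϱ := by
    intro x hx
    rw [mem_closedBall_iff_norm] at hx
    have := norm_le_norm_add_norm_sub' x y1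
    simp; linarith
  let g : Z d → ℝ := gg μ c τ1 y1
  let φ : Z d → ℝ := fun z => c⁻¹ * ((kap μ c τ1 z.1)⁻¹) ^ (n + 1) * (max (g z) 0) ^ 2
  have hkap : ∀ t ∈ Icc t0 τ1, 1 / 16 ≤ kap μ c τ1 t ∧ kap μ c τ1 t ≤ κm := by
    intro t ht
    have h1 : 0 ≤ c * (τ1 - t) := mul_nonneg hc0.le (by linarith [ht.2])
    have h2 : c * (τ1 - t) ≤ Λ := by
      calc c * (τ1 - t) ≤ c * (Λ * r ^ 2) := by
            apply mul_le_mul_of_nonneg_left _ hc0.le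
            linarith [ht.1]
        _ = Λ := by rw [mul_left_comm, hcr, mul_one]
    constructor
    · simp only [kap, mul_assoc]; have := mul_nonneg hμ.le h1; linarith
    · simp only [kap, mul_assoc]; have := mul_le_mul_of_nonneg_left h2 hμ.le; linarith
  have hφ0 : ∀ z, g z ≤ 0 → φ z = 0 := by
    intro z hz; simp only [φ, max_eq_right hz]; simp
  let w : Z d → ℝ := fun z => v z - pP z - (lam * M) * φ z
  let wt : Z d → ℝ := fun z => vt z - (-M) - (lam * M) * phit n μ c τ1 y1 z
  let Gw : Z d → E d := fun z => G z - (p + (-M) • (z.2 - x0)) - (lam * M) • phiG n μ c τ1 y1 z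
  let Hw : Z d → Matrix (Fin d) (Fin d) ℝ := fun z => H z - (-M) • 1 - (lam * M) • phiH n μ c τ1 y1 z
  have hgc : Continuous g := by
    simp only [g, gg, kap]; unfold gg kap; fun_prop
  have hwc : ContinuousOn w (Icc t0 τ1 ×ˢ Metric.closedBall y1 (ρ * r)) := by
    have h1 : ContinuousOn (fun z : Z d => (kap μ c τ1 z.1)⁻¹) (Icc t0 τ1 ×ˢ Metric.closedBall y1 (ρ * r)) := by
      refine ContinuousOn.inv₀ (Continuous.continuousOn (by unfold kap; fun_prop)) fun z hz => ?_
      have := (hkap z.1 hz.1).1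
      linarith
    have hv := h.cont
    refine ContinuousOn.sub (Continuous.continuousOn ?_) ?_
    · simp only [pP]; fun_prop
    · refine continuousOn_const.mul ((continuousOn_const.mul (h1.pow _)).mul (Continuous.continuousOn ?_))
      fun_prop
  have hjet : ∀ t ∈ Icc t0 τ1, ∀ x ∈ Metric.closedBall y1 (ρ * r), w (t, x) < 0 → 0 < g (t, x) ∧
      JetAt w wt Gw Hw (t, x) := by
    intro t ht x hx hw
    have hg : 0 < g (t, x) := by
      by_contra hg
      have h1 := hφ0 _ (not_lt.1 hg)
      have h2 := hPv t ⟨ht.1, ht.2.trans hτT⟩ x (hball x hx)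
      simp only [w, h1] at hw
      linarith
    refine ⟨hg, ?_⟩
    have hk : 0 < kap μ c τ1 t := by linarith [(hkap t ht).1]
    have := ((h.jet (t, x)).sub (JetAt.poly (α + M * t0) (-M) (-M) p x0 (t, x))).sub
      ((jet_phi n hc0 y1 (t, x) hk).const_mul (lam * M))
    refine this.congr_local ?_
    filter_upwards [hgc.continuousAt.eventually (lt_mem_nhds hg)] with z hz
    simp only [w, pP, φ, phi, max_eq_left hz.le]
    rfl
  have hsph : ∀ t ∈ Icc t0 τ1, ∀ x, ρ * r ≤ ‖x - y1‖ → g (t, x) ≤ 0 := by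
    intro t ht x hx
    have h1 := (hkap t ht).2
    have h2 : ρ ^ 2 ≤ c * ‖x - y1‖ ^ 2 := by
      calc ρ ^ 2 = c * (ρ * r) ^ 2 := by rw [mul_pow, mul_left_comm, hcr, mul_one]
        _ ≤ _ := by gcongr
    simp only [g, gg]; linarith
  obtain ⟨S, hSc, hS, hI⟩ := abp y1 (R := ρ * r) (t0 := t0) (t1 := τ1) (m := lam * M * r ^ 2 * Kp / 256)
    (p0 := M * r) (by positivity) (by linarith) (by positivity) (by positivity)
    (by
      calc M * r * (8 * (ρ * r)) = M * r ^ 2 * (8 * ρ) := by ring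
        _ ≤ M * r ^ 2 * (lam * Kp / 256) := by gcongr
        _ = _ := by ring) w wt Gw Hw hwc
    (by
      intro t ht x hx
      have h2 : ‖x - y1‖ = ρ * r := by simpa [dist_eq_norm] using hx
      have h1 := hPv t ⟨ht.1, ht.2.trans hτT⟩ x (hball x (Metric.sphere_subset_closedBall hx))
      simp only [w, hφ0 _ (hsph t ht x h2.ge)]; linarith)
    (by
      intro x hx
      have h1 := hPv τ1 ⟨by linarith, hτT⟩ x (hball x hx)
      by_cases hg : g (τ1, x) ≤ 0
      · simp only [w, hφ0 _ hg]; linarith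
      push Not at hg
      have hk : kap μ c τ1 τ1 = 1 / 16 := by simp [kap]
      have hge : g (τ1, x) = 1 / 16 - c * ‖x - y1‖ ^ 2 := by simp [g, gg, hk]
      have h3 : ‖x - y1‖ ≤ r / 4 := by
        rw [hge] at hg
        by_contra h4
        push Not at h4
        have : c * (r / 4) ^ 2 ≤ c * ‖x - y1‖ ^ 2 := by gcongr
        have e : c * (r / 4) ^ 2 = 1 / 16 := by rw [div_pow]; linarith
        linarith
      have h4 := hcon x h3
      rw [← hPe] at h4
      have hg1 : g (τ1, x) ≤ 1 / 16 := by
        rw [hge]; have : 0 ≤ c * ‖x - y1‖ ^ 2 := by positivity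
        linarith
      have h5 : φ (τ1, x) ≤ r ^ 2 * 16 ^ (n + 1) / 256 := by
        simp only [φ, hk, max_eq_left hg.le]
        have : c⁻¹ = r ^ 2 := by rw [hc, inv_inv]
        rw [this]
        calc r ^ 2 * (1 / 16 : ℝ)⁻¹ ^ (n + 1) * g (τ1, x) ^ 2 ≤ r ^ 2 * (1 / 16 : ℝ)⁻¹ ^ (n + 1) * (1 / 16) ^ 2 := by gcongr
          _ = _ := by norm_num; ring
      have h6 : lam * M * φ (τ1, x) ≤ lam * M * (r ^ 2 * 16 ^ (n + 1) / 256) := by gcongr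
      have h7 : 0 ≤ M * r ^ 2 := by positivity
      have h8 : (lam * 16 ^ (n + 1) / 256 + 1) * M * r ^ 2 = lam * M * (r ^ 2 * 16 ^ (n + 1) / 256) + M * r ^ 2 := by ring
      rw [h8] at h4
      simp only [w]
      linarith)
    x0 (by
      rw [mem_closedBall_iff_norm]
      refine hx0.trans ?_
      gcongr)
    (by
      have h1 : pP (t0, x0) = α := by rw [hPe]; simp
      have hk := hkap t0 ⟨le_rfl, by linarith⟩
      have hg : 1 / 16 ≤ g (t0, x0) := by
        have e1 : c * ‖x0 - y1‖ ^ 2 ≤ D ^ 2 := by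
          calc c * ‖x0 - y1‖ ^ 2 ≤ c * (D * r) ^ 2 := by gcongr
            _ = D ^ 2 := by rw [mul_pow, mul_left_comm, hcr, mul_one]
        have e2 : 1 / 4 ≤ c * (τ1 - t0) := by
          calc 1 / 4 = c * (r ^ 2 / 4) := by rw [← mul_div_assoc, hcr]
            _ ≤ _ := by gcongr; linarith
        have e3 : μ * (1 / 4) ≤ μ * (c * (τ1 - t0)) := by gcongr
        simp only [g, gg, kap, mul_assoc]
        linarith
      have h5 : r ^ 2 * Kp / 256 ≤ φ (t0, x0) := by
        have hg0 : 0 ≤ g (t0, x0) := by linarith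
        simp only [φ, max_eq_left hg0]
        have : c⁻¹ = r ^ 2 := by rw [hc, inv_inv]
        rw [this]
        have e5 : 0 < kap μ c τ1 t0 := by linarith
        have e4 : κm⁻¹ ≤ (kap μ c τ1 t0)⁻¹ := inv_anti₀ (by linarith) hk.2
        calc r ^ 2 * Kp / 256 = r ^ 2 * (κm⁻¹) ^ (n + 1) * (1 / 16) ^ 2 := by rw [hKp]; ring
          _ ≤ r ^ 2 * (kap μ c τ1 t0)⁻¹ ^ (n + 1) * g (t0, x0) ^ 2 := by gcongr
      have h6 : lam * M * (r ^ 2 * Kp / 256) ≤ lam * M * φ (t0, x0) := by gcongr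
      simp only [w, h1]
      linarith)
    (fun t ht x hx hw => (hjet t ⟨ht.1, ht.2.le⟩ x (Metric.ball_subset_closedBall hx) hw).2)
  have hSsub : S ⊆ Ico t0 τ1 ×ˢ Metric.ball y1 (ρ * r) := fun z hz =>
    ⟨⟨(hS z hz).t0le, (hS z hz).ltt1⟩, (hS z hz).mem⟩
  have hfin := abp_F y1 (by positivity) (by positivity) hSc hS hI hδ hδ1 a h.ell f h.f0 0 le_rfl
    (fun z hz => ?_) hb ((lintegral_mono_set hSsub).trans hfb)
  · simp only [ne_eq, Nat.add_eq_zero_iff, one_ne_zero, and_false, not_false_eq_true, zero_pow, zero_mul, add_zero] at hfin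
    have h1 : M ^ (d + 1) * r ^ (d + 2) ≤ lam * M * r ^ 2 * Kp / 256 * (M * r) ^ d := by
      calc M ^ (d + 1) * r ^ (d + 2) = 1 * (M * r ^ 2 * (M * r) ^ d) := by rw [mul_pow]; ring
        _ ≤ (lam * Kp / 256) * (M * r ^ 2 * (M * r) ^ d) := by
            gcongr; linarith
        _ = _ := by ring
    linarith
  · have hzS := hSsub hz
    have hc := hS z hz
    have htz : z.1 ∈ Icc t0 τ1 := ⟨hzS.1.1, hzS.1.2.le⟩
    have hzb := Metric.ball_subset_closedBall hzS.2
    have hg := (hjet z.1 htz z.2 hzb hc.neg).1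
    have hxy : ‖z.2 - y1‖ ≤ ρ * r := mem_closedBall_iff_norm.1 hzb
    have hxρ : ‖z.2 - y1‖ ≤ ρ := hxy.trans (mul_le_of_le_one_right (by linarith) hr1)
    have hk := hkap z.1 htz
    have hbar := phi_ineq n hc0 hμ hδ hK y1 z hk.1 hk.2 hg hxρ (by linarith) hn' (h.ell z)
    have heq := h.eq z.1 ⟨ht00.trans htz.1, htz.2.trans hτT⟩ z.2 (hball _ hzb)
    have h4 := (h.ell z).trace_le
    have h5 : ctr (a z) (Hw z) = ctr (a z) (H z) + M * (a z).trace - lam * M * ctr (a z) (phiH n μ c τ1 y1 z) := by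
      simp only [Hw, ctr_sub, ctr_smul, ctr_one]; ring
    have hGn : ‖G z‖ ≤ M * (4 + ρ + D) + lam * M * ‖phiG n μ c τ1 y1 z‖ := by
      have e : G z = Gw z + (p + (-M) • (z.2 - x0)) + (lam * M) • phiG n μ c τ1 y1 z := by
        simp only [Gw]; abel
      have e1 : ‖z.2 - x0‖ ≤ ρ + D := by
        have : z.2 - x0 = (z.2 - y1) - (x0 - y1) := by abel
        rw [this]
        refine (norm_sub_le _ _).trans ?_
        have : D * r ≤ D := mul_le_of_le_one_right hD hr1
        linarith
      have e2 : ‖(-M) • (z.2 - x0)‖ ≤ M * (ρ + D) := by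
        rw [norm_smul, norm_neg, Real.norm_eq_abs, abs_of_pos (by linarith : 0 < M)]; gcongr
      have e3 : ‖(lam * M) • phiG n μ c τ1 y1 z‖ = lam * M * ‖phiG n μ c τ1 y1 z‖ := by
        rw [norm_smul, Real.norm_eq_abs, abs_of_pos (by positivity)]
      have e4 := hc.gle
      have e5 : M * r ≤ M := mul_le_of_le_one_right (by linarith) hr1
      rw [e]
      refine (norm_add_le _ _).trans ?_
      have e6 := norm_add_le (Gw z) (p + (-M) • (z.2 - x0))
      have e7 := norm_add_le p ((-M) • (z.2 - x0))
      have e8 : M * (4 + ρ + D) = 4 * M + M * (ρ + D) := by ring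
      rw [e3, e8]
      linarith
    have h6 : K * ‖G z‖ ≤ K * (M * (4 + ρ + D) + lam * M * ‖phiG n μ c τ1 y1 z‖) := by gcongr
    have h7 : M * (a z).trace ≤ M * (d * δ⁻¹) := by gcongr
    have h8 : lam * M * (δ / 4 * Kp + K * ‖phiG n μ c τ1 y1 z‖) ≤
        lam * M * (phit n μ c τ1 y1 z + ctr (a z) (phiH n μ c τ1 y1 z)) := by gcongr
    have h9 : M * c6 ≤ M * (lam * (δ / 4 * Kp)) := by gcongr
    rw [h5]
    simp only [wt]
    simp only [Prod.mk.eta] at heq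
    rw [hc6] at h9
    linarith

end LinEst

namespace LinEst
variable {d : ℕ}

lemma lag_fin {ι : Type*} (a l : ι → ℝ) (hl : ∀ i, 0 < l i) (m : ℕ) (F : Finset ι) :
    ∀ τ : ℝ, (m : ℝ≥0∞) * volume ((⋃ i ∈ F, Ico (a i - m * l i) (a i + l i)) ∩ Iio τ) ≤
      (m + 1) * volume ((⋃ i ∈ F, Ico (a i - m * l i) (a i)) ∩ Iio τ) := by
  classical
  induction F using Finset.induction_on_max_value a with
  | empty => intro τ; simp
  | insert i F hi hmax ih =>
    intro σ
    by_cases hex : ∃ i' ∈ F, a i + l i ≤ a i' + l i'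
    · obtain ⟨i', hi', hle⟩ := hex
      have h1 := hmax i' hi'
      have hsub : (⋃ j ∈ insert i F, Ico (a j - m * l j) (a j + l j)) = ⋃ j ∈ F, Ico (a j - m * l j) (a j + l j) := by
        rw [Finset.set_biUnion_insert]
        refine union_eq_right.2 (subset_trans ?_ (subset_biUnion_of_mem (u := fun j => Ico (a j - m * l j) (a j + l j)) hi'))
        refine Ico_subset_Ico ?_ hle
        have : (m : ℝ) * l i ≤ m * l i' := by gcongr; linarith
        linarith
      rw [hsub]
      refine (ih σ).trans ?_
      gcongr (_ + 1) * volume (?_ ∩ _)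
      rw [Finset.set_biUnion_insert]
      exact subset_union_right
    · push Not at hex
      set τ := a i - m * l i with hτ
      have hli := hl i
      have hm0 : (0 : ℝ) ≤ m := Nat.cast_nonneg m
      have hml : 0 ≤ m * l i := by positivity
      rw [Finset.set_biUnion_insert, Finset.set_biUnion_insert]
      set V := ⋃ j ∈ F, Ico (a j - m * l j) (a j + l j)
      set U := ⋃ j ∈ F, Ico (a j - m * l j) (a j)
      have hUm : MeasurableSet U := Finset.measurableSet_biUnion _ fun _ _ => measurableSet_Ico
      have hV : ∀ x ∈ V, x < a i + l i := by
        intro x hx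
        simp only [V, mem_iUnion] at hx
        obtain ⟨j, hj, hx⟩ := hx
        exact hx.2.trans (hex j hj)
      rcases le_or_gt σ τ with h | h
      · have e1 : (Ico τ (a i + l i) ∪ V) ∩ Iio σ ⊆ V ∩ Iio σ := by
          rintro x ⟨hx | hx, hxσ⟩
          · exact absurd hxσ (not_lt.2 (h.trans hx.1))
          · exact ⟨hx, hxσ⟩
        calc (m : ℝ≥0∞) * volume ((Ico τ (a i + l i) ∪ V) ∩ Iio σ) ≤ m * volume (V ∩ Iio σ) := by gcongr
          _ ≤ (m + 1) * volume (U ∩ Iio σ) := ih σ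
          _ ≤ _ := by gcongr; exact subset_union_right
      · have e1 : (Ico τ (a i + l i) ∪ V) ∩ Iio σ ⊆ (V ∩ Iio τ) ∪ Ico τ (min σ (a i + l i)) := by
          rintro x ⟨hx | hx, hxσ⟩
          · exact Or.inr ⟨hx.1, lt_min hxσ hx.2⟩
          · rcases lt_or_ge x τ with h' | h'
            · exact Or.inl ⟨hx, h'⟩
            · exact Or.inr ⟨h', lt_min hxσ (hV x hx)⟩
        have e2 : (U ∩ Iio τ) ∪ Ico τ (min σ (a i)) ⊆ (Ico τ (a i) ∪ U) ∩ Iio σ := by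
          rintro x (⟨hx, hx'⟩ | ⟨hx, hx'⟩)
          · exact ⟨Or.inr hx, lt_trans hx' h⟩
          · exact ⟨Or.inl ⟨hx, hx'.trans_le (min_le_right _ _)⟩, hx'.trans_le (min_le_left _ _)⟩
        have e3 : volume ((U ∩ Iio τ) ∪ Ico τ (min σ (a i))) = volume (U ∩ Iio τ) + volume (Ico τ (min σ (a i))) := by
          refine measure_union ?_ measurableSet_Ico
          rw [disjoint_left]
          rintro x ⟨_, hx⟩ ⟨hx', _⟩
          exact absurd hx (not_lt.2 hx')
        have e4 : (m : ℝ≥0∞) * volume (Ico τ (min σ (a i + l i))) ≤ (m + 1) * volume (Ico τ (min σ (a i))) := by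
          rw [Real.volume_Ico, Real.volume_Ico]
          have : (m : ℝ≥0∞) = ENNReal.ofReal m := by simp
          rw [this, ← ENNReal.ofReal_one, ← ENNReal.ofReal_add hm0 zero_le_one, ← ENNReal.ofReal_mul hm0,
            ← ENNReal.ofReal_mul (by positivity)]
          apply ENNReal.ofReal_le_ofReal
          rcases le_total σ (a i) with h' | h'
          · rw [min_eq_left h', min_eq_left (by linarith)]
            nlinarith
          · rw [min_eq_right h']
            have := min_le_right σ (a i + l i)
            have : (m : ℝ) * (min σ (a i + l i) - τ) ≤ m * (a i + l i - τ) := by gcongr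
            rw [hτ] at this ⊢
            nlinarith
        calc (m : ℝ≥0∞) * volume ((Ico τ (a i + l i) ∪ V) ∩ Iio σ)
            ≤ m * (volume (V ∩ Iio τ) + volume (Ico τ (min σ (a i + l i)))) := by
              gcongr; exact (measure_mono e1).trans (measure_union_le _ _)
          _ ≤ (m + 1) * volume (U ∩ Iio τ) + (m + 1) * volume (Ico τ (min σ (a i))) := by
              rw [mul_add]; exact add_le_add (ih τ) e4
          _ = (m + 1) * volume ((U ∩ Iio τ) ∪ Ico τ (min σ (a i))) := by rw [e3, mul_add]
          _ ≤ _ := by gcongr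

lemma lag_countable {ι : Type*} [Countable ι] (a l : ι → ℝ) (hl : ∀ i, 0 < l i) (m : ℕ) :
    (m : ℝ≥0∞) * volume (⋃ i, Ico (a i - m * l i) (a i + l i)) ≤
      (m + 1) * volume (⋃ i, Ico (a i - m * l i) (a i)) := by
  classical
  have h1 : (⋃ i, Ico (a i - m * l i) (a i + l i)) = ⋃ F : Finset ι, ⋃ i ∈ F, Ico (a i - m * l i) (a i + l i) := by
    rw [iUnion_eq_iUnion_finset]
  rw [h1, Directed.measure_iUnion, ENNReal.mul_iSup]
  · refine iSup_le fun F => ?_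
    by_contra hcon
    push Not at hcon
    -- truncation at a large level
    obtain ⟨τ, hτ⟩ : ∃ τ, ∀ i ∈ F, a i + l i ≤ τ := by
      obtain ⟨τ, hτ⟩ := (F.image fun i => a i + l i).bddAbove
      exact ⟨τ, fun i hi => hτ (Finset.mem_coe.2 (Finset.mem_image_of_mem _ hi))⟩
    have h2 := lag_fin a l hl m F τ
    have h3 : (⋃ i ∈ F, Ico (a i - m * l i) (a i + l i)) ∩ Iio τ = ⋃ i ∈ F, Ico (a i - m * l i) (a i + l i) := by
      refine inter_eq_left.2 (iUnion₂_subset fun i hi x hx => hx.2.trans_le (hτ i hi))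
    rw [h3] at h2
    refine absurd (hcon.trans_le h2) (not_lt.2 ?_)
    gcongr
    exact inter_subset_left.trans (iUnion₂_subset fun i _ => subset_iUnion (fun i => Ico (a i - m * l i) (a i)) i)
  · intro F1 F2
    refine ⟨F1 ∪ F2, ?_, ?_⟩
    · exact biUnion_subset_biUnion_left (fun i hi => Finset.mem_union_left _ hi)
    · exact biUnion_subset_biUnion_left (fun i hi => Finset.mem_union_right _ hi)

/-- The lag lemma in space-time. -/
lemma lag_prod {ι : Type*} [Countable ι] (a l : ι → ℝ) (hl : ∀ i, 0 < l i) (m : ℕ) (X : ι → Set (E d))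
    (hX : ∀ i, MeasurableSet (X i)) :
    (m : ℝ≥0∞) * volume (⋃ i, Ico (a i - m * l i) (a i + l i) ×ˢ X i) ≤
      (m + 1) * volume (⋃ i, Ico (a i - m * l i) (a i) ×ˢ X i) := by
  rw [Measure.volume_eq_prod,
    Measure.prod_apply_symm (MeasurableSet.iUnion fun i => measurableSet_Ico.prod (hX i)),
    Measure.prod_apply_symm (MeasurableSet.iUnion fun i => measurableSet_Ico.prod (hX i)),
    ← lintegral_const_mul' _ _ (by simp), ← lintegral_const_mul' _ _ (by simp)]
  refine lintegral_mono fun y => ?_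
  have key : ∀ b : ι → ℝ, (fun x => (x, y)) ⁻¹' (⋃ i, Ico (a i - m * l i) (b i) ×ˢ X i) =
      ⋃ i : {i // y ∈ X i}, Ico (a i - m * l i) (b i) := by
    intro b; ext x
    simp only [mem_preimage, mem_iUnion, mem_prod, Subtype.exists, exists_prop]
    exact exists_congr fun i => and_comm
  have := lag_countable (fun i : {i // y ∈ X i} => a i) (fun i => l i) (fun i => hl i) m
  simp only
  rw [key, key]
  exact this

end LinEst

namespace LinEst
variable {d : ℕ}

/-- dyadic parabolic index -/
def idx (j : ℕ) (z : Z d) : ℤ × (Fin d → ℤ) := (⌊4 ^ j * z.1⌋, fun i => ⌊2 ^ j * z.2 i⌋)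

def cellK (j : ℕ) (k : Fin d → ℤ) : Set (E d) := {x | ∀ i, ⌊2 ^ j * x i⌋ = k i}

def tlen (j : ℕ) : ℝ := (1 / 4) ^ j
def slen (j : ℕ) : ℝ := (1 / 2) ^ j

lemma slen_pos (j : ℕ) : 0 < slen j := by unfold slen; positivity
lemma slen_le (j : ℕ) : slen j ≤ 1 := by unfold slen; exact pow_le_one₀ (by norm_num) (by norm_num)
lemma slen_succ (j : ℕ) : slen (j + 1) = slen j / 2 := by unfold slen; rw [pow_succ]; ring
lemma tlen_eq (j : ℕ) : tlen j = slen j ^ 2 := by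
  unfold tlen slen; rw [← pow_mul, mul_comm, pow_mul]; norm_num
lemma tlen_pos (j : ℕ) : 0 < tlen j := by unfold tlen; positivity

abbrev Ix (d : ℕ) := ℕ × (ℤ × (Fin d → ℤ))

def cell (i : Ix d) : Set (Z d) := idx i.1 ⁻¹' {i.2}

lemma cell_eq (i : Ix d) : cell i = Ico (i.2.1 * tlen i.1) (i.2.1 * tlen i.1 + tlen i.1) ×ˢ cellK i.1 i.2.2 := by
  ext z
  obtain ⟨j, n, k⟩ := i
  simp only [cell, idx, mem_preimage, mem_singleton_iff, Prod.mk.injEq, mem_prod, mem_Ico, cellK, mem_ofPred_eq,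
    Int.floor_eq_iff, funext_iff, tlen]
  have h4 : (0 : ℝ) < 4 ^ j := by positivity
  refine and_congr (and_congr ?_ ?_) Iff.rfl
  · rw [one_div, inv_pow, ← div_eq_mul_inv, div_le_iff₀ h4, mul_comm]
  · rw [one_div, inv_pow, ← div_eq_mul_inv, ← one_div, ← add_div, lt_div_iff₀ h4, mul_comm]

lemma cellK_pre (j : ℕ) (k : Fin d → ℤ) : cellK j k = WithLp.ofLp ⁻¹'
    (univ.pi fun i => Ico (k i * slen j : ℝ) (k i * slen j + slen j)) := by
  ext x
  simp only [cellK, mem_ofPred_eq, mem_preimage, mem_pi, mem_univ, true_imp_iff, mem_Ico, Int.floor_eq_iff, slen]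
  have h4 : (0 : ℝ) < 2 ^ j := by positivity
  refine forall_congr' fun i => and_congr ?_ ?_
  · rw [one_div, inv_pow, ← div_eq_mul_inv, div_le_iff₀ h4, mul_comm]
  · rw [one_div, inv_pow, ← div_eq_mul_inv, ← one_div, ← add_div, lt_div_iff₀ h4, mul_comm]

lemma mem_cellK {j : ℕ} {k : Fin d → ℤ} {x : E d} :
    x ∈ cellK j k ↔ ∀ i, (k i * slen j : ℝ) ≤ x i ∧ x i < k i * slen j + slen j := by
  rw [cellK_pre]; simp

lemma cellK_meas (j : ℕ) (k : Fin d → ℤ) : MeasurableSet (cellK j k) := by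
  rw [cellK_pre]
  exact (PiLp.volume_preserving_ofLp (Fin d)).measurable (MeasurableSet.univ_pi fun _ => measurableSet_Ico)

lemma cellK_vol (j : ℕ) (k : Fin d → ℤ) : volume (cellK j k) = ENNReal.ofReal (slen j ^ d) := by
  rw [cellK_pre, (PiLp.volume_preserving_ofLp (Fin d)).measure_preimage
    (MeasurableSet.univ_pi fun _ => measurableSet_Ico).nullMeasurableSet, Real.volume_pi_Ico]
  simp [ENNReal.ofReal_pow (slen_pos j).le]

lemma cell_meas (i : Ix d) : MeasurableSet (cell i) := by
  rw [cell_eq]; exact measurableSet_Ico.prod (cellK_meas _ _)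

lemma cell_vol (i : Ix d) : volume (cell i) = ENNReal.ofReal (slen i.1 ^ (d + 2)) := by
  rw [cell_eq, Measure.volume_eq_prod, Measure.prod_prod, cellK_vol, Real.volume_Ico,
    ← ENNReal.ofReal_mul (by linarith [tlen_pos i.1]), tlen_eq]
  congr 1; ring

lemma idx_succ {j : ℕ} {z w : Z d} (h : idx (j + 1) z = idx (j + 1) w) : idx j z = idx j w := by
  have key : ∀ (n : ℕ) (a : ℝ), n ≠ 0 → ⌊(n : ℝ) ^ j * a⌋ = ⌊(n : ℝ) ^ (j + 1) * a⌋ / n := by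
    intro n a hn
    rw [pow_succ', mul_assoc, Int.natCast_mul_floor_div_cancel hn]
  have k4 := fun a => key 4 a (by norm_num)
  have k2 := fun a => key 2 a (by norm_num)
  push_cast at k4 k2
  simp only [idx, Prod.mk.injEq, funext_iff] at h ⊢
  refine ⟨?_, fun i => ?_⟩
  · rw [k4, k4, h.1]
  · rw [k2, k2, h.2 i]

lemma idx_le {i j : ℕ} (hij : i ≤ j) {z w : Z d} (h : idx j z = idx j w) : idx i z = idx i w := by
  induction hij with
  | refl => exact h
  | step _ ih => exact ih (idx_succ h)

/-- nested family lemma -/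
lemma nest_max (J : Set (Ix d)) : ∃ J' ⊆ J, J'.PairwiseDisjoint cell ∧ (⋃ i ∈ J, cell i) = ⋃ i ∈ J', cell i := by
  classical
  refine ⟨{i ∈ J | ∀ i' ∈ J, i'.1 < i.1 → Disjoint (cell i) (cell i')}, fun i hi => hi.1, ?_, ?_⟩
  · intro i hi i' hi' hne
    rcases lt_trichotomy i.1 i'.1 with h | h | h
    · exact (hi'.2 i hi.1 h).symm
    · refine disjoint_left.2 fun z hz hz' => hne ?_
      simp only [cell, mem_preimage, mem_singleton_iff] at hz hz'
      rw [h] at hz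
      exact Prod.ext h (hz.symm.trans hz')
    · exact hi.2 i' hi'.1 h
  · refine subset_antisymm ?_ (biUnion_subset_biUnion_left fun i hi => hi.1)
    intro z hz
    have hex : ∃ j, ∃ n, (j, n) ∈ J ∧ z ∈ cell (j, n) := by
      simp only [mem_iUnion] at hz
      obtain ⟨⟨j, n⟩, h1, h2⟩ := hz
      exact ⟨j, n, h1, h2⟩
    obtain ⟨n, hn, hzn⟩ := Nat.find_spec hex
    simp only [mem_iUnion]
    refine ⟨(Nat.find hex, n), ⟨hn, ?_⟩, hzn⟩
    intro i' hi' hlt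
    refine disjoint_left.2 fun w hw hw' => ?_
    refine Nat.find_min hex hlt ⟨i'.2, hi', ?_⟩
    simp only [cell, mem_preimage, mem_singleton_iff] at hw hw' hzn ⊢
    rw [← hw']
    exact idx_le hlt.le (hzn.trans hw.symm)

lemma nest_density (J : Set (Ix d)) (Γ : Set (Z d)) (θ : ℝ≥0∞)
    (h : ∀ i ∈ J, volume (Γ ∩ cell i) ≤ θ * volume (cell i)) :
    volume (Γ ∩ ⋃ i ∈ J, cell i) ≤ θ * volume (⋃ i ∈ J, cell i) := by
  obtain ⟨J', hJ', hd, he⟩ := nest_max J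
  rw [he, inter_iUnion₂, measure_biUnion (to_countable J') hd fun i _ => cell_meas i, ← ENNReal.tsum_mul_left]
  refine (measure_biUnion_le _ (to_countable J') _).trans ?_
  exact ENNReal.tsum_le_tsum fun i => h i (hJ' i.2)

end LinEst

namespace LinEst
variable {d : ℕ}

lemma norm_le_coord (x : E d) {s : ℝ} (hs : 0 ≤ s) (h : ∀ i, |x i| ≤ s) : ‖x‖ ≤ d * s := by
  rw [EuclideanSpace.norm_eq]
  refine Real.sqrt_le_iff.2 ⟨by positivity, ?_⟩
  calc ∑ i, ‖x i‖ ^ 2 ≤ ∑ _i : Fin d, s ^ 2 := by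
        refine Finset.sum_le_sum fun i _ => ?_
        have := h i
        rw [Real.norm_eq_abs]; gcongr
    _ = d * s ^ 2 := by simp
    _ ≤ (d * s) ^ 2 := by
        rw [mul_pow]
        have : (d : ℝ) ≤ d ^ 2 := by exact_mod_cast Nat.le_self_pow (by norm_num) d
        gcongr

def corner (i : Ix d) : Z d := (i.2.1 * tlen i.1, WithLp.toLp 2 fun l => i.2.2 l * slen i.1)

def box (Λ ρ : ℝ) (i : Ix d) : Set (Z d) :=
  Icc ((corner i).1 - Λ * tlen i.1) ((corner i).1 + Λ * tlen i.1) ×ˢ Metric.closedBall (corner i).2 (ρ * slen i.1)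

lemma cellK_corner {i : Ix d} {x : E d} (hx : x ∈ cellK i.1 i.2.2) : ‖x - (corner i).2‖ ≤ d * slen i.1 := by
  refine norm_le_coord _ (slen_pos _).le fun l => ?_
  have := mem_cellK.1 hx l
  simp only [corner, PiLp.sub_apply, abs_le]
  constructor <;> linarith [slen_pos i.1]

lemma cell_corner {i : Ix d} {z : Z d} (hz : z ∈ cell i) :
    (corner i).1 ≤ z.1 ∧ z.1 < (corner i).1 + tlen i.1 ∧ z.2 ∈ cellK i.1 i.2.2 := by
  rw [cell_eq] at hz
  exact ⟨hz.1.1, hz.1.2, hz.2⟩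

lemma bad_vol (d : ℕ) {Λ ρ : ℝ} (hΛ : 0 < Λ) (hρ : 0 < ρ) : ∃ CV : ℝ, 0 < CV ∧ ∀ (ν : Measure (Z d)) (κ : ℝ) (J : Set (Ix d)),
    ν univ ≤ 1 → 0 < κ → (∀ i ∈ J, ENNReal.ofReal (κ * slen i.1 ^ (d + 2)) ≤ ν (box Λ ρ i)) →
    volume (⋃ i ∈ J, cell i) ≤ ENNReal.ofReal (CV / κ) := by
  set v1 := (volume (Metric.ball (0 : E d) 1)).toReal with hv1
  have hv1' : volume (Metric.ball (0 : E d) 1) = ENNReal.ofReal v1 := by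
    rw [hv1, ENNReal.ofReal_toReal measure_ball_lt_top.ne]
  have hv10 : 0 < v1 := ENNReal.toReal_pos (Metric.measure_ball_pos _ _ one_pos).ne' measure_ball_lt_top.ne
  set Λ2 := 4 + 5 * Λ
  set ρ2 := 2 * d + 3 * ρ
  refine ⟨2 * Λ2 * ρ2 ^ d * v1, by positivity, fun ν κ J hν hκ hJ => ?_⟩
  obtain ⟨u, huJ, hud, hu⟩ := Vitali.exists_disjoint_subfamily_covering_enlargement (box Λ ρ) J (fun i => slen i.1) 2
    (by norm_num) (fun i _ => (slen_pos _).le) 1 (fun i _ => slen_le _) (fun i _ => ⟨corner i, by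
      have h1 := mul_pos hΛ (tlen_pos i.1)
      have h2 := mul_pos hρ (slen_pos i.1)
      exact ⟨⟨by linarith, by linarith⟩, Metric.mem_closedBall_self h2.le⟩⟩)
  have hsub : (⋃ i ∈ J, cell i) ⊆ ⋃ b ∈ u, box Λ2 ρ2 b := by
    refine iUnion₂_subset fun i hi z hz => ?_
    obtain ⟨b, hb, ⟨y, hy1, hy2⟩, hs⟩ := hu i hi
    refine mem_iUnion₂.2 ⟨b, hb, ?_⟩
    obtain ⟨c1, c2, c3⟩ := cell_corner hz
    have c4 := cellK_corner c3
    have ht : tlen i.1 ≤ 4 * tlen b.1 := by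
      rw [tlen_eq, tlen_eq]
      calc slen i.1 ^ 2 ≤ (2 * slen b.1) ^ 2 := by have := slen_pos i.1; gcongr
        _ = _ := by ring
    have ht' : Λ * tlen i.1 ≤ Λ * (4 * tlen b.1) := by gcongr
    have hρ' : ρ * slen i.1 ≤ ρ * (2 * slen b.1) := by gcongr
    have hd' : d * slen i.1 ≤ d * (2 * slen b.1) := by gcongr
    have htb := tlen_pos b.1
    constructor
    · simp only [Λ2]
      constructor <;> nlinarith [hy1.1.1, hy1.1.2, hy2.1.1, hy2.1.2]
    · have e1 := mem_closedBall_iff_norm.1 hy1.2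
      have e2 := mem_closedBall_iff_norm.1 hy2.2
      rw [mem_closedBall_iff_norm]
      have e : z.2 - (corner b).2 = (z.2 - (corner i).2) - (y.2 - (corner i).2) + (y.2 - (corner b).2) := by abel
      rw [e]
      refine (norm_add_le _ _).trans ?_
      have := norm_sub_le (z.2 - (corner i).2) (y.2 - (corner i).2)
      simp only [ρ2]
      nlinarith
  have hvol : ∀ b : Ix d, volume (box Λ2 ρ2 b) = ENNReal.ofReal (2 * Λ2 * ρ2 ^ d * v1 * slen b.1 ^ (d + 2)) := by
    intro b
    have hs := slen_pos b.1
    rw [box, Measure.volume_eq_prod, Measure.prod_prod, Real.volume_Icc, Measure.addHaar_closedBall _ _ (by positivity),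
      hv1', ← ENNReal.ofReal_mul (by positivity), ← ENNReal.ofReal_mul (by rw [tlen_eq]; ring_nf; positivity)]
    congr 1
    rw [tlen_eq, finrank_euclideanSpace, Fintype.card_fin]; ring
  calc volume (⋃ i ∈ J, cell i) ≤ volume (⋃ b ∈ u, box Λ2 ρ2 b) := measure_mono hsub
    _ ≤ ∑' b : u, volume (box Λ2 ρ2 b.1) := measure_biUnion_le _ (to_countable u) _
    _ ≤ ∑' b : u, ENNReal.ofReal (2 * Λ2 * ρ2 ^ d * v1 / κ) * ν (box Λ ρ b.1) := by
        refine ENNReal.tsum_le_tsum fun b => ?_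
        rw [hvol]
        calc ENNReal.ofReal (2 * Λ2 * ρ2 ^ d * v1 * slen b.1.1 ^ (d + 2))
            = ENNReal.ofReal (2 * Λ2 * ρ2 ^ d * v1 / κ) * ENNReal.ofReal (κ * slen b.1.1 ^ (d + 2)) := by
              rw [← ENNReal.ofReal_mul (by positivity)]; congr 1; field_simp
          _ ≤ _ := by gcongr; exact hJ _ (huJ b.2)
    _ = ENNReal.ofReal (2 * Λ2 * ρ2 ^ d * v1 / κ) * ν (⋃ b ∈ u, box Λ ρ b) := by
        rw [ENNReal.tsum_mul_left, measure_biUnion (to_countable u) hud fun b _ =>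
          measurableSet_Icc.prod Metric.isClosed_closedBall.measurableSet]
    _ ≤ ENNReal.ofReal (2 * Λ2 * ρ2 ^ d * v1 / κ) * 1 := by
        gcongr; exact (measure_mono (subset_univ _)).trans hν
    _ = _ := mul_one _

end LinEst

namespace LinEst
variable {d : ℕ}

def c00 (d : ℕ) (δ K : ℝ) : ℝ := (4 ^ (d + 2) * (16 * 64 ^ d) * (cA d δ * 2 ^ d) * cL d δ K ^ (d + 1))⁻¹
def c0 (d : ℕ) (δ K : ℝ) : ℝ := min (c00 d δ K) (1 / 2)

lemma c0_pos (d : ℕ) {δ K : ℝ} (hδ : 0 < δ) (hK : 0 ≤ K) : 0 < c0 d δ K := by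
  have h1 := cA_pos (d := d) hδ
  have h2 := cL_pos (d := d) hδ hK
  unfold c0 c00; positivity

lemma c0_le (d : ℕ) (δ K : ℝ) : c0 d δ K ≤ 1 / 2 := min_le_right _ _

abbrev Y (d : ℕ) : Set (E d) := cellK 0 0

lemma mem_Y {x : E d} : x ∈ Y d ↔ ∀ i, 0 ≤ x i ∧ x i < 1 := by
  rw [mem_cellK]; simp [slen]

lemma norm_Y {x : E d} (hx : x ∈ Y d) : ‖x‖ ≤ d := by
  have := norm_le_coord x (s := 1) zero_le_one fun i => by
    have := mem_Y.1 hx i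
    rw [abs_le]; constructor <;> linarith
  simpa using this

lemma cellK_Y {j : ℕ} {k : Fin d → ℤ} {x x' : E d} (hx : x ∈ cellK j k) (hx' : x' ∈ cellK j k) (hY : x ∈ Y d) :
    x' ∈ Y d := by
  have h : idx j ((0 : ℝ), x) = idx j ((0 : ℝ), x') := by
    simp only [idx, Prod.mk.injEq, true_and, funext_iff]
    intro i; exact (hx i).trans (hx' i).symm
  have h2 := idx_le (Nat.zero_le j) h
  simp only [idx, Prod.mk.injEq, true_and, funext_iff] at h2
  intro i
  exact (h2 i).symm.trans (hY i)

lemma cell_time {i : Ix d} {z : Z d} (hz : z ∈ cell i) {T : ℕ} (hT : z.1 < T) :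
    (corner i).1 + tlen i.1 ≤ T := by
  obtain ⟨h1, -, -⟩ := cell_corner hz
  have h3 : (i.2.1 : ℝ) * tlen i.1 < T := h1.trans_lt hT
  have h4 : (0 : ℝ) < 4 ^ i.1 := by positivity
  have h5 : tlen i.1 = ((4 : ℝ) ^ i.1)⁻¹ := by simp [tlen]
  have h6 : (i.2.1 : ℝ) < T * 4 ^ i.1 := by rwa [h5, ← div_eq_mul_inv, div_lt_iff₀ h4] at h3
  have h7 : i.2.1 < (T : ℤ) * 4 ^ i.1 := by exact_mod_cast h6
  have h8 : (i.2.1 : ℝ) + 1 ≤ T * 4 ^ i.1 := by exact_mod_cast Int.add_one_le_iff.2 h7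
  have h9 : (corner i).1 + tlen i.1 = (i.2.1 + 1) / 4 ^ i.1 := by simp only [corner]; rw [h5]; field_simp
  rw [h9, div_le_iff₀ h4]; exact h8

lemma cell_time0 {i : Ix d} {z : Z d} (hz : z ∈ cell i) (h0 : 0 ≤ z.1) : 0 ≤ (corner i).1 := by
  obtain ⟨-, h2, -⟩ := cell_corner hz
  have h3 := tlen_pos i.1
  have h4 : (0 : ℝ) < (i.2.1 + 1) * tlen i.1 := by
    simp only [corner] at h2; linarith
  have h5 : (0 : ℝ) < i.2.1 + 1 := by
    by_contra h; push Not at h; nlinarith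
  have h6 : 0 < i.2.1 + 1 := by exact_mod_cast h5
  have h7 : (0 : ℝ) ≤ i.2.1 := by exact_mod_cast Int.lt_add_one_iff.1 h6
  exact mul_nonneg h7 h3.le

def cen (i : Ix d) : E d := WithLp.toLp 2 fun l => i.2.2 l * slen i.1 + slen i.1 / 2

lemma cen_near {i : Ix d} {x : E d} (hx : ‖x - cen i‖ < slen i.1 / 2) : x ∈ cellK i.1 i.2.2 := by
  rw [mem_cellK]
  intro l
  have h1 := (PiLp.norm_apply_le (x - cen i) l).trans_lt hx
  simp only [cen, PiLp.sub_apply, Real.norm_eq_abs, abs_lt] at h1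
  constructor <;> linarith [h1.1, h1.2]

lemma cen_mem (i : Ix d) : cen i ∈ cellK i.1 i.2.2 := cen_near (by simp [slen_pos])

variable {δ K T ϱ : ℝ} {v vt : Z d → ℝ} {G : Z d → E d} {H : Z d → Matrix (Fin d) (Fin d) ℝ}
    {a : Z d → Matrix (Fin d) (Fin d) ℝ} {f : Z d → ℝ}

lemma core (h : Sub δ K T ϱ v vt G H a f) (hδ : 0 < δ) (hδ1 : δ ≤ 1) (hK : 0 ≤ K) (hϱ : (d : ℝ) + 2 ≤ ϱ)
    {M M2 t0 α b : ℝ} {p x0 x1 : E d} (hM : 0 ≤ M) (hMM : M ≤ M2) (hM2 : 1 ≤ M2) (i : Ix d)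
    (hP : ∀ t ∈ Icc t0 T, ∀ x ∈ Metric.closedBall (0 : E d) ϱ,
      α + inner ℝ p (x - x0) - M / 2 * ‖x - x0‖ ^ 2 - M * (t - t0) ≤ v (t, x))
    (ht0 : t0 ≤ (corner i).1 + tlen i.1 / 2) (hτ0 : 0 ≤ (corner i).1) (hτT : (corner i).1 + tlen i.1 ≤ T)
    (hY : cen i ∈ Y d) (hx1 : ‖x1 - cen i‖ ≤ slen i.1 / 4)
    (hclose : v ((corner i).1 + tlen i.1 / 2, x1) - (α + inner ℝ p (x1 - x0) - M / 2 * ‖x1 - x0‖ ^ 2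
      - M * ((corner i).1 + tlen i.1 / 2 - t0)) ≤ M2 * slen i.1 ^ 2 / 128)
    (hb : 0 ≤ b)
    (hfb : ∫⁻ z in Ico ((corner i).1 + tlen i.1 / 2) ((corner i).1 + tlen i.1) ×ˢ Metric.ball (cen i) (slen i.1),
      ENNReal.ofReal (f z) ^ (d + 1) ≤ ENNReal.ofReal b)
    (hbM : cA d δ * 2 ^ d * b ≤ M2 ^ (d + 1) * (slen i.1 / 4) ^ (d + 2) / (16 * 64 ^ d)) :
    volume (cell i \ AM T ϱ v G (M + M2)) ≤ ENNReal.ofReal (1 - c0 d δ K) * volume (cell i) := by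
  set s := slen i.1 with hs
  have hs0 : 0 < s := slen_pos _
  have hs1 : s ≤ 1 := slen_le _
  have htl : tlen i.1 = s ^ 2 := tlen_eq _
  rw [htl] at ht0 hτT hclose hfb
  set τ1 := (corner i).1 + s ^ 2 / 2 with hτ1
  have hs2 : 0 < s ^ 2 := by positivity
  have hR : (s / 4) ^ 2 / 4 = s ^ 2 / 64 := by ring
  have hcn := norm_Y hY
  have hx1n : ‖x1‖ ≤ d + s / 4 := by
    have := norm_le_norm_add_norm_sub' x1 (cen i); linarith
  have hball : Metric.ball x1 (s / 4) ⊆ Metric.ball (cen i) s := by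
    intro x hx
    rw [mem_ball_iff_norm] at *
    have : x - cen i = (x - x1) + (x1 - cen i) := by abel
    rw [this]
    have := norm_add_le (x - x1) (x1 - cen i)
    linarith
  obtain ⟨S, hSc, hSs, hSA, hSv⟩ := step2 h hδ hδ1 hK (R := s / 4) (τ1 := τ1) (x1 := x1) hM hMM hM2 (by positivity) hP
    ht0 (by positivity) (by rw [hR]; linarith) (by linarith) (by linarith [hclose, (by ring : M2 * (s / 4) ^ 2 / 8 = M2 * s ^ 2 / 128)]) hb
    ((lintegral_mono_set (prod_mono (Ico_subset_Ico le_rfl (by rw [hR]; linarith)) hball)).trans hfb)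
  have hScell : S ⊆ cell i := by
    intro z hz
    obtain ⟨hz1, hz2⟩ := hSs hz
    rw [cell_eq]
    refine ⟨⟨?_, ?_⟩, ?_⟩
    · have := hz1.1; simp only [corner] at hτ1; linarith
    · have := hz1.2; rw [hR] at this; simp only [corner] at hτ1; linarith
    · apply cen_near
      rw [mem_ball_iff_norm] at hz2
      have e : z.2 - cen i = (z.2 - x1) + (x1 - cen i) := by abel
      rw [e]
      have := norm_add_le (z.2 - x1) (x1 - cen i)
      simp only [← hs]
      linarith
  have hcA := cA_pos (d := d) hδ
  have hcL := cL_pos (d := d) hδ hK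
  have hM20 : 0 < M2 := by linarith
  have hSvol : c00 d δ K * s ^ (d + 2) ≤ (volume S).toReal := by
    rw [c00, inv_mul_le_iff₀ (by positivity)]
    have e0 : M2 ^ (d + 1) * (s / 4) ^ (d + 2) / (8 * 64 ^ d) = 2 * (M2 ^ (d + 1) * (s / 4) ^ (d + 2) / (16 * 64 ^ d)) := by
      field_simp; ring
    have e1 : M2 ^ (d + 1) * (s / 4) ^ (d + 2) / (16 * 64 ^ d) ≤
      cA d δ * 2 ^ d * ((cL d δ K * M2) ^ (d + 1) * (volume S).toReal) := by
      rw [e0, mul_add] at hSv; linarith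
    rw [div_le_iff₀ (by positivity), mul_pow, div_pow, ← mul_div_assoc, div_le_iff₀ (by positivity)] at e1
    have e2 : 0 < M2 ^ (d + 1) := by positivity
    refine le_of_mul_le_mul_left ?_ e2
    calc M2 ^ (d + 1) * s ^ (d + 2) ≤ _ := e1
      _ = _ := by ring
  have hSfin : volume S ≠ ⊤ := hSc.measure_lt_top.ne
  calc volume (cell i \ AM T ϱ v G (M + M2)) ≤ volume (cell i \ S) := measure_mono (diff_subset_diff_right hSA)
    _ = volume (cell i) - volume S := measure_diff hScell hSc.measurableSet.nullMeasurableSet hSfin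
    _ ≤ ENNReal.ofReal (s ^ (d + 2)) - ENNReal.ofReal (c00 d δ K * s ^ (d + 2)) := by
        rw [cell_vol]
        refine tsub_le_tsub le_rfl ?_
        rw [← ENNReal.ofReal_toReal hSfin]
        exact ENNReal.ofReal_le_ofReal hSvol
    _ = ENNReal.ofReal (s ^ (d + 2) - c00 d δ K * s ^ (d + 2)) := by
        rw [ENNReal.ofReal_sub]; unfold c00; positivity
    _ ≤ ENNReal.ofReal ((1 - c0 d δ K) * s ^ (d + 2)) := by
        apply ENNReal.ofReal_le_ofReal
        have : c0 d δ K ≤ c00 d δ K := min_le_left _ _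
        have := mul_le_mul_of_nonneg_right this (by positivity : 0 ≤ s ^ (d + 2))
        linarith
    _ = _ := by
        rw [cell_vol, ENNReal.ofReal_mul]
        linarith [c0_le d δ K]

end LinEst

namespace LinEst
variable {d : ℕ}

lemma AM.mono {T ϱ : ℝ} {v : Z d → ℝ} {G : Z d → E d} {M M' : ℝ} (hM : M ≤ M') : AM T ϱ v G M ⊆ AM T ϱ v G M' := by
  rintro z ⟨h1, h2, h3⟩
  refine ⟨h1, h2, fun t ht x hx => le_trans ?_ (h3 t ht x hx)⟩
  have e1 : M / 2 * ‖x - z.2‖ ^ 2 ≤ M' / 2 * ‖x - z.2‖ ^ 2 := by gcongr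
  have e2 : M * (t - z.1) ≤ M' * (t - z.1) := by
    have := ht.1
    gcongr
  linarith

lemma root (d : ℕ) {δ K : ℝ} (hδ : 0 < δ) (hδ1 : δ ≤ 1) (hK : 0 ≤ K) : ∃ Mr : ℝ, 1 ≤ Mr ∧
    ∀ {T ϱ : ℝ} {v vt : Z d → ℝ} {G : Z d → E d} {H : Z d → Matrix (Fin d) (Fin d) ℝ}
    {a : Z d → Matrix (Fin d) (Fin d) ℝ} {f : Z d → ℝ} (_ : Sub δ K T ϱ v vt G H a f) (_ : (d : ℝ) + 2 ≤ ϱ)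
    {M : ℝ} (_ : Mr ≤ M) (i : Ix d) (_ : i.1 = 0) (_ : cen i ∈ Y d) (_ : 0 ≤ (corner i).1)
    (_ : (corner i).1 + tlen i.1 ≤ T),
    volume (cell i \ AM T ϱ v G M) ≤ ENNReal.ofReal (1 - c0 d δ K) * volume (cell i) := by
  have hcA := cA_pos (d := d) hδ
  set q := cA d δ * 2 ^ d * (4 ^ (d + 2) * (16 * 64 ^ d)) with hq
  have hq0 : 0 < q := by positivity
  refine ⟨256 + q, by linarith, ?_⟩
  intro T ϱ v vt G H a f h hϱ M hM i hi hY h0 hT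
  have hs : slen i.1 = 1 := by simp [hi, slen]
  have ht : tlen i.1 = 1 := by simp [hi, tlen]
  have hcn := norm_Y hY
  have hdom : ∀ t ∈ Icc 0 T, ∀ x ∈ Metric.closedBall (0 : E d) ϱ,
      (-1 : ℝ) + inner ℝ (0 : E d) (x - 0) - 0 / 2 * ‖x - 0‖ ^ 2 - 0 * (t - 0) ≤ v (t, x) := by
    intro t ht x hx
    have := (abs_le.1 (h.bd t ht x hx)).1
    simpa using this
  have := core h hδ hδ1 hK hϱ (M := 0) (M2 := M) (t0 := 0) (α := -1) (b := 1) (p := 0) (x0 := 0) (x1 := cen i)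
    le_rfl (by linarith) (by linarith) i hdom (by rw [ht]; linarith) h0 hT hY (by rw [sub_self, norm_zero, hs]; norm_num)
    (by
      have := (abs_le.1 (h.bd ((corner i).1 + tlen i.1 / 2) ⟨by rw [ht]; linarith, by rw [ht] at hT ⊢; linarith⟩ (cen i)
        (by simp; linarith))).2
      rw [hs]
      simp only [inner_zero_left]
      linarith) zero_le_one
    (by
      rw [ENNReal.ofReal_one]
      refine (lintegral_mono_set (prod_mono ?_ ?_)).trans h.fint
      · intro t htt; exact ⟨by linarith [htt.1, tlen_pos i.1], by linarith [htt.2]⟩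
      · intro x hx
        rw [mem_ball_iff_norm, hs] at hx
        have := norm_le_norm_add_norm_sub' x (cen i)
        simp; linarith)
    (by
      rw [hs, mul_one, le_div_iff₀ (by positivity), div_pow, one_pow, ← div_eq_mul_one_div, le_div_iff₀ (by positivity)]
      calc cA d δ * 2 ^ d * (16 * 64 ^ d) * 4 ^ (d + 2) = q := by rw [hq]; ring
        _ ≤ M := by linarith
        _ ≤ M ^ (d + 1) := le_self_pow₀ (by linarith) (by omega))
  simpa using this

def nuf (T ϱ : ℝ) (f : Z d → ℝ) : Measure (Z d) :=
  (volume.restrict (Icc 0 T ×ˢ Metric.closedBall (0 : E d) ϱ)).withDensity fun z => ENNReal.ofReal (f z) ^ (d + 1)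

lemma nuf_apply {T ϱ : ℝ} {f : Z d → ℝ} {s : Set (Z d)} (hs : MeasurableSet s) :
    nuf T ϱ f s = ∫⁻ z in s ∩ Icc 0 T ×ˢ Metric.closedBall (0 : E d) ϱ, ENNReal.ofReal (f z) ^ (d + 1) := by
  rw [nuf, withDensity_apply _ hs, Measure.restrict_restrict hs]

set_option maxHeartbeats 1000000 in
lemma child (d m : ℕ) {δ K : ℝ} (hδ : 0 < δ) (hδ1 : δ ≤ 1) (hK : 0 ≤ K) : ∃ ρ C ζ : ℝ, 1 ≤ ρ ∧ 2 ≤ C ∧ 0 < ζ ∧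
    ∀ {T : ℕ} {ϱ : ℝ} {v vt : Z d → ℝ} {G : Z d → E d} {H : Z d → Matrix (Fin d) (Fin d) ℝ}
    {a : Z d → Matrix (Fin d) (Fin d) ℝ} {f : Z d → ℝ} (_ : Sub δ K T ϱ v vt G H a f) (_ : (d : ℝ) + 2 + ρ ≤ ϱ)
    {M : ℝ} (_ : 1 ≤ M) (j : ℕ) (z z0 : Z d) (_ : 0 ≤ z.1) (_ : z.1 < T) (_ : z.2 ∈ Y d)
    (_ : nuf T ϱ f (box (m + 1) (d + 1 + ρ) (j, idx j z)) ≤ ENNReal.ofReal (ζ * M ^ (d + 1) * slen j ^ (d + 2)))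
    (_ : z0 ∈ AM T ϱ v G M)
    (_ : z0 ∈ Ico ((corner (j, idx j z)).1 - m * tlen j) (corner (j, idx j z)).1 ×ˢ cellK j (idx j z).2),
    volume (cell (j + 1, idx (j + 1) z) \ AM T ϱ v G (C * M)) ≤
      ENNReal.ofReal (1 - c0 d δ K) * volume (cell (j + 1, idx (j + 1) z)) := by
  obtain ⟨ρ, C1, hρ, hC1, hstep⟩ := step1 d (Λ := 4 * (m + 1)) (D := 2 * d) hδ hδ1 hK
    (by have : (0 : ℝ) ≤ m := Nat.cast_nonneg m
        linarith) (by positivity)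
  have hcA := cA_pos (d := d) hδ
  set q := cA d δ * 2 ^ d * (2 ^ (d + 2) * (4 ^ (d + 2) * (16 * 64 ^ d))) with hq
  have hq0 : 0 < q := by positivity
  refine ⟨ρ, 1 + 128 * C1, 1 / (2 * q), hρ, by linarith, by positivity, ?_⟩
  intro T ϱ v vt G H a f h hϱ M hM j z z0 hz0 hzT hzY hnu hA hst
  set i : Ix d := (j, idx j z) with hi
  set i' : Ix d := (j + 1, idx (j + 1) z) with hi'
  have hzi : z ∈ cell i := rfl
  have hzi' : z ∈ cell i' := rfl
  set s := slen (j + 1) with hs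
  have hs0 : 0 < s := slen_pos _
  have hs1 : s ≤ 1 := slen_le _
  have hsj : slen j = 2 * s := by rw [hs, slen_succ]; ring
  have htj : tlen j = 4 * s ^ 2 := by rw [tlen_eq, hsj]; ring
  have hti' : tlen i'.1 = s ^ 2 := tlen_eq _
  have hsi' : slen i'.1 = s := rfl
  have hs2 : 0 < s ^ 2 := by positivity
  have hm0 : (0 : ℝ) ≤ m := Nat.cast_nonneg m
  obtain ⟨hz1, hz2, hzK⟩ := cell_corner hzi
  obtain ⟨hz1', hz2', hzK'⟩ := cell_corner hzi'
  have hcK : cen i' ∈ cellK i'.1 i'.2.2 := cen_mem i'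
  have hcY : cen i' ∈ Y d := cellK_Y hzK' hcK hzY
  have hcn := norm_Y hcY
  -- the child cell is inside the parent cell
  have hsub : ∀ w ∈ cell i', w ∈ cell i := fun w hw => by
    have : idx (j + 1) w = idx (j + 1) z := hw
    exact idx_succ this
  have hcorn : (corner i').1 ∈ Ico (corner i).1 ((corner i).1 + tlen j) ∧ cen i' ∈ cellK j (idx j z).2 := by
    have : ((corner i').1, cen i') ∈ cell i := by
      apply hsub
      rw [cell_eq]
      exact ⟨⟨le_rfl, by have := tlen_pos i'.1; simp only [corner]; linarith⟩, hcK⟩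
    obtain ⟨e1, e2, e3⟩ := cell_corner this
    exact ⟨⟨e1, e2⟩, e3⟩
  have hcend : (corner i').1 + s ^ 2 ≤ (corner i).1 + tlen j := by
    by_contra hcon
    push Not at hcon
    have : ((corner i).1 + tlen j, cen i') ∈ cell i := by
      apply hsub
      rw [cell_eq]
      refine ⟨⟨?_, ?_⟩, hcK⟩
      · exact hcorn.1.2.le
      · show (corner i).1 + tlen j < (corner i').1 + tlen i'.1
        rw [hti']; exact hcon
    obtain ⟨e1, e2, e3⟩ := cell_corner this
    exact absurd e2 (lt_irrefl _)
  have hc0 := cell_time0 hzi' hz0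
  have hcT := cell_time hzi' hzT
  rw [hti'] at hcT
  set τ1 := (corner i').1 + s ^ 2 / 2 with hτ1
  obtain ⟨⟨hst1, hst2⟩, hstK⟩ := hst
  -- the mass of f
  set b := 1 / (2 * q) * M ^ (d + 1) * slen j ^ (d + 2) with hb
  have hb0 : 0 ≤ b := by rw [hb, hsj]; positivity
  have hmass : ∀ S ⊆ box (m + 1) (d + 1 + ρ) i ∩ Icc 0 (T : ℝ) ×ˢ Metric.closedBall (0 : E d) ϱ,
      ∫⁻ z in S, ENNReal.ofReal (f z) ^ (d + 1) ≤ ENNReal.ofReal b := by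
    intro S hS
    refine (lintegral_mono_set hS).trans ?_
    rw [← nuf_apply (s := box (m + 1) (d + 1 + ρ) i) (measurableSet_Icc.prod Metric.isClosed_closedBall.measurableSet)]
    exact hnu
  have hcc : ‖cen i' - (corner i).2‖ ≤ d * (2 * s) := by
    have := cellK_corner (i := i) hcorn.2
    rwa [show slen i.1 = 2 * s from hsj] at this
  have hboxb : ∀ t ∈ Icc z0.1 ((corner i').1 + s ^ 2), ∀ x ∈ Metric.ball (cen i') (ρ * s),
      (t, x) ∈ box (m + 1) (d + 1 + ρ) i ∩ Icc 0 (T : ℝ) ×ˢ Metric.closedBall (0 : E d) ϱ := by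
    intro t ht x hx
    rw [mem_ball_iff_norm] at hx
    have hρs : ρ * s ≤ ρ := mul_le_of_le_one_right (by linarith) hs1
    refine ⟨⟨⟨?_, ?_⟩, ?_⟩, ⟨hA.1.1.trans ht.1, ht.2.trans hcT⟩, ?_⟩
    · simp only [show tlen i.1 = tlen j from rfl]; have := ht.1; have := tlen_pos j; linarith
    · simp only [show tlen i.1 = tlen j from rfl]; have := ht.2
      have := mul_nonneg hm0 (tlen_pos j).le
      linarith
    · rw [mem_closedBall_iff_norm, show slen i.1 = 2 * s from hsj]
      have e : x - (corner i).2 = (x - cen i') + (cen i' - (corner i).2) := by abel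
      simp only
      rw [e]
      refine (norm_add_le _ _).trans ?_
      have : 0 ≤ ρ * s := by positivity
      linarith
    · have := norm_le_norm_add_norm_sub' x (cen i')
      rw [mem_closedBall_zero_iff]
      linarith
  have hz0c : ‖z0.2 - cen i'‖ ≤ 2 * d * s := by
    have := norm_le_coord (z0.2 - cen i') (s := 2 * s) (by positivity) fun l => by
      have e1 := mem_cellK.1 hstK l
      have e2 := mem_cellK.1 hcorn.2 l
      rw [hsj] at e1 e2
      simp only [PiLp.sub_apply, abs_le]
      constructor <;> linarith [e1.1, e1.2, e2.1, e2.2]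
    linarith
  have hqb : q * b = M ^ (d + 1) * s ^ (d + 2) / 2 * 2 ^ (d + 2) := by
    rw [hb, hsj, mul_pow]; field_simp
  have hMs : 0 < M ^ (d + 1) * s ^ (d + 2) := by positivity
  have hcab : cA d δ * 2 ^ d * b * (4 ^ (d + 2) * (16 * 64 ^ d)) = M ^ (d + 1) * s ^ (d + 2) / 2 := by
    have h2 : (0 : ℝ) < 2 ^ (d + 2) := by positivity
    have : cA d δ * 2 ^ d * b * (4 ^ (d + 2) * (16 * 64 ^ d)) * 2 ^ (d + 2) = M ^ (d + 1) * s ^ (d + 2) / 2 * 2 ^ (d + 2) := by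
      rw [← hqb, hq]; ring
    exact mul_right_cancel₀ h2.ne' this
  have hcab0 : 0 ≤ cA d δ * 2 ^ d * b := by positivity
  have hC1M : M ≤ C1 * M := le_mul_of_one_le_left (by linarith) (by linarith)
  have hρss : s ≤ ρ * s := le_mul_of_one_le_left hs0.le (by linarith)
  obtain ⟨x1, hx1, hx1v⟩ := hstep h (M := M) (r := s) (τ1 := τ1) (b := b) (z0 := z0) (y1 := cen i') hM hs0 hs1 hA
    (by linarith [hcorn.1.1]) (by rw [htj] at hst1 hcend; linarith) (by linarith)
    hz0c (by have : ρ * s ≤ ρ := mul_le_of_le_one_right (by linarith) hs1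
             linarith) hb0
    (hmass _ fun w hw => hboxb w.1 ⟨hw.1.1, by linarith [hw.1.2]⟩ w.2 hw.2)
    (by
      have : (1 : ℝ) ≤ 4 ^ (d + 2) * (16 * 64 ^ d) := by
        have e1 : (1 : ℝ) ≤ 4 ^ (d + 2) := one_le_pow₀ (by norm_num)
        have e2 : (1 : ℝ) ≤ 64 ^ d := one_le_pow₀ (by norm_num)
        linarith [mul_le_mul e1 (show (1:ℝ) ≤ 16 * 64 ^ d by linarith) zero_le_one (by linarith)]
      have := mul_le_mul_of_nonneg_left this hcab0
      linarith)
  have hfin := core h hδ hδ1 hK (by linarith) (M := M) (M2 := 128 * C1 * M) (t0 := z0.1) (α := v z0) (b := b) (p := G z0)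
    (x0 := z0.2) (x1 := x1) (by linarith) (by linarith [hC1M]) (by linarith [hC1M]) i' hA.2.2
    (by rw [hti']; linarith [hcorn.1.1]) hc0 (by rw [hti']; exact hcT) hcY (by rw [hsi']; exact hx1)
    (by rw [hti', hsi']; exact hx1v.trans (le_of_eq (by ring))) hb0
    (by
      rw [hti', hsi']
      refine hmass _ fun w hw => hboxb w.1 ⟨by linarith [hw.1.1, hcorn.1.1], hw.1.2.le⟩ w.2
        (Metric.ball_subset_ball (by linarith [hρss]) hw.2))
    (by
      rw [hsi', div_pow, le_div_iff₀ (by positivity), ← mul_div_assoc, le_div_iff₀ (by positivity)]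
      calc cA d δ * 2 ^ d * b * (16 * 64 ^ d) * 4 ^ (d + 2) = M ^ (d + 1) * s ^ (d + 2) / 2 := by rw [← hcab]; ring
        _ ≤ M ^ (d + 1) * s ^ (d + 2) := by linarith
        _ ≤ _ := by gcongr; linarith [hC1M])
  rwa [show (1 + 128 * C1) * M = M + 128 * C1 * M by ring]

end LinEst

namespace LinEst
variable {d : ℕ}

def Ek (T ϱ : ℝ) (v : Z d → ℝ) (G : Z d → E d) (s M : ℝ) : Set (Z d) := (Ioo s T ×ˢ Y d) \ AM T ϱ v G M

lemma cell_small {j : ℕ} {z w : Z d} (hw : w ∈ cell (j, idx j z)) : |w.1 - z.1| ≤ slen j ∧ ‖w.2 - z.2‖ ≤ d * slen j := by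
  have hz : z ∈ cell (j, idx j z) := rfl
  obtain ⟨h1, h2, h3⟩ := cell_corner hw
  obtain ⟨h4, h5, h6⟩ := cell_corner hz
  have ht : tlen j ≤ slen j := by
    rw [tlen_eq, sq]; exact mul_le_of_le_one_left (slen_pos j).le (slen_le j)
  simp only at h1 h2 h4 h5
  refine ⟨abs_le.2 ⟨by linarith, by linarith⟩, norm_le_coord _ (slen_pos _).le fun l => ?_⟩
  have e1 := mem_cellK.1 h3 l
  have e2 := mem_cellK.1 h6 l
  simp only [PiLp.sub_apply, abs_le]
  simp only at e1 e2
  constructor <;> linarith [e1.1, e1.2, e2.1, e2.2]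

lemma exists_cell_sub {Γ A : Set (Z d)} {s T : ℝ} (hA : IsClosed A) (hΓ : Γ = (Ioo s T ×ˢ Y d) \ A) {z : Z d} (hz : z ∈ Γ) :
    ∃ j, cell (j, idx j z) ⊆ Γ := by
  have hop : IsOpen ((Ioo s T ×ˢ (univ : Set (E d))) \ A) := (isOpen_Ioo.prod isOpen_univ).sdiff hA
  have hz' : z ∈ (Ioo s T ×ˢ (univ : Set (E d))) \ A := by
    rw [hΓ] at hz; exact ⟨⟨hz.1.1, mem_univ _⟩, hz.2⟩
  obtain ⟨r, hr, hsub⟩ := Metric.isOpen_iff.1 hop z hz'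
  obtain ⟨j, hj⟩ := exists_pow_lt_of_lt_one (show 0 < r / (d + 1) by positivity) (show (1 / 2 : ℝ) < 1 by norm_num)
  rw [lt_div_iff₀ (by positivity)] at hj
  refine ⟨j, fun w hw => ?_⟩
  have hsm := cell_small hw
  have hsp := slen_pos j
  have hj' : slen j * (d + 1) < r := hj
  have hd0 : (0 : ℝ) ≤ d := Nat.cast_nonneg d
  have hwb : w ∈ Metric.ball z r := by
    rw [Metric.mem_ball, Prod.dist_eq, max_lt_iff, Real.dist_eq, dist_eq_norm]
    constructor
    · refine hsm.1.trans_lt (lt_of_le_of_lt ?_ hj'); nlinarith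
    · refine hsm.2.trans_lt (lt_of_le_of_lt ?_ hj'); nlinarith
  have hw2 := hsub hwb
  rw [hΓ] at hz ⊢
  have hzc : z ∈ cell (j, idx j z) := rfl
  exact ⟨⟨hw2.1.1, cellK_Y (cell_corner hzc).2.2 (cell_corner hw).2.2 hz.1.2⟩, hw2.2⟩

lemma iter_step (d m : ℕ) {δ K : ℝ} (hm : 0 < m) (hδ : 0 < δ) (hδ1 : δ ≤ 1) (hK : 0 ≤ K) : ∃ ρ C Mr CF : ℝ, 1 ≤ ρ ∧ 2 ≤ C ∧ 1 ≤ Mr ∧ 0 < CF ∧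
    ∀ {T : ℕ} {ϱ : ℝ} {v vt : Z d → ℝ} {G : Z d → E d} {H : Z d → Matrix (Fin d) (Fin d) ℝ}
    {a : Z d → Matrix (Fin d) (Fin d) ℝ} {f : Z d → ℝ} (_ : Sub δ K T ϱ v vt G H a f) (_ : (d : ℝ) + 2 + ρ ≤ ϱ)
    {M : ℝ} (_ : Mr ≤ M) {s s' e R : ℝ} (_ : 0 ≤ s) (_ : 0 ≤ e) (_ : 0 < R) (_ : volume (Ek T ϱ v G s M) ≤ ENNReal.ofReal e)
    (_ : e * 2 ^ (d + 3) ≤ R ^ (d + 2)) (_ : s + (m + 1) * R ^ 2 ≤ s'),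
    volume (Ek T ϱ v G s' (C * M)) ≤ ENNReal.ofReal ((1 - c0 d δ K) * ((m + 1) / m) * e + CF / M) := by
  obtain ⟨Mr, hMr, hroot⟩ := root d hδ hδ1 hK
  obtain ⟨ρ, C, ζ, hρ, hC, hζ, hchild⟩ := child d m hδ hδ1 hK
  have hm0 : (0 : ℝ) < m := Nat.cast_pos.2 hm
  obtain ⟨CV, hCV, hbad⟩ := bad_vol d (Λ := m + 1) (ρ := d + 1 + ρ) (by positivity) (by positivity)
  refine ⟨ρ, C, Mr, CV / ζ, hρ, hC, hMr, by positivity, ?_⟩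
  intro T ϱ v vt G H a f h hϱ M hM s s' e R hs he hR hvol heR hss
  have hM1 : 1 ≤ M := hMr.trans hM
  have hc0 := c0_pos d hδ hK
  have hc1 := c0_le d δ K
  set c := c0 d δ K with hc
  set Γ := Ek T ϱ v G s' (C * M) with hΓ
  have hs' : s ≤ s' := le_trans (by nlinarith [sq_nonneg R]) hss
  have hΓE : Γ ⊆ Ek T ϱ v G s M := fun z hz =>
    ⟨⟨⟨hs'.trans_lt hz.1.1.1, hz.1.1.2⟩, hz.1.2⟩, fun hA => hz.2 (AM.mono (by nlinarith) hA)⟩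
  have hΓcell : ∀ i, Γ ∩ cell i ⊆ cell i \ AM T ϱ v G (C * M) := fun i z hz => ⟨hz.2, hz.1.2⟩
  -- dense cells
  have hdense : ∀ z ∈ Γ, ∃ j, volume (Γ ∩ cell (j, idx j z)) ≤ ENNReal.ofReal (1 - c) * volume (cell (j, idx j z)) ∧
      ENNReal.ofReal (1 - c) * volume (cell (j + 1, idx (j + 1) z)) < volume (Γ ∩ cell (j + 1, idx (j + 1) z)) := by
    intro z hz
    classical
    have hex : ∃ j, ENNReal.ofReal (1 - c) * volume (cell (j, idx j z)) < volume (Γ ∩ cell (j, idx j z)) := by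
      obtain ⟨j, hj⟩ := exists_cell_sub (AM.closed h (C * M)) rfl hz
      refine ⟨j, ?_⟩
      rw [inter_eq_right.2 (show cell (j, idx j z) ⊆ Γ from hj), cell_vol, ← ENNReal.ofReal_mul (by linarith)]
      have := pow_pos (slen_pos j) (d + 2)
      exact (ENNReal.ofReal_lt_ofReal_iff this).2 (by simp only; nlinarith)
    rcases hn : Nat.find hex with _ | j
    · exfalso
      have h1 := Nat.find_spec hex
      rw [hn] at h1
      have hzc : z ∈ cell (0, idx 0 z) := rfl
      refine absurd (h1.trans_le (measure_mono (hΓcell _))) (not_lt.2 ?_)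
      exact hroot h (by linarith) (by nlinarith) _ rfl
        (cellK_Y (cell_corner hzc).2.2 (cen_mem _) hz.1.2) (cell_time0 hzc (by linarith [hz.1.1.1])) (cell_time hzc hz.1.1.2)
    · refine ⟨j, ?_, ?_⟩
      · exact not_lt.1 (Nat.find_min hex (m := j) (by omega))
      · have h1 := Nat.find_spec hex
        rwa [hn] at h1
  choose! jz hj1 hj2 using hdense
  have hsl : ∀ z ∈ Γ, slen (jz z) ≤ R := by
    intro z hz
    have h1 : ENNReal.ofReal (1 - c) * volume (cell (jz z + 1, idx (jz z + 1) z)) ≤ ENNReal.ofReal e :=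
      (hj2 z hz).le.trans ((measure_mono (inter_subset_left.trans hΓE)).trans hvol)
    rw [cell_vol, ← ENNReal.ofReal_mul (by linarith), ENNReal.ofReal_le_ofReal_iff he] at h1
    simp only [slen_succ, div_pow] at h1
    have hp := pow_pos (slen_pos (jz z)) (d + 2)
    have h2 : slen (jz z) ^ (d + 2) ≤ e * 2 ^ (d + 3) := by
      have h3 : 1 / 2 * (slen (jz z) ^ (d + 2) / 2 ^ (d + 2)) ≤ e :=
        le_trans (mul_le_mul_of_nonneg_right (by linarith) (by positivity)) h1
      have h4 : (0 : ℝ) < 2 ^ (d + 2) := by positivity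
      have h5 : 1 / 2 * (slen (jz z) ^ (d + 2) / 2 ^ (d + 2)) * 2 ^ (d + 3) = slen (jz z) ^ (d + 2) := by
        rw [pow_succ 2 (d + 2)]; field_simp
      rw [← h5]; gcongr
    exact le_of_pow_le_pow_left₀ (by omega) hR.le (h2.trans heR)
  set Jg : Set (Ix d) := {i | ∃ z ∈ Γ, i = (jz z, idx (jz z) z) ∧
    nuf T ϱ f (box (m + 1) (d + 1 + ρ) i) ≤ ENNReal.ofReal (ζ * M ^ (d + 1) * slen i.1 ^ (d + 2))} with hJg
  set Jb : Set (Ix d) := {i | ENNReal.ofReal (ζ * M ^ (d + 1) * slen i.1 ^ (d + 2)) ≤ nuf T ϱ f (box (m + 1) (d + 1 + ρ) i)} with hJb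
  have hcov : Γ ⊆ (Γ ∩ ⋃ i ∈ Jg, cell i) ∪ ⋃ i ∈ Jb, cell i := by
    intro z hz
    have hzc : z ∈ cell (jz z, idx (jz z) z) := rfl
    rcases le_total (nuf T ϱ f (box (m + 1) (d + 1 + ρ) (jz z, idx (jz z) z)))
      (ENNReal.ofReal (ζ * M ^ (d + 1) * slen (jz z) ^ (d + 2))) with hle | hle
    · exact Or.inl ⟨hz, mem_iUnion₂.2 ⟨_, ⟨z, hz, rfl, hle⟩, hzc⟩⟩
    · exact Or.inr (mem_iUnion₂.2 ⟨_, hle, hzc⟩)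
  have hb : volume (⋃ i ∈ Jb, cell i) ≤ ENNReal.ofReal (CV / ζ / M) := by
    refine (hbad (nuf T ϱ f) (ζ * M ^ (d + 1)) Jb ?_ (by positivity) fun i hi => hi).trans (ENNReal.ofReal_le_ofReal ?_)
    · rw [nuf_apply MeasurableSet.univ, univ_inter]; exact h.fint
    · rw [div_div]
      have : M ≤ M ^ (d + 1) := le_self_pow₀ hM1 (by omega)
      gcongr
  have hstack : (⋃ i : Jg, Ico ((corner i.1).1 - m * tlen i.1.1) (corner i.1).1 ×ˢ cellK i.1.1 i.1.2.2) ⊆ Ek T ϱ v G s M := by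
    intro w hw
    obtain ⟨⟨i, z, hz, hi, hnu⟩, hw⟩ := mem_iUnion.1 hw
    have hzc : z ∈ cell i := by rw [hi]; rfl
    obtain ⟨hz1, hz2, hz3⟩ := cell_corner hzc
    have hR' := hsl z hz
    have ht : tlen i.1 ≤ R ^ 2 := by
      rw [hi]; simp only [tlen_eq]
      exact pow_le_pow_left₀ (slen_pos _).le hR' 2
    have hw1 := hw.1.1
    have hw2 := hw.1.2
    have hzs := hz.1.1.1
    simp only at hw1 hw2
    refine ⟨⟨⟨?_, ?_⟩, cellK_Y hz3 hw.2 hz.1.2⟩, fun hA => ?_⟩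
    · nlinarith
    · linarith [hz.1.1.2]
    · have hc := hchild h hϱ hM1 (jz z) z w (by linarith) hz.1.1.2 hz.1.2 (by rw [hi] at hnu; exact hnu) hA
        (by simp only at hw; rw [hi] at hw; exact hw)
      exact absurd ((hj2 z hz).trans_le (measure_mono (hΓcell _))) (not_lt.2 hc)
  have hlag := lag_prod (fun i : Jg => (corner i.1).1) (fun i : Jg => tlen i.1.1) (fun i => tlen_pos _) m
    (fun i : Jg => cellK i.1.1 i.1.2.2) (fun i => cellK_meas _ _)
  have hUsub : (⋃ i ∈ Jg, cell i) ⊆ ⋃ i : Jg, Ico ((corner i.1).1 - m * tlen i.1.1) ((corner i.1).1 + tlen i.1.1) ×ˢ cellK i.1.1 i.1.2.2 := by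
    intro w hw
    obtain ⟨i, hi, hwi⟩ := mem_iUnion₂.1 hw
    obtain ⟨h1, h2, h3⟩ := cell_corner hwi
    refine mem_iUnion.2 ⟨⟨i, hi⟩, ⟨?_, h2⟩, h3⟩
    have := mul_pos hm0 (tlen_pos i.1)
    simp only; linarith
  have hU : volume (⋃ i ∈ Jg, cell i) ≤ ENNReal.ofReal ((m + 1) / m * e) := by
    have h1 : (m : ℝ≥0∞) * volume (⋃ i ∈ Jg, cell i) ≤ (m + 1) * ENNReal.ofReal e :=
      (mul_le_mul_right (measure_mono hUsub) _).trans (hlag.trans (mul_le_mul_right ((measure_mono hstack).trans hvol) _))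
    have h2 : ((m : ℝ≥0∞) + 1) * ENNReal.ofReal e = (m : ℝ≥0∞) * ENNReal.ofReal ((m + 1) / m * e) := by
      rw [show ((m : ℝ≥0∞) + 1) = ENNReal.ofReal (m + 1) by
        rw [ENNReal.ofReal_add hm0.le zero_le_one]; simp, show (m : ℝ≥0∞) = ENNReal.ofReal m by simp,
        ← ENNReal.ofReal_mul (by positivity), ← ENNReal.ofReal_mul (by positivity)]
      congr 1; field_simp
    rw [h2] at h1
    exact (ENNReal.mul_le_mul_iff_right (by simpa using hm.ne') (ENNReal.natCast_ne_top m)).1 h1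
  have hg := nest_density Jg Γ (ENNReal.ofReal (1 - c)) (by
    rintro i ⟨z, hz, hi, -⟩
    rw [hi]; exact hj1 z hz)
  calc volume Γ ≤ volume (Γ ∩ ⋃ i ∈ Jg, cell i) + volume (⋃ i ∈ Jb, cell i) := (measure_mono hcov).trans (measure_union_le _ _)
    _ ≤ ENNReal.ofReal (1 - c) * ENNReal.ofReal ((m + 1) / m * e) + ENNReal.ofReal (CV / ζ / M) :=
        add_le_add (hg.trans (mul_le_mul_right hU _)) hb
    _ = _ := by
        rw [← ENNReal.ofReal_mul (by linarith), ← ENNReal.ofReal_add]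
        · congr 1; ring
        · have : 0 ≤ 1 - c := by linarith
          positivity
        · positivity

end LinEst

namespace LinEst
variable {d : ℕ}

lemma Ek_meas {δ K T ϱ : ℝ} {v vt : Z d → ℝ} {G : Z d → E d} {H : Z d → Matrix (Fin d) (Fin d) ℝ}
    {a : Z d → Matrix (Fin d) (Fin d) ℝ} {f : Z d → ℝ} (h : Sub δ K T ϱ v vt G H a f) (s M : ℝ) :
    MeasurableSet (Ek T ϱ v G s M) :=
  (measurableSet_Ioo.prod (cellK_meas _ _)).diff (AM.closed h M).measurableSet

lemma strip_vol (s T : ℝ) : volume (Ioo s T ×ˢ Y d) = ENNReal.ofReal (T - s) := by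
  rw [Measure.volume_eq_prod, Measure.prod_prod, cellK_vol, Real.volume_Ioo]
  simp [slen]

set_option maxHeartbeats 1000000 in
lemma decay (d : ℕ) (hd : 1 ≤ d) {δ K : ℝ} (hδ : 0 < δ) (hδ1 : δ ≤ 1) (hK : 0 ≤ K) :
    ∃ (T : ℕ) (ϱ M0 C θ : ℝ), 1 ≤ T ∧ d + 1 ≤ ϱ ∧ 1 ≤ M0 ∧ 2 ≤ C ∧ 0 < θ ∧ θ < 1 ∧
    ∀ {v vt : Z d → ℝ} {G : Z d → E d} {H : Z d → Matrix (Fin d) (Fin d) ℝ}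
    {a : Z d → Matrix (Fin d) (Fin d) ℝ} {f : Z d → ℝ} (_ : Sub δ K T ϱ v vt G H a f) (k : ℕ),
    volume (Ek T ϱ v G (T - 1) (M0 * C ^ k)) ≤ ENNReal.ofReal (T * θ ^ k) := by
  have hc0 := c0_pos d hδ hK
  have hc1 := c0_le d δ K
  set c := c0 d δ K with hc
  obtain ⟨m, hm⟩ := exists_nat_gt (1 / c)
  have hm0 : (0 : ℝ) < m := lt_trans (by positivity) hm
  have hmN : 0 < m := Nat.cast_pos.1 hm0
  set q := (1 - c) * ((m + 1) / m) with hq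
  have hq1 : q < 1 := by
    rw [hq, ← mul_div_assoc, div_lt_one hm0]
    rw [div_lt_iff₀ hc0] at hm
    nlinarith
  have hq0 : 1 / 2 ≤ q := by
    have : (1 : ℝ) ≤ (m + 1) / m := by rw [le_div_iff₀ hm0]; linarith
    rw [hq]; nlinarith
  obtain ⟨ρ, C, Mr, CF, hρ, hC, hMr, hCF, hit⟩ := iter_step d m hmN hδ hδ1 hK
  have hd2 : (0 : ℝ) < (d + 2 : ℕ) := by positivity
  set η := 1 - (1 - q) / (2 * (d + 2 : ℕ)) with hη
  have hx0 : 0 < (1 - q) / (2 * (d + 2 : ℕ)) := div_pos (by linarith) (by positivity)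
  have hx1 : (1 - q) / (2 * (d + 2 : ℕ)) ≤ 1 / 2 := by
    rw [div_le_iff₀ (by positivity)]; push_cast
    have : (0 : ℝ) ≤ d := Nat.cast_nonneg d
    linarith
  have hη1 : η < 1 := by linarith
  have hη0 : 0 < η := by linarith
  set θ := η ^ (d + 2) with hθ
  have hθ0 : 0 < θ := by positivity
  have hθ1 : θ < 1 := pow_lt_one₀ hη0.le hη1 (by omega)
  have hθq : (1 + q) / 2 ≤ θ := by
    have := one_add_mul_le_pow (a := -((1 - q) / (2 * (d + 2 : ℕ)))) (by linarith) (d + 2)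
    have e : ((d + 2 : ℕ) : ℝ) * -((1 - q) / (2 * (d + 2 : ℕ))) = -((1 - q) / 2) := by field_simp
    rw [e] at this
    rw [hθ, hη, sub_eq_add_neg]
    linarith
  have hη' : 0 < 1 - η := by linarith
  obtain ⟨n, hn⟩ := exists_nat_gt ((m + 1) / (1 - η))
  have hn0 : (0 : ℝ) ≤ n := Nat.cast_nonneg n
  set B : ℝ := 2 ^ (d + 3) * (n + 1) with hB
  have hB1 : 1 ≤ B := by
    have : (1 : ℝ) ≤ 2 ^ (d + 3) := one_le_pow₀ (by norm_num)
    rw [hB]; nlinarith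
  set T : ℕ := (2 ^ (d + 3) * (n + 1)) ^ (d + 1) * (n + 1) with hT
  have hTr : (T : ℝ) = B ^ (d + 1) * (n + 1) := by rw [hT, hB]; push_cast; ring
  have hT1 : (1 : ℝ) ≤ T := by
    rw [hTr]; have : 1 ≤ B ^ (d + 1) := one_le_pow₀ hB1
    nlinarith
  have hTB : B ^ 2 * n ≤ T - 1 := by
    rw [hTr]
    have h1 : B ^ 2 ≤ B ^ (d + 1) := pow_le_pow_right₀ hB1 (by omega)
    have h2 : 1 ≤ B ^ (d + 1) := one_le_pow₀ hB1
    have h3 : B ^ 2 * n ≤ B ^ (d + 1) * n := by gcongr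
    linarith
  set M0 := Mr + CF / (θ - q) with hM0
  have hθq' : 0 < θ - q := by linarith
  have hM0r : Mr ≤ M0 := by
    have : 0 < CF / (θ - q) := by positivity
    linarith
  have hM0' : CF / (θ - q) ≤ M0 := by linarith
  have hM01 : 1 ≤ M0 := hMr.trans hM0r
  refine ⟨T, d + 2 + ρ, M0, C, θ, by exact_mod_cast hT1, by linarith, hM01, hC, hθ0, hθ1, ?_⟩
  intro v vt G H a f h
  set S : ℕ → ℝ := fun k => (m + 1) * B ^ 2 * ((1 - η ^ k) / (1 - η)) with hS
  clear_value η q B T M0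
  have hηk : ∀ k : ℕ, 0 < η ^ k ∧ η ^ k ≤ 1 := fun k => ⟨by positivity, pow_le_one₀ hη0.le hη1.le⟩
  have hS0 : ∀ k, 0 ≤ S k := fun k => by
    have : 0 ≤ 1 - η ^ k := by linarith [(hηk k).2]
    simp only [hS]; positivity
  have hST : ∀ k, S k ≤ T - 1 := fun k => by
    refine le_trans ?_ hTB
    have h1 : (1 - η ^ k) / (1 - η) ≤ 1 / (1 - η) := by
      gcongr; linarith [(hηk k).1]
    calc S k ≤ (m + 1) * B ^ 2 * (1 / (1 - η)) := by simp only [hS]; gcongr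
      _ = B ^ 2 * ((m + 1) / (1 - η)) := by ring
      _ ≤ _ := by gcongr
  have main : ∀ k, volume (Ek T (d + 2 + ρ) v G (S k) (M0 * C ^ k)) ≤ ENNReal.ofReal (T * θ ^ k) := by
    intro k
    induction k with
    | zero =>
      refine (measure_mono diff_subset).trans ?_
      rw [strip_vol]; simp [hS]
    | succ k ih =>
      have hCk : 1 ≤ C ^ k := one_le_pow₀ (by linarith)
      have := hit h le_rfl (M := M0 * C ^ k) (by nlinarith) (s := S k) (s' := S (k + 1)) (e := T * θ ^ k) (R := B * η ^ k)
        (hS0 k) (by positivity) (by positivity) ih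
        (le_of_eq (by
            calc (T : ℝ) * θ ^ k * 2 ^ (d + 3) = B ^ (d + 1) * (2 ^ (d + 3) * (n + 1)) * θ ^ k := by rw [hTr]; ring
              _ = B ^ (d + 1) * B * (η ^ k) ^ (d + 2) := by rw [← hB, hθ, pow_right_comm]
              _ = (B * η ^ k) ^ (d + 2) := by rw [mul_pow]; ring))
        (by
          have e1 : S (k + 1) - S k = (m + 1) * B ^ 2 * η ^ k := by
            simp only [hS]; rw [pow_succ]; field_simp; ring
          have e2 : (B * η ^ k) ^ 2 ≤ B ^ 2 * η ^ k := by
            rw [mul_pow]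
            gcongr
            rw [sq]; exact mul_le_of_le_one_left (hηk k).1.le (hηk k).2
          have e3 : ((m : ℝ) + 1) * (B * η ^ k) ^ 2 ≤ (m + 1) * (B ^ 2 * η ^ k) := by gcongr
          linarith)
      rw [pow_succ' C, mul_left_comm]
      refine this.trans (ENNReal.ofReal_le_ofReal ?_)
      have hCθ : 1 ≤ C * θ := by
        have : 2 * (1 / 2) ≤ C * θ := mul_le_mul hC (by linarith) (by norm_num) (by linarith)
        linarith
      have hCθk : 1 ≤ C ^ k * θ ^ k := by rw [← mul_pow]; exact one_le_pow₀ hCθ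
      have h1 : CF / (M0 * C ^ k) ≤ (θ - q) * θ ^ k := by
        rw [div_le_iff₀ (by positivity)]
        rw [div_le_iff₀ hθq'] at hM0'
        have hx : 0 ≤ M0 * (θ - q) := by positivity
        calc CF ≤ M0 * (θ - q) := hM0'
          _ ≤ M0 * (θ - q) * (C ^ k * θ ^ k) := le_mul_of_one_le_right hx hCθk
          _ = _ := by ring
      have h2 : (θ - q) * θ ^ k ≤ T * ((θ - q) * θ ^ k) := le_mul_of_one_le_left (by positivity) hT1
      rw [pow_succ]
      calc _ ≤ q * (T * θ ^ k) + T * ((θ - q) * θ ^ k) := by rw [← hc, ← hq]; linarith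
        _ = _ := by ring
  intro k
  refine (measure_mono ?_).trans (main k)
  intro z hz
  exact ⟨⟨⟨(hST k).trans_lt hz.1.1.1, hz.1.1.2⟩, hz.1.2⟩, hz.2⟩

end LinEst

namespace LinEst
variable {d : ℕ}

lemma exists_eps {C θ : ℝ} (hC : 2 ≤ C) (hθ0 : 0 < θ) (hθ1 : θ < 1) : ∃ ε : ℝ, 0 < ε ∧ ε ≤ 1 / 4 ∧ C ^ ε * θ < 1 := by
  have h1 : Filter.Tendsto (fun ε : ℝ => C ^ ε * θ) (nhdsWithin 0 (Ioi 0)) (nhds (C ^ (0 : ℝ) * θ)) := by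
    refine Filter.Tendsto.mul_const _ ?_
    exact ((Real.continuous_const_rpow (by linarith)).tendsto 0).mono_left nhdsWithin_le_nhds
  rw [Real.rpow_zero, one_mul] at h1
  have h2 := h1.eventually (gt_mem_nhds hθ1)
  have h3 : ∀ᶠ ε : ℝ in nhdsWithin 0 (Ioi 0), ε < 1 / 4 :=
    Filter.Eventually.filter_mono nhdsWithin_le_nhds (gt_mem_nhds (by norm_num))
  obtain ⟨ε, ha, hb, hc⟩ := (h2.and (h3.and self_mem_nhdsWithin)).exists
  exact ⟨ε, hc, hb.le, ha⟩

lemma rpow_small {x : ℝ≥0∞} {ε : ℝ} (h0 : 0 < ε) (h1 : ε ≤ 1) (n : ℕ) : x ^ ε ≤ 1 + x ^ (n + 1) := by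
  rcases le_total x 1 with h | h
  · exact (ENNReal.rpow_le_one h h0.le).trans le_self_add
  · calc x ^ ε ≤ x ^ (1 : ℝ) := ENNReal.rpow_le_rpow_of_exponent_le h h1
      _ = x := ENNReal.rpow_one x
      _ ≤ x ^ (n + 1) := le_self_pow₀ h (by omega)
      _ ≤ _ := le_add_self

lemma interior (d : ℕ) (hd : 1 ≤ d) {δ K : ℝ} (hδ : 0 < δ) (hδ1 : δ ≤ 1) (hK : 0 ≤ K) :
    ∃ (T : ℕ) (ϱ ε C : ℝ), 1 ≤ T ∧ d + 1 ≤ ϱ ∧ 0 < ε ∧ ε ≤ 1 / 4 ∧ 0 < C ∧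
    ∀ {v vt : Z d → ℝ} {G : Z d → E d} {H : Z d → Matrix (Fin d) (Fin d) ℝ}
    {a : Z d → Matrix (Fin d) (Fin d) ℝ} {f : Z d → ℝ} (_ : Sub δ K T ϱ v vt G H a f),
    ∫⁻ z in Ioo (T - 1 : ℝ) T ×ˢ Y d, ENNReal.ofReal (frobNorm (H z)) ^ ε ≤ ENNReal.ofReal C := by
  obtain ⟨T, ϱ, M0, C, θ, hT, hϱ, hM0, hC, hθ0, hθ1, hdec⟩ := decay d hd hδ hδ1 hK
  obtain ⟨ε, hε0, hε1, hε⟩ := exists_eps hC hθ0 hθ1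
  have hcL := cL_pos (d := d) hδ hK
  set C2 : ℝ := d * (δ⁻¹ * (1 + cL d δ K) + 1) with hC2
  have hC20 : 0 ≤ C2 := by positivity
  set A : ℝ := C2 ^ ε with hA
  have hA0 : 0 ≤ A := by positivity
  set P : ℝ := A * (2 + M0 ^ ε) with hP
  have hP0 : 0 ≤ P := by positivity
  set r := C ^ ε * θ with hr
  have hr0 : 0 ≤ r := by positivity
  set Q : ℝ := A * M0 ^ ε * C ^ ε * T with hQ
  have hQ0 : 0 ≤ Q := by positivity
  refine ⟨T, ϱ, ε, P + Q * (1 - r)⁻¹ + 1, hT, hϱ, hε0, hε1, ?_, ?_⟩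
  · have : 0 ≤ (1 - r)⁻¹ := inv_nonneg.2 (by linarith)
    positivity
  intro v vt G H a f h
  set W := Ioo (T - 1 : ℝ) T ×ˢ Y d with hW
  have hWm : MeasurableSet W := measurableSet_Ioo.prod (cellK_meas _ _)
  have hWv : volume W = 1 := by rw [hW, strip_vol]; simp
  set Ee : ℕ → Set (Z d) := fun k => Ek T ϱ v G (T - 1) (M0 * C ^ k) with hEe
  have hEm : ∀ k, MeasurableSet (Ee k) := fun k => Ek_meas h _ _
  have hMk : ∀ k : ℕ, 1 ≤ M0 * C ^ k := fun k => one_le_mul_of_one_le_of_one_le hM0 (one_le_pow₀ (by linarith))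
  -- pointwise bound in terms of the level
  have hpt : ∀ z ∈ W, ∀ k, z ∉ Ee k → ENNReal.ofReal (frobNorm (H z)) ^ ε ≤
      ENNReal.ofReal A * (1 + ENNReal.ofReal (f z) ^ (d + 1)) + ENNReal.ofReal (A * (M0 * C ^ k) ^ ε) := by
    intro z hz k hk
    have hzA : z ∈ AM T ϱ v G (M0 * C ^ k) := by
      by_contra hcon; exact hk ⟨hz, hcon⟩
    have h1 := AM.frob h hδ hK (hMk k) hzA hz.1.2
    have hf := h.f0 z
    have h2 : frobNorm (H z) ≤ C2 * (f z + M0 * C ^ k) := by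
      refine h1.trans ?_
      rw [hC2, mul_assoc]
      have hMp : 0 < M0 * C ^ k := lt_of_lt_of_le one_pos (hMk k)
      have : δ⁻¹ * (f z + cL d δ K * (M0 * C ^ k)) + M0 * C ^ k ≤ (δ⁻¹ * (1 + cL d δ K) + 1) * (f z + M0 * C ^ k) := by
        have e1 : 0 ≤ δ⁻¹ * (cL d δ K * f z) := by positivity
        have e2 : 0 ≤ δ⁻¹ * (M0 * C ^ k) := by positivity
        linarith
      gcongr
    have hMp : 0 ≤ M0 * C ^ k := zero_le_one.trans (hMk k)
    calc ENNReal.ofReal (frobNorm (H z)) ^ ε ≤ ENNReal.ofReal (C2 * (f z + M0 * C ^ k)) ^ ε :=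
          ENNReal.rpow_le_rpow (ENNReal.ofReal_le_ofReal h2) hε0.le
      _ = ENNReal.ofReal A * (ENNReal.ofReal (f z) + ENNReal.ofReal (M0 * C ^ k)) ^ ε := by
          rw [ENNReal.ofReal_mul hC20, ENNReal.mul_rpow_of_nonneg _ _ hε0.le, hA, ENNReal.ofReal_rpow_of_nonneg hC20 hε0.le,
            ENNReal.ofReal_add hf hMp]
      _ ≤ ENNReal.ofReal A * (ENNReal.ofReal (f z) ^ ε + ENNReal.ofReal (M0 * C ^ k) ^ ε) := by
          gcongr; exact ENNReal.rpow_add_le_add_rpow _ _ hε0.le (by linarith)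
      _ ≤ ENNReal.ofReal A * ((1 + ENNReal.ofReal (f z) ^ (d + 1)) + ENNReal.ofReal ((M0 * C ^ k) ^ ε)) := by
          rw [ENNReal.ofReal_rpow_of_nonneg hMp hε0.le]
          gcongr; exact rpow_small hε0 (by linarith) d
      _ = _ := by rw [mul_add, ENNReal.ofReal_mul hA0]
  have hnull : volume (⋂ k, Ee k) = 0 := by
    refine le_antisymm (ge_of_tendsto' (x := Filter.atTop) (f := fun k : ℕ => ENNReal.ofReal (T * θ ^ k)) ?_ fun k =>
      (measure_mono (iInter_subset _ k)).trans (hdec h k)) zero_le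
    have := (tendsto_pow_atTop_nhds_zero_of_lt_one hθ0.le hθ1).const_mul (T : ℝ)
    rw [mul_zero] at this
    simpa using ENNReal.tendsto_ofReal this
  set g : Z d → ℝ≥0∞ := fun z => ENNReal.ofReal A * (1 + ENNReal.ofReal (f z) ^ (d + 1)) + ENNReal.ofReal (A * M0 ^ ε) with hg
  set u : ℕ → Z d → ℝ≥0∞ := fun k => (Ee k).indicator fun _ => ENNReal.ofReal (A * (M0 * C ^ (k + 1)) ^ ε) with hu
  have hbound : ∀ᵐ z ∂(volume.restrict W), ENNReal.ofReal (frobNorm (H z)) ^ ε ≤ g z + ∑' k, u k z := by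
    have h0 : ∀ᵐ z ∂(volume.restrict W), z ∉ ⋂ k, Ee k := ae_restrict_of_ae (measure_eq_zero_iff_ae_notMem.1 hnull)
    filter_upwards [h0, ae_restrict_mem hWm] with z hz hzW
    classical
    have hex : ∃ k, z ∉ Ee k := by simpa using hz
    rcases hn : Nat.find hex with _ | k
    · have h1 := Nat.find_spec hex
      rw [hn] at h1
      have := hpt z hzW 0 h1
      rw [pow_zero, mul_one] at this
      exact this.trans le_self_add
    · have h1 := Nat.find_spec hex
      rw [hn] at h1
      have h2 : z ∈ Ee k := not_not.1 (Nat.find_min hex (m := k) (by omega))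
      refine (hpt z hzW (k + 1) h1).trans ?_
      have h3 : ENNReal.ofReal (A * (M0 * C ^ (k + 1)) ^ ε) = u k z := by simp [hu, h2]
      rw [h3]
      exact add_le_add le_self_add (ENNReal.le_tsum k)
  have hgm : Measurable g := by
    have := h.fm
    simp only [hg]; fun_prop
  have hum : ∀ k, Measurable (u k) := fun k => measurable_const.indicator (hEm k)
  have hfW : ∫⁻ z in W, ENNReal.ofReal (f z) ^ (d + 1) ≤ 1 := by
    refine (lintegral_mono_set ?_).trans h.fint
    intro z hz
    have h1 : (1 : ℝ) ≤ T := by exact_mod_cast hT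
    refine ⟨⟨by linarith [hz.1.1], hz.1.2.le⟩, ?_⟩
    have := norm_Y hz.2
    rw [mem_closedBall_zero_iff]; linarith
  have hgi : ∫⁻ z in W, g z ≤ ENNReal.ofReal P := by
    have hfm := h.fm
    simp only [hg]
    rw [lintegral_add_right _ measurable_const, lintegral_const_mul _ (by fun_prop), lintegral_add_left measurable_const,
      setLIntegral_const, setLIntegral_const, hWv, mul_one, mul_one]
    calc _ ≤ ENNReal.ofReal A * (1 + 1) + ENNReal.ofReal (A * M0 ^ ε) := by gcongr
      _ = ENNReal.ofReal P := by
        rw [show (1 + 1 : ℝ≥0∞) = ENNReal.ofReal 2 by norm_num, ← ENNReal.ofReal_mul hA0, ← ENNReal.ofReal_add (by positivity) (by positivity), hP]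
        congr 1; ring
  have hui : ∫⁻ z in W, ∑' k, u k z ≤ ENNReal.ofReal (Q * (1 - r)⁻¹) := by
    rw [lintegral_tsum fun k => (hum k).aemeasurable]
    calc _ ≤ ∑' k : ℕ, ENNReal.ofReal (Q * r ^ k) := by
          refine ENNReal.tsum_le_tsum fun k => ?_
          refine (setLIntegral_le_lintegral _ _).trans ?_
          simp only [hu]
          rw [lintegral_indicator_const (hEm k)]
          refine (mul_le_mul_right (hdec h k) _).trans ?_
          rw [← ENNReal.ofReal_mul (by positivity)]
          refine ENNReal.ofReal_le_ofReal (le_of_eq ?_)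
          rw [Real.mul_rpow (by positivity) (by positivity), ← Real.rpow_natCast, ← Real.rpow_mul (by positivity), mul_comm _ ε,
            Real.rpow_mul (by positivity), Real.rpow_natCast, hQ, hr, mul_pow]
          ring
      _ = ENNReal.ofReal (Q * (1 - r)⁻¹) := by
          rw [← ENNReal.ofReal_tsum_of_nonneg (fun k => by positivity) ((summable_geometric_of_lt_one hr0 hε).mul_left _),
            tsum_mul_left, tsum_geometric_of_lt_one hr0 hε]
  calc _ ≤ ∫⁻ z in W, g z + ∑' k, u k z := lintegral_mono_ae hbound
    _ = (∫⁻ z in W, g z) + ∫⁻ z in W, ∑' k, u k z := lintegral_add_left hgm _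
    _ ≤ ENNReal.ofReal P + ENNReal.ofReal (Q * (1 - r)⁻¹) := add_le_add hgi hui
    _ ≤ _ := by
      have : 0 ≤ (1 - r)⁻¹ := inv_nonneg.2 (by linarith)
      rw [← ENNReal.ofReal_add hP0 (by positivity)]
      exact ENNReal.ofReal_le_ofReal (by linarith)

end LinEst

namespace LinEst
variable {d : ℕ}

/-- parabolic dilation and translation -/
def dil (tc : ℝ) (xc : E d) (r : ℝ) (z : Z d) : Z d := (tc + r ^ 2 * z.1, xc + r • z.2)

lemma JetAt.dil {w wt : Z d → ℝ} {G : Z d → E d} {H : Z d → Matrix (Fin d) (Fin d) ℝ} {tc : ℝ} {xc : E d} {r : ℝ} {z : Z d}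
    (h : JetAt w wt G H (dil tc xc r z)) :
    JetAt (fun z => w (LinEst.dil tc xc r z)) (fun z => r ^ 2 * wt (LinEst.dil tc xc r z)) (fun z => r • G (LinEst.dil tc xc r z))
      (fun z => r ^ 2 • H (LinEst.dil tc xc r z)) z := by
  have hd : HasFDerivAt (LinEst.dil tc xc r) ((r ^ 2 • ContinuousLinearMap.fst ℝ ℝ (E d)).prod
      (r • ContinuousLinearMap.snd ℝ ℝ (E d))) z := by
    refine HasFDerivAt.prodMk ?_ ?_
    · exact ((hasFDerivAt_fst (𝕜 := ℝ) (p := z)).const_mul (r ^ 2)).const_add tc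
    · exact ((hasFDerivAt_snd (𝕜 := ℝ) (p := z)).const_smul r).const_add xc
  refine ⟨?_, ?_, h.sym.smul _⟩
  · refine (h.hw.comp z hd).congr_fderiv ?_
    ext <;> simp [inner_smul_left, inner_smul_right]; ring
  · obtain ⟨q, hq⟩ := h.hG
    refine ⟨r ^ 3 • q, ((hq.comp z hd).const_smul r).congr_fderiv ?_⟩
    ext <;> simp <;> ring

lemma dil_map (tc : ℝ) (xc : E d) {r : ℝ} (hr : 0 < r) :
    Measure.map (dil tc xc r) (volume : Measure (Z d)) = ENNReal.ofReal ((r ^ (d + 2))⁻¹) • volume := by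
  have h1 : Measure.map (fun t : ℝ => tc + r ^ 2 * t) volume = ENNReal.ofReal ((r ^ 2)⁻¹) • volume := by
    have e : (fun t : ℝ => tc + r ^ 2 * t) = (fun t => tc + t) ∘ fun t => r ^ 2 * t := rfl
    rw [e, ← Measure.map_map (by fun_prop) (by fun_prop), Real.map_volume_mul_left (by positivity), Measure.map_smul,
      map_add_left_eq_self, abs_of_pos (by positivity)]
  have h2 : Measure.map (fun x : E d => xc + r • x) volume = ENNReal.ofReal ((r ^ d)⁻¹) • volume := by
    have e : (fun x : E d => xc + r • x) = (fun t => xc + t) ∘ fun t => r • t := rfl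
    rw [e, ← Measure.map_map (by fun_prop) (by fun_prop), Measure.map_addHaar_smul _ hr.ne', Measure.map_smul,
      map_add_left_eq_self, abs_of_pos (by positivity), finrank_euclideanSpace, Fintype.card_fin]
  have e : dil tc xc r = Prod.map (fun t : ℝ => tc + r ^ 2 * t) (fun x : E d => xc + r • x) := rfl
  rw [e, Measure.volume_eq_prod, ← Measure.map_prod_map _ _ (by fun_prop) (by fun_prop), h1, h2, Measure.prod_smul_left, Measure.prod_smul_right,
    smul_smul, ← ENNReal.ofReal_mul (by positivity)]
  congr 2; rw [pow_add]; field_simp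

lemma dil_emb (tc : ℝ) (xc : E d) {r : ℝ} (hr : 0 < r) : MeasurableEmbedding (dil tc xc r : Z d → Z d) := by
  have hc : Continuous (dil tc xc r : Z d → Z d) := by unfold dil; fun_prop
  have hi : Function.Injective (dil tc xc r : Z d → Z d) := by
    intro z w h
    simp only [dil, Prod.mk.injEq] at h
    have h1 : z.1 = w.1 := mul_left_cancel₀ (by positivity : r ^ 2 ≠ 0) (add_left_cancel h.1)
    have h2 : z.2 = w.2 := smul_right_injective _ hr.ne' (add_left_cancel h.2)
    exact Prod.ext h1 h2
  exact hc.measurableEmbedding hi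

lemma dil_lint (tc : ℝ) (xc : E d) {r : ℝ} (hr : 0 < r) (g : Z d → ℝ≥0∞) (S : Set (Z d)) :
    ∫⁻ z in dil tc xc r ⁻¹' S, g (dil tc xc r z) = ENNReal.ofReal ((r ^ (d + 2))⁻¹) * ∫⁻ z in S, g z := by
  have he := dil_emb tc xc hr
  rw [← he.lintegral_map, ← he.restrict_map, dil_map tc xc hr, Measure.restrict_smul, lintegral_smul_measure, smul_eq_mul]

structure Sol (δ K Mu R : ℝ) (u ut : Z d → ℝ) (G : Z d → E d) (H : Z d → Matrix (Fin d) (Fin d) ℝ)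
    (a : Z d → Matrix (Fin d) (Fin d) ℝ) (f : Z d → ℝ) : Prop where
  jet : ∀ z, JetAt u ut G H z
  ell : ∀ z, Ell δ (a z)
  bd : ∀ t ∈ Icc (1 / 2 : ℝ) 2, ∀ x ∈ Metric.closedBall (0 : E d) R, |u (t, x)| ≤ Mu
  f0 : ∀ z, 0 ≤ f z
  fm : Measurable f
  eq : ∀ t ∈ Icc (1 / 2 : ℝ) 2, ∀ x ∈ Metric.closedBall (0 : E d) R,
    ut (t, x) + ctr (a (t, x)) (H (t, x)) ≤ f (t, x) + K * ‖G (t, x)‖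
  fint : ∫⁻ z in Icc (1 / 2 : ℝ) 2 ×ˢ Metric.closedBall (0 : E d) R, ENNReal.ofReal (f z) ^ (d + 1) ≤ ENNReal.ofReal Mu ^ (d + 1)

lemma frob_smul (s : ℝ) (hs : 0 ≤ s) (H : Matrix (Fin d) (Fin d) ℝ) : frobNorm (s • H) = s * frobNorm H := by
  unfold frobNorm
  have : ∑ i, ∑ j, ((s • H) i j) ^ 2 = s ^ 2 * ∑ i, ∑ j, H i j ^ 2 := by
    simp [Finset.mul_sum, mul_pow]
  rw [this, Real.sqrt_mul (sq_nonneg s), Real.sqrt_sq hs]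

lemma cell_int (d : ℕ) {δ K : ℝ} (hK : 0 ≤ K) {T : ℕ} {ϱ ε C : ℝ} (hε : 0 < ε)
    (hinterior : ∀ {v vt : Z d → ℝ} {G : Z d → E d} {H : Z d → Matrix (Fin d) (Fin d) ℝ}
    {a : Z d → Matrix (Fin d) (Fin d) ℝ} {f : Z d → ℝ} (_ : Sub δ K T ϱ v vt G H a f),
    ∫⁻ z in Ioo (T - 1 : ℝ) T ×ˢ Y d, ENNReal.ofReal (frobNorm (H z)) ^ ε ≤ ENNReal.ofReal C)
    {Mu R : ℝ} {u ut : Z d → ℝ} {G : Z d → E d} {H : Z d → Matrix (Fin d) (Fin d) ℝ}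
    {a : Z d → Matrix (Fin d) (Fin d) ℝ} {f : Z d → ℝ} (hMu : 0 < Mu) (h : Sol δ K Mu R u ut G H a f) (i : Ix d)
    (hi1 : (corner i).1 + tlen i.1 ≤ 2) (hi2 : 1 / 2 ≤ (corner i).1 + tlen i.1 - T * tlen i.1)
    (hi3 : ‖(corner i).2‖ + ϱ * slen i.1 ≤ R) :
    ∫⁻ z in cell i, ENNReal.ofReal (frobNorm (H z)) ^ ε ≤
      ENNReal.ofReal (Mu / slen i.1 ^ 2) ^ ε * ENNReal.ofReal C * volume (cell i) := by
  set r := slen i.1 with hr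
  have hr0 : 0 < r := slen_pos _
  have hr1 : r ≤ 1 := slen_le _
  have ht : tlen i.1 = r ^ 2 := tlen_eq _
  rw [ht] at hi1 hi2
  set tc := (corner i).1 + r ^ 2 - T * r ^ 2 with htc
  set xc := (corner i).2 with hxc
  set s := 1 / Mu with hs
  have hs0 : 0 < s := by positivity
  have hdom : dil tc xc r ⁻¹' (Icc (1 / 2 : ℝ) 2 ×ˢ Metric.closedBall (0 : E d) R) ⊇ Icc 0 (T : ℝ) ×ˢ Metric.closedBall (0 : E d) ϱ := by
    rintro ⟨t, x⟩ ⟨⟨h1, h2⟩, h3⟩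
    simp only at h1 h2
    rw [mem_closedBall_zero_iff] at h3
    have hr2 : 0 < r ^ 2 := by positivity
    have e1 : 0 ≤ r ^ 2 * t := by positivity
    have e2 : r ^ 2 * t ≤ r ^ 2 * T := by gcongr
    refine ⟨⟨?_, ?_⟩, ?_⟩
    · simp only [dil]; linarith
    · simp only [dil]; linarith
    · rw [mem_closedBall_zero_iff]
      refine (norm_add_le _ _).trans ?_
      rw [norm_smul, Real.norm_eq_abs, abs_of_pos hr0]
      simp only at h3
      have : r * ‖x‖ ≤ r * ϱ := by gcongr
      linarith
  have hsub : Sub δ K T ϱ (fun z => s * u (dil tc xc r z)) (fun z => s * (r ^ 2 * ut (dil tc xc r z)))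
      (fun z => s • (r • G (dil tc xc r z))) (fun z => s • (r ^ 2 • H (dil tc xc r z))) (fun z => a (dil tc xc r z))
      (fun z => s * r ^ 2 * f (dil tc xc r z)) := by
    refine ⟨fun z => (h.jet _).dil.const_mul s, fun z => h.ell _, ?_, ?_, ?_, ?_, ?_⟩
    · intro t ht x hx
      have hm := @hdom (t, x) ⟨ht, hx⟩
      have := h.bd _ hm.1 _ hm.2
      rw [abs_mul, abs_of_pos hs0, hs, one_div, inv_mul_le_iff₀ hMu, mul_one]
      exact this
    · intro z
      have := h.f0 (dil tc xc r z)
      positivity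
    · exact (h.fm.comp (dil_emb tc xc hr0).measurable).const_mul _
    · intro t ht x hx
      have hm := @hdom (t, x) ⟨ht, hx⟩
      have := h.eq _ hm.1 _ hm.2
      simp only [Prod.mk.eta] at this
      rw [ctr_smul, ctr_smul, norm_smul, norm_smul, Real.norm_eq_abs, abs_of_pos hs0, Real.norm_eq_abs, abs_of_pos hr0]
      have e1 : s * r ^ 2 * (ut (dil tc xc r (t, x)) + ctr (a (dil tc xc r (t, x))) (H (dil tc xc r (t, x)))) ≤
          s * r ^ 2 * (f (dil tc xc r (t, x)) + K * ‖G (dil tc xc r (t, x))‖) := by gcongr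
      have e2 : s * (K * ‖G (dil tc xc r (t, x))‖) * r ^ 2 ≤ s * (K * ‖G (dil tc xc r (t, x))‖) * r := by
        gcongr
        rw [sq]; exact mul_le_of_le_one_left hr0.le hr1
      linarith
    · calc _ ≤ ∫⁻ z in dil tc xc r ⁻¹' (Icc (1 / 2 : ℝ) 2 ×ˢ Metric.closedBall (0 : E d) R),
            ENNReal.ofReal (s * r ^ 2 * f (dil tc xc r z)) ^ (d + 1) := lintegral_mono_set hdom
        _ = ENNReal.ofReal ((r ^ (d + 2))⁻¹) * ∫⁻ z in Icc (1 / 2 : ℝ) 2 ×ˢ Metric.closedBall (0 : E d) R,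
            ENNReal.ofReal (s * r ^ 2 * f z) ^ (d + 1) := dil_lint tc xc hr0 (fun z => ENNReal.ofReal (s * r ^ 2 * f z) ^ (d + 1)) _
        _ = ENNReal.ofReal ((r ^ (d + 2))⁻¹) * (ENNReal.ofReal (s * r ^ 2) ^ (d + 1) *
            ∫⁻ z in Icc (1 / 2 : ℝ) 2 ×ˢ Metric.closedBall (0 : E d) R, ENNReal.ofReal (f z) ^ (d + 1)) := by
            congr 1
            rw [← lintegral_const_mul' _ _ (by simp)]
            refine lintegral_congr fun z => ?_
            rw [ENNReal.ofReal_mul (by positivity), mul_pow]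
        _ ≤ ENNReal.ofReal ((r ^ (d + 2))⁻¹) * (ENNReal.ofReal (s * r ^ 2) ^ (d + 1) * ENNReal.ofReal Mu ^ (d + 1)) := by
            gcongr; exact h.fint
        _ ≤ 1 := by
            rw [← mul_pow, ← ENNReal.ofReal_mul (by positivity), ← ENNReal.ofReal_pow (by positivity), ← ENNReal.ofReal_mul (by positivity),
              ← ENNReal.ofReal_one]
            refine ENNReal.ofReal_le_ofReal ?_
            rw [show s * r ^ 2 * Mu = r ^ 2 by rw [hs]; field_simp, inv_mul_le_iff₀ (by positivity), mul_one, ← pow_mul]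
            exact pow_le_pow_of_le_one hr0.le hr1 (by omega)
  have hmain := hinterior hsub
  have hpre : dil tc xc r ⁻¹' (Ioo (corner i).1 ((corner i).1 + r ^ 2) ×ˢ cellK i.1 i.2.2) = Ioo (T - 1 : ℝ) T ×ˢ Y d := by
    have hr2 : 0 < r ^ 2 := by positivity
    ext ⟨t, x⟩
    simp only [mem_preimage, dil, mem_prod, mem_Ioo, mem_cellK, mem_Y]
    refine and_congr (and_congr ?_ ?_) (forall_congr' fun l => and_congr ?_ ?_)
    · rw [htc]
      constructor
      · intro h; nlinarith
      · intro h; nlinarith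
    · rw [htc]
      constructor
      · intro h; nlinarith
      · intro h; nlinarith
    · simp only [hxc, corner, PiLp.add_apply, PiLp.smul_apply, smul_eq_mul, ← hr]
      rw [le_add_iff_nonneg_right, mul_nonneg_iff_of_pos_left hr0]; simp
    · simp only [hxc, corner, PiLp.add_apply, PiLp.smul_apply, smul_eq_mul, ← hr]
      rw [add_lt_add_iff_left, mul_lt_iff_lt_one_right hr0]; simp [slen]
  rw [← hpre] at hmain
  have hmain2 : ∫⁻ z in dil tc xc r ⁻¹' (Ioo (corner i).1 ((corner i).1 + r ^ 2) ×ˢ cellK i.1 i.2.2),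
      ENNReal.ofReal (frobNorm (s • r ^ 2 • H (dil tc xc r z))) ^ ε = ENNReal.ofReal ((r ^ (d + 2))⁻¹) *
      (ENNReal.ofReal (s * r ^ 2) ^ ε * ∫⁻ z in Ioo (corner i).1 ((corner i).1 + r ^ 2) ×ˢ cellK i.1 i.2.2,
        ENNReal.ofReal (frobNorm (H z)) ^ ε) := by
    rw [dil_lint tc xc hr0 (fun z => ENNReal.ofReal (frobNorm (s • r ^ 2 • H z)) ^ ε)]
    congr 1
    rw [← lintegral_const_mul' _ _ (by simp [hε.le])]
    refine lintegral_congr fun z => ?_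
    rw [smul_smul, frob_smul _ (by positivity), ENNReal.ofReal_mul (by positivity), ENNReal.mul_rpow_of_nonneg _ _ hε.le]
  rw [hmain2] at hmain
  have hcell : (cell i : Set (Z d)) =ᵐ[volume] Ioo (corner i).1 ((corner i).1 + r ^ 2) ×ˢ cellK i.1 i.2.2 := by
    have e : (corner i).1 = i.2.1 * r ^ 2 := by rw [← ht]; rfl
    rw [cell_eq, ht, Measure.volume_eq_prod, e]
    exact Measure.set_prod_ae_eq Ioo_ae_eq_Ico.symm (ae_eq_refl _)
  rw [setLIntegral_congr hcell, cell_vol]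
  set I := ∫⁻ z in Ioo (corner i).1 ((corner i).1 + r ^ 2) ×ˢ cellK i.1 i.2.2, ENNReal.ofReal (frobNorm (H z)) ^ ε with hI
  have e1 : ENNReal.ofReal (Mu / r ^ 2) ^ ε * ENNReal.ofReal (s * r ^ 2) ^ ε = 1 := by
    rw [← ENNReal.mul_rpow_of_nonneg _ _ hε.le, ← ENNReal.ofReal_mul (by positivity),
      show Mu / r ^ 2 * (s * r ^ 2) = 1 by rw [hs]; field_simp]
    simp
  have e2 : ENNReal.ofReal (r ^ (d + 2)) * ENNReal.ofReal ((r ^ (d + 2))⁻¹) = 1 := by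
    rw [← ENNReal.ofReal_mul (by positivity), mul_inv_cancel₀ (by positivity)]; simp
  calc I = (ENNReal.ofReal (Mu / r ^ 2) ^ ε * ENNReal.ofReal (s * r ^ 2) ^ ε) * (ENNReal.ofReal (r ^ (d + 2)) * ENNReal.ofReal ((r ^ (d + 2))⁻¹)) * I := by
        rw [e1, e2, one_mul, one_mul]
    _ = ENNReal.ofReal (Mu / r ^ 2) ^ ε * (ENNReal.ofReal ((r ^ (d + 2))⁻¹) * (ENNReal.ofReal (s * r ^ 2) ^ ε * I)) * ENNReal.ofReal (r ^ (d + 2)) := by ring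
    _ ≤ _ := by gcongr

end LinEst

namespace LinEst
variable {d : ℕ}

lemma shell_vol (d : ℕ) (hd : 1 ≤ d) {R s : ℝ} (hR : 0 < R) (hR1 : R ≤ 1) (hs : s ≤ R) :
    volume {x : E d | s ≤ ‖x‖ ∧ ‖x‖ ≤ R} ≤ ENNReal.ofReal (d * (R - s)) * volume (Metric.ball (0 : E d) 1) := by
  set s' := max s 0 with hs'
  have h0 : 0 ≤ s' := le_max_right _ _
  have h1 : s' ≤ R := max_le hs hR.le
  have h2 : s ≤ s' := le_max_left _ _
  haveI : Nontrivial (E d) := by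
    haveI : Nonempty (Fin d) := ⟨⟨0, hd⟩⟩
    infer_instance
  have hsub : {x : E d | s ≤ ‖x‖ ∧ ‖x‖ ≤ R} ⊆ Metric.closedBall 0 R \ Metric.ball 0 s' := by
    rintro x ⟨hx1, hx2⟩
    refine ⟨by simpa using hx2, ?_⟩
    simp only [Metric.mem_ball, dist_zero_right, not_lt]
    exact max_le hx1 (norm_nonneg _)
  refine (measure_mono hsub).trans ?_
  rw [measure_sdiff ((Metric.ball_subset_ball h1).trans Metric.ball_subset_closedBall) measurableSet_ball.nullMeasurableSet
    measure_ball_lt_top.ne, Measure.addHaar_closedBall _ _ hR.le, Measure.addHaar_ball _ _ h0, ← ENNReal.sub_mul (fun _ _ => measure_ball_lt_top.ne),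
    ← ENNReal.ofReal_sub _ (by positivity), finrank_euclideanSpace, Fintype.card_fin]
  gcongr
  have hc : R ^ d - s' ^ d ≤ d * (R - s') := by
    have h3 : ∀ n : ℕ, R ^ n - s' ^ n ≤ n * (R - s') := by
      intro n
      induction n with
      | zero => simp
      | succ n ih =>
        have e1 : R ^ n ≤ 1 := pow_le_one₀ hR.le hR1
        have e2 : s' ≤ 1 := h1.trans hR1
        have e3 : s' ^ n ≤ R ^ n := by gcongr
        push_cast
        have : R ^ (n + 1) - s' ^ (n + 1) = R ^ n * (R - s') + s' * (R ^ n - s' ^ n) := by ring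
        rw [this]
        have e4 : R ^ n * (R - s') ≤ 1 * (R - s') := by gcongr
        have e5 : s' * (R ^ n - s' ^ n) ≤ 1 * (R ^ n - s' ^ n) := by gcongr
        linarith
    exact h3 d
  refine hc.trans ?_
  gcongr

lemma level_int (d : ℕ) (hd : 1 ≤ d) {δ K : ℝ} (hK : 0 ≤ K) {T : ℕ} {ϱ ε C : ℝ} (hε : 0 < ε)
    (hinterior : ∀ {v vt : Z d → ℝ} {G : Z d → E d} {H : Z d → Matrix (Fin d) (Fin d) ℝ}
    {a : Z d → Matrix (Fin d) (Fin d) ℝ} {f : Z d → ℝ} (_ : Sub δ K T ϱ v vt G H a f),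
    ∫⁻ z in Ioo (T - 1 : ℝ) T ×ˢ Y d, ENNReal.ofReal (frobNorm (H z)) ^ ε ≤ ENNReal.ofReal C)
    {Mu R : ℝ} {u ut : Z d → ℝ} {G : Z d → E d} {H : Z d → Matrix (Fin d) (Fin d) ℝ}
    {a : Z d → Matrix (Fin d) (Fin d) ℝ} {f : Z d → ℝ} (hMu : 0 < Mu) (hR : 0 < R) (hR1 : R ≤ 1) (hϱ : (d : ℝ) + 1 ≤ ϱ)
    (h : Sol δ K Mu R u ut G H a f) (j : ℕ) (hj : T * tlen j ≤ 1 / 2) (B0 : ℝ) (hB : 0 ≤ B0) (S : Set (Z d))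
    (hS : ∀ z ∈ S, z.1 ∈ Ioo (1 : ℝ) 2 ∧ (ϱ + d) * slen j ≤ R - ‖z.2‖ ∧ R - ‖z.2‖ ≤ B0 * slen j) :
    ∫⁻ z in S, ENNReal.ofReal (frobNorm (H z)) ^ ε ≤
      ENNReal.ofReal (Mu / slen j ^ 2) ^ ε * ENNReal.ofReal C * (2 * (ENNReal.ofReal (d * ((B0 + d) * slen j)) * volume (Metric.ball (0 : E d) 1))) := by
  set J : Set (ℤ × (Fin d → ℤ)) := {k | (cell (j, k) ∩ S).Nonempty} with hJ
  have hsl := slen_pos j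
  have hcov : S ⊆ ⋃ k : J, cell (j, (k : ℤ × (Fin d → ℤ))) := by
    intro z hz
    have hzc : z ∈ cell (j, idx j z) := rfl
    exact mem_iUnion.2 ⟨⟨idx j z, z, hzc, hz⟩, hzc⟩
  have hdis : Pairwise (Function.onFun Disjoint fun k : J => (cell (j, (k : ℤ × (Fin d → ℤ))) : Set (Z d))) := by
    intro k k' hkk
    refine disjoint_left.2 fun z hz hz' => hkk ?_
    have e1 : idx j z = k := hz
    have e2 : idx j z = k' := hz'
    exact Subtype.ext (e1.symm.trans e2)
  have hsh : (⋃ k : J, cell (j, (k : ℤ × (Fin d → ℤ)))) ⊆ Icc (0 : ℝ) 2 ×ˢ {x : E d | R - (B0 + d) * slen j ≤ ‖x‖ ∧ ‖x‖ ≤ R} := by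
    refine iUnion_subset ?_
    rintro ⟨k, z, hz, hzS⟩ w hw
    simp only at hw
    have hk : idx j z = k := hz
    obtain ⟨h1, h2, h3⟩ := hS z hzS
    subst hk
    obtain ⟨h4, h5⟩ := cell_small hw
    have h6 : (corner (j, idx j z)).1 + tlen j ≤ 2 := by
      have := cell_time hz (T := 2) (by exact_mod_cast h1.2)
      simpa using this
    have h7 := cell_time0 hz (by linarith [h1.1])
    obtain ⟨h8, h9, -⟩ := cell_corner hw
    have n1 := norm_sub_norm_le w.2 z.2
    have n2 := norm_sub_norm_le z.2 w.2
    rw [norm_sub_rev] at n2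
    refine ⟨⟨h7.trans h8, ?_⟩, ?_, ?_⟩
    · simp only at h9; linarith
    · linarith
    · have : 0 ≤ ϱ * slen j := by
        have : (0 : ℝ) ≤ ϱ := le_trans (by positivity) hϱ
        positivity
      linarith
  have hc : ∀ k : J, ∫⁻ z in cell (j, (k : ℤ × (Fin d → ℤ))), ENNReal.ofReal (frobNorm (H z)) ^ ε ≤
      ENNReal.ofReal (Mu / slen j ^ 2) ^ ε * ENNReal.ofReal C * volume (cell (j, (k : ℤ × (Fin d → ℤ))) : Set (Z d)) := by
    rintro ⟨k, z, hz, hzS⟩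
    obtain ⟨h1, h2, h3⟩ := hS z hzS
    obtain ⟨h8, h9, h10⟩ := cell_corner hz
    refine cell_int d hK hε hinterior hMu h (j, k) ?_ ?_ ?_
    · have := cell_time hz (T := 2) (by exact_mod_cast h1.2)
      simpa using this
    · have := h1.1
      simp only at h9 ⊢
      linarith
    · have n1 := norm_sub_norm_le (corner (j, k)).2 z.2
      rw [norm_sub_rev] at n1
      have h10 := cellK_corner (i := (j, k)) h10
      simp only at h10 ⊢
      linarith
  calc _ ≤ ∫⁻ z in ⋃ k : J, cell (j, (k : ℤ × (Fin d → ℤ))), ENNReal.ofReal (frobNorm (H z)) ^ ε := lintegral_mono_set hcov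
    _ ≤ ∑' k : J, ∫⁻ z in cell (j, (k : ℤ × (Fin d → ℤ))), ENNReal.ofReal (frobNorm (H z)) ^ ε := lintegral_iUnion_le _ _
    _ ≤ ∑' k : J, ENNReal.ofReal (Mu / slen j ^ 2) ^ ε * ENNReal.ofReal C * volume (cell (j, (k : ℤ × (Fin d → ℤ))) : Set (Z d)) :=
        ENNReal.tsum_le_tsum hc
    _ = ENNReal.ofReal (Mu / slen j ^ 2) ^ ε * ENNReal.ofReal C * volume (⋃ k : J, cell (j, (k : ℤ × (Fin d → ℤ))) : Set (Z d)) := by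
        rw [ENNReal.tsum_mul_left, measure_iUnion hdis fun k => cell_meas _]
    _ ≤ ENNReal.ofReal (Mu / slen j ^ 2) ^ ε * ENNReal.ofReal C * volume (Icc (0 : ℝ) 2 ×ˢ {x : E d | R - (B0 + d) * slen j ≤ ‖x‖ ∧ ‖x‖ ≤ R}) := by
        gcongr
    _ ≤ _ := by
        rw [Measure.volume_eq_prod, Measure.prod_prod, Real.volume_Icc, sub_zero]
        have := shell_vol d hd hR hR1 (s := R - (B0 + d) * slen j) (by
          have : 0 ≤ (B0 + d) * slen j := by positivity
          linarith)
        rw [_root_.sub_sub_cancel] at this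
        gcongr
        simp

lemma level_const {Mu ε : ℝ} (hMu : 0 < Mu) (hε : 0 < ε) (j : ℕ) :
    ENNReal.ofReal (Mu / slen j ^ 2) ^ ε * ENNReal.ofReal (slen j) = ENNReal.ofReal Mu ^ ε * ENNReal.ofReal ((1 / 2) ^ (1 - 2 * ε)) ^ j := by
  have hs := slen_pos j
  have e0 : slen j = (1 / 2 : ℝ) ^ (j : ℝ) := by rw [Real.rpow_natCast]; rfl
  have e1 : (1 / slen j ^ 2) ^ ε * slen j = ((1 / 2 : ℝ) ^ (1 - 2 * ε)) ^ j := by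
    rw [one_div, Real.inv_rpow (by positivity), ← Real.rpow_natCast (slen j) 2, ← Real.rpow_mul hs.le, ← Real.rpow_neg hs.le]
    nth_rewrite 2 [← Real.rpow_one (slen j)]
    rw [← Real.rpow_add hs, e0, ← Real.rpow_natCast, ← Real.rpow_mul (by norm_num), ← Real.rpow_mul (by norm_num)]
    congr 1; push_cast; ring
  rw [div_eq_mul_one_div, ENNReal.ofReal_mul hMu.le, ENNReal.mul_rpow_of_nonneg _ _ hε.le, mul_assoc,
    ENNReal.ofReal_rpow_of_pos (x := 1 / slen j ^ 2) (by positivity), ← ENNReal.ofReal_mul (by positivity), e1, ENNReal.ofReal_pow (by positivity)]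

/-- Estimate up to the lateral boundary for smooth bounded solutions. -/
lemma smooth_est (d : ℕ) (hd : 1 ≤ d) {δ K : ℝ} (hδ : 0 < δ) (hδ1 : δ ≤ 1) (hK : 0 ≤ K) :
    ∃ (ε C : ℝ), 0 < ε ∧ ε ≤ 1 / 4 ∧ 0 < C ∧
    ∀ {Mu R : ℝ} {u ut : Z d → ℝ} {G : Z d → E d} {H : Z d → Matrix (Fin d) (Fin d) ℝ}
    {a : Z d → Matrix (Fin d) (Fin d) ℝ} {f : Z d → ℝ} (_ : 0 < Mu) (_ : 0 < R) (_ : R ≤ 1) (_ : Sol δ K Mu R u ut G H a f),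
    ∫⁻ z in Ioo (1 : ℝ) 2 ×ˢ Metric.ball (0 : E d) R, ENNReal.ofReal (frobNorm (H z)) ^ ε ≤ ENNReal.ofReal C * ENNReal.ofReal Mu ^ ε := by
  obtain ⟨T, ϱ, ε, C, hT, hϱ, hε, hε1, hC, hinterior⟩ := interior d hd hδ hδ1 hK
  obtain ⟨j0, hj0⟩ : ∃ j0 : ℕ, (1 / 4 : ℝ) ^ j0 < 1 / (2 * T) :=
    exists_pow_lt_of_lt_one (by positivity) (by norm_num)
  have hϱ0 : (0 : ℝ) < ϱ := lt_of_lt_of_le (by positivity) hϱ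
  set B0 := max (2 * (ϱ + d)) (1 / slen j0) with hB0
  have hB00 : 0 ≤ B0 := le_max_of_le_left (by positivity)
  set q : ℝ := (1 / 2) ^ (1 - 2 * ε) with hq
  have hq1 : q < 1 := Real.rpow_lt_one (by norm_num) (by norm_num) (by linarith)
  set W : ℝ≥0∞ := ENNReal.ofReal C * (2 * (ENNReal.ofReal (d * (B0 + d)) * volume (Metric.ball (0 : E d) 1))) * (1 - ENNReal.ofReal q)⁻¹ with hW
  have hWt : W ≠ ∞ := by
    refine ENNReal.mul_ne_top (ENNReal.mul_ne_top (by simp) (ENNReal.mul_ne_top (by simp) (ENNReal.mul_ne_top ENNReal.ofReal_ne_top measure_ball_lt_top.ne))) ?_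
    rw [ENNReal.inv_ne_top, ← ENNReal.ofReal_one, ← ENNReal.ofReal_sub _ (by positivity)]
    simp [hq1]
  refine ⟨ε, W.toReal + 1, hε, hε1, by positivity, ?_⟩
  intro Mu R u ut G H a f hMu hR hR1 h
  have hjle : ∀ j, j0 ≤ j → T * tlen j ≤ 1 / 2 := by
    intro j hj
    have h1 : tlen j ≤ (1 / 4) ^ j0 := pow_le_pow_of_le_one (by norm_num) (by norm_num) hj
    have h2 : (0 : ℝ) < T := by exact_mod_cast hT
    rw [lt_div_iff₀ (by positivity)] at hj0
    nlinarith
  set S : ℕ → Set (Z d) := fun n => {z | z.1 ∈ Ioo (1 : ℝ) 2 ∧ (ϱ + d) * slen (j0 + n) ≤ R - ‖z.2‖ ∧ R - ‖z.2‖ ≤ B0 * slen (j0 + n)} with hS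
  have hcov : Ioo (1 : ℝ) 2 ×ˢ Metric.ball (0 : E d) R ⊆ ⋃ n, S n := by
    rintro ⟨t, x⟩ ⟨ht, hx⟩
    rw [mem_ball_zero_iff] at hx
    simp only at hx ht
    have hpos : 0 < R - ‖x‖ := by linarith
    have hex : ∃ n, (ϱ + d) * slen (j0 + n) ≤ R - ‖x‖ := by
      obtain ⟨n, hn⟩ : ∃ n : ℕ, (1 / 2 : ℝ) ^ n < (R - ‖x‖) / (ϱ + d) := exists_pow_lt_of_lt_one (by positivity) (by norm_num)
      refine ⟨n, ?_⟩
      rw [lt_div_iff₀ (by positivity)] at hn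
      have : slen (j0 + n) ≤ (1 / 2) ^ n := pow_le_pow_of_le_one (by norm_num) (by norm_num) (by omega)
      calc _ ≤ (ϱ + d) * (1 / 2) ^ n := by gcongr
        _ ≤ _ := by linarith
    classical
    refine mem_iUnion.2 ⟨Nat.find hex, ht, Nat.find_spec hex, ?_⟩
    rcases Nat.eq_zero_or_pos (Nat.find hex) with h0 | h0
    · rw [h0, add_zero]
      have e1 : 1 / slen j0 * slen j0 ≤ B0 * slen j0 := by
        gcongr
        · exact (slen_pos _).le
        · exact le_max_right _ _
      rw [one_div, inv_mul_cancel₀ (slen_pos _).ne'] at e1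
      have := norm_nonneg x
      simp only
      linarith
    · obtain ⟨n, hn⟩ : ∃ n, Nat.find hex = n + 1 := ⟨Nat.find hex - 1, by omega⟩
      have e1 := Nat.find_min hex (m := n) (by omega)
      push Not at e1
      rw [hn, ← add_assoc, slen_succ]
      have e2 : 2 * (ϱ + d) * (slen (j0 + n) / 2) ≤ B0 * (slen (j0 + n) / 2) := by
        gcongr
        · have := slen_pos (j0 + n); positivity
        · exact le_max_left _ _
      simp only
      linarith
  have hlev : ∀ n, ∫⁻ z in S n, ENNReal.ofReal (frobNorm (H z)) ^ ε ≤ ENNReal.ofReal Mu ^ ε * (ENNReal.ofReal C *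
      (2 * (ENNReal.ofReal (d * (B0 + d)) * volume (Metric.ball (0 : E d) 1)))) * ENNReal.ofReal q ^ n := by
    intro n
    refine (level_int d hd hK hε hinterior hMu hR hR1 hϱ h (j0 + n) (hjle _ (by omega)) B0 hB00 (S n) fun z hz => hz).trans ?_
    rw [← mul_assoc (d : ℝ), ENNReal.ofReal_mul (p := d * (B0 + d)) (by positivity)]
    calc _ = (ENNReal.ofReal (Mu / slen (j0 + n) ^ 2) ^ ε * ENNReal.ofReal (slen (j0 + n))) * (ENNReal.ofReal C *
      (2 * (ENNReal.ofReal (d * (B0 + d)) * volume (Metric.ball (0 : E d) 1)))) := by ring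
      _ ≤ (ENNReal.ofReal Mu ^ ε * ENNReal.ofReal q ^ n) * (ENNReal.ofReal C *
      (2 * (ENNReal.ofReal (d * (B0 + d)) * volume (Metric.ball (0 : E d) 1)))) := by
        rw [level_const hMu hε]
        refine mul_le_mul_left (mul_le_mul_right ?_ _) _
        exact pow_le_pow_right_of_le_one' (by rw [← ENNReal.ofReal_one]; exact ENNReal.ofReal_le_ofReal hq1.le) (by omega)
      _ = _ := by ring
  calc _ ≤ ∫⁻ z in ⋃ n, S n, ENNReal.ofReal (frobNorm (H z)) ^ ε := lintegral_mono_set hcov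
    _ ≤ ∑' n, ∫⁻ z in S n, ENNReal.ofReal (frobNorm (H z)) ^ ε := lintegral_iUnion_le _ _
    _ ≤ ∑' n, ENNReal.ofReal Mu ^ ε * (ENNReal.ofReal C *
      (2 * (ENNReal.ofReal (d * (B0 + d)) * volume (Metric.ball (0 : E d) 1)))) * ENNReal.ofReal q ^ n := ENNReal.tsum_le_tsum hlev
    _ = W * ENNReal.ofReal Mu ^ ε := by
      rw [ENNReal.tsum_mul_left, ENNReal.tsum_geometric, hW]; ring
    _ ≤ _ := by
      gcongr
      rw [← ENNReal.ofReal_toReal hWt]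
      refine ENNReal.ofReal_le_ofReal ?_
      rw [ENNReal.toReal_ofReal ENNReal.toReal_nonneg]; linarith

end LinEst

namespace LinEst
variable {d : ℕ}

def cE (d : ℕ) (δ K : ℝ) : ℝ := 2 * (1 + cA d δ * 2 ^ d * (8 + 2 * K) ^ d)

lemma cE_pos {δ K : ℝ} (hδ : 0 < δ) (hK : 0 ≤ K) : 0 < cE d δ K := by
  have := cA_pos (d := d) hδ
  unfold cE; positivity

/-- minimum principle -/
lemma minp {δ K R t0 t1 B β : ℝ} (hδ : 0 < δ) (hδ1 : δ ≤ 1) (hK : 0 ≤ K) (hR : 0 < R) (hR1 : R ≤ 1) (ht2 : t1 - t0 ≤ 2)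
    (hB : 0 ≤ B) (hβ : 0 ≤ β)
    {u ut : Z d → ℝ} {G : Z d → E d} {H : Z d → Matrix (Fin d) (Fin d) ℝ}
    {a : Z d → Matrix (Fin d) (Fin d) ℝ} {f : Z d → ℝ} (hj : ∀ z, JetAt u ut G H z) (ha : ∀ z, Ell δ (a z)) (hf0 : ∀ z, 0 ≤ f z)
    (heq : ∀ t ∈ Icc t0 t1, ∀ x ∈ Metric.closedBall (0 : E d) R, u (t, x) < 0 →
      ut (t, x) + ctr (a (t, x)) (H (t, x)) ≤ f (t, x) + K * ‖G (t, x)‖)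
    (hfi : ∫⁻ z in Icc t0 t1 ×ˢ Metric.closedBall (0 : E d) R, ENNReal.ofReal (f z) ^ (d + 1) ≤ ENNReal.ofReal β ^ (d + 1))
    (hb : ∀ t ∈ Icc t0 t1, ∀ x ∈ Metric.sphere (0 : E d) R, -B ≤ u (t, x))
    (htop : ∀ x ∈ Metric.closedBall (0 : E d) R, -B ≤ u (t1, x)) :
    ∀ t ∈ Icc t0 t1, ∀ x ∈ Metric.closedBall (0 : E d) R, -(B + cE d δ K * β) ≤ u (t, x) := by
  intro s hs x0 hx0
  have hcE := cE_pos (d := d) hδ hK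
  have hcA := cA_pos (d := d) hδ
  by_contra hcon
  push Not at hcon
  have hcb : 0 ≤ cE d δ K * β := by positivity
  have hst : s < t1 := by
    refine lt_of_le_of_ne hs.2 fun h => ?_
    subst h
    have := htop x0 hx0
    linarith
  set m := (-B - u (s, x0)) / 2 with hm
  have hm0 : 0 < m := by rw [hm]; linarith
  have hmc : cE d δ K * β < 2 * m := by rw [hm]; linarith
  set p0 := m / (8 + 2 * K) with hp0
  have hp : 0 < p0 := by positivity
  have hpm : p0 * (8 + 2 * K) = m := by rw [hp0]; field_simp
  have hKp : K * p0 ≤ m / 2 := by nlinarith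
  have h8 : p0 * (8 * R) ≤ m := by
    have : 0 ≤ p0 * K := by positivity
    have : p0 * (8 * R) ≤ p0 * (8 * 1) := by gcongr
    linarith
  set w : Z d → ℝ := fun z => u z - (-B - m / 2 * t1 + inner ℝ (0 : E d) (z.2 - 0) + 0 / 2 * ‖z.2 - 0‖ ^ 2 + m / 2 * z.1) with hw
  have hwe : ∀ z, w z = u z + B + m / 2 * (t1 - z.1) := by
    intro z; simp only [hw, inner_zero_left]; ring
  have hjw : ∀ z, JetAt w (fun z => ut z - m / 2) G H z := by
    intro z
    refine ((hj z).sub (JetAt.poly (-B - m / 2 * t1) 0 (m / 2) 0 0 z)).congr rfl rfl ?_ ?_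
    · ext z i; simp
    · ext z i; simp
  have hcont : Continuous w := continuous_iff_continuousAt.2 fun z => (hjw z).hw.continuousAt
  obtain ⟨S, hSc, hS, hI⟩ := abp (0 : E d) hR hst hm0 hp h8 w (fun z => ut z - m / 2) G H hcont.continuousOn
    (fun t ht x hx => by
      rw [hwe]
      have := hb t ⟨hs.1.trans ht.1, ht.2⟩ x hx
      have h2 : 0 ≤ m / 2 * (t1 - t) := mul_nonneg (by positivity) (by linarith [ht.2])
      simp only; linarith)
    (fun x hx => by
      rw [hwe]
      have := htop x hx
      simp only [sub_self, mul_zero]; linarith)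
    x0 hx0 (by
      rw [hwe]
      simp only
      have : m / 2 * (t1 - s) ≤ m / 2 * 2 := by
        gcongr
        linarith [hs.1]
      have : u (s, x0) + B = - (2 * m) := by rw [hm]; ring
      linarith)
    (fun t _ x _ _ => hjw _)
  have hSD : S ⊆ Icc t0 t1 ×ˢ Metric.closedBall (0 : E d) R := by
    intro z hz
    have h := hS z hz
    exact ⟨⟨hs.1.trans h.t0le, h.ltt1.le⟩, Metric.ball_subset_closedBall h.mem⟩
  have key := abp_F (0 : E d) hm0 hp hSc hS hI hδ hδ1 a ha f hf0 0 le_rfl (fun z hz => by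
      have h := hS z hz
      have h1 := h.neg
      rw [hwe] at h1
      have h2 : 0 ≤ m / 2 * (t1 - z.1) := mul_nonneg (by positivity) (by linarith [h.ltt1])
      have h3 := heq z.1 (hSD hz).1 z.2 (hSD hz).2 (by simp only [Prod.mk.eta]; linarith)
      simp only [Prod.mk.eta] at h3
      have h4 : K * ‖G z‖ ≤ K * p0 := by gcongr; exact h.gle
      linarith) (b := β ^ (d + 1)) (by positivity) (by
      rw [ENNReal.ofReal_pow hβ]
      exact (lintegral_mono_set hSD).trans hfi)
  set k := cA d δ * 2 ^ d * (8 + 2 * K) ^ d with hk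
  have hk0 : 0 < k := by positivity
  have h5 : m ^ (d + 1) ≤ k * β ^ (d + 1) := by
    have e : m ^ (d + 1) = m * p0 ^ d * (8 + 2 * K) ^ d := by
      rw [mul_assoc, ← mul_pow, hpm]; ring
    rw [e]
    calc m * p0 ^ d * (8 + 2 * K) ^ d ≤ cA d δ * 2 ^ d * (β ^ (d + 1) + 0 ^ (d + 1) * (volume S).toReal) * (8 + 2 * K) ^ d := by gcongr
      _ = _ := by rw [hk]; ring
  have h6 : m ^ (d + 1) ≤ ((1 + k) * β) ^ (d + 1) := by
    refine h5.trans ?_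
    rw [mul_pow]
    gcongr
    calc k ≤ 1 + k := by linarith
      _ ≤ (1 + k) ^ (d + 1) := le_self_pow₀ (by linarith) (by omega)
  have h7 := le_of_pow_le_pow_left₀ (by omega) (by positivity) h6
  have h9 : cE d δ K = 2 * (1 + k) := by rw [cE, hk]
  rw [h9] at hmc
  linarith

lemma Ell_neg_jet {w wt : Z d → ℝ} {G H} {z : Z d} (h : JetAt w wt G H z) :
    JetAt (fun z => - w z) (fun z => - wt z) (fun z => - G z) (fun z => - H z) z :=
  (h.const_mul (-1)).congr (by ext; simp) (by ext; simp) (by ext; simp) (by ext; simp)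

lemma smooth_full0 (d : ℕ) (hd : 1 ≤ d) {δ K : ℝ} (hδ : 0 < δ) (hδ1 : δ ≤ 1) (hK : 0 ≤ K) :
    ∃ (ε C : ℝ), 0 < ε ∧ ε ≤ 1 / 4 ∧ 0 < C ∧
    ∀ {B β R : ℝ} {u ut : Z d → ℝ} {G : Z d → E d} {H : Z d → Matrix (Fin d) (Fin d) ℝ}
    {a : Z d → Matrix (Fin d) (Fin d) ℝ} {b : Z d → E d} {c f : Z d → ℝ} (_ : 0 ≤ B) (_ : 0 < β) (_ : 0 < R) (_ : R ≤ 1)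
    (_ : ∀ z, JetAt u ut G H z) (_ : ∀ z, Ell δ (a z)) (_ : ∀ z, ‖b z‖ + c z ≤ K) (_ : ∀ z, 0 ≤ c z)
    (_ : ∀ z, 0 ≤ f z) (_ : Measurable f)
    (_ : ∀ t ∈ Icc (1 / 2 : ℝ) 2, ∀ x ∈ Metric.closedBall (0 : E d) R, |ut (t, x) + ctr (a (t, x)) (H (t, x)) +
      inner ℝ (b (t, x)) (G (t, x)) - c (t, x) * u (t, x)| ≤ f (t, x))
    (_ : ∫⁻ z in Icc (1 / 2 : ℝ) 2 ×ˢ Metric.closedBall (0 : E d) R, ENNReal.ofReal (f z) ^ (d + 1) ≤ ENNReal.ofReal β ^ (d + 1))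
    (_ : ∀ t ∈ Icc (1 / 2 : ℝ) 2, ∀ x ∈ Metric.sphere (0 : E d) R, |u (t, x)| ≤ B)
    (_ : ∀ x ∈ Metric.closedBall (0 : E d) R, |u (2, x)| ≤ B),
    ∫⁻ z in Ioo (1 : ℝ) 2 ×ˢ Metric.ball (0 : E d) R, ENNReal.ofReal (frobNorm (H z)) ^ ε ≤ ENNReal.ofReal C * ENNReal.ofReal (B + β) ^ ε := by
  obtain ⟨ε, C, hε, hε1, hC, hmain⟩ := smooth_est d hd hδ hδ1 hK
  have hcE := cE_pos (d := d) hδ hK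
  set A := cE d δ K with hA
  set ν := (volume (Icc (1 / 2 : ℝ) 2 ×ˢ Metric.closedBall (0 : E d) 1)).toReal with hν
  have hνt : volume (Icc (1 / 2 : ℝ) 2 ×ˢ Metric.closedBall (0 : E d) 1) ≠ ∞ :=
    (isCompact_Icc.prod (isCompact_closedBall _ _)).measure_lt_top.ne
  have hν0 : 0 ≤ ν := ENNReal.toReal_nonneg
  set k := 1 + K * (1 + A) with hk
  have hk0 : 0 < k := by positivity
  set CM := (1 + A) + 2 ^ d * (1 + ν) * k with hCM
  have hCM0 : 0 < CM := by positivity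
  refine ⟨ε, C * CM ^ ε, hε, hε1, by positivity, ?_⟩
  intro B β R u ut G H a b c f hB hβ hR hR1 hj ha hbc hc hf0 hfm heq hfi hside htop
  have hbG : ∀ z, |inner ℝ (b z) (G z)| ≤ K * ‖G z‖ := by
    intro z
    refine (abs_real_inner_le_norm _ _).trans ?_
    gcongr
    linarith [hbc z, hc z]
  have hcK : ∀ z, c z ≤ K := fun z => by linarith [hbc z, norm_nonneg (b z)]
  have hlow := minp (t0 := 1 / 2) (t1 := 2) hδ hδ1 hK hR hR1 (by norm_num) hB hβ.le hj ha hf0 (fun t ht x hx hneg => by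
      have h1 := (abs_le.1 (heq t ht x hx)).2
      have h2 := (abs_le.1 (hbG (t, x))).1
      have h3 : c (t, x) * u (t, x) ≤ 0 := mul_nonpos_of_nonneg_of_nonpos (hc _) hneg.le
      linarith) hfi (fun t ht x hx => (abs_le.1 (hside t ht x hx)).1) (fun x hx => (abs_le.1 (htop x hx)).1)
  have hup := minp (u := fun z => - u z) (t0 := 1 / 2) (t1 := 2) hδ hδ1 hK hR hR1 (by norm_num) hB hβ.le (fun z => Ell_neg_jet (hj z)) ha hf0 (fun t ht x hx hneg => by
      have h1 := (abs_le.1 (heq t ht x hx)).1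
      have h2 := (abs_le.1 (hbG (t, x))).2
      have h3 : 0 ≤ c (t, x) * u (t, x) := mul_nonneg (hc _) (by linarith)
      have h4 : ctr (a (t, x)) (-H (t, x)) = - ctr (a (t, x)) (H (t, x)) := by
        have := ctr_smul (a (t, x)) (H (t, x)) (-1)
        simpa using this
      rw [norm_neg, h4]
      linarith) hfi (fun t ht x hx => by linarith [(abs_le.1 (hside t ht x hx)).2]) (fun x hx => by linarith [(abs_le.1 (htop x hx)).2])
  have hbd : ∀ t ∈ Icc (1 / 2 : ℝ) 2, ∀ x ∈ Metric.closedBall (0 : E d) R, |u (t, x)| ≤ (1 + A) * (B + β) := by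
    intro t ht x hx
    have h1 := hlow t ht x hx
    have h2 := hup t ht x hx
    have h3 : 0 ≤ A * B := by positivity
    have h4 : B + A * β ≤ (1 + A) * (B + β) := by ring_nf; linarith
    rw [abs_le]
    constructor <;> linarith
  set m := (1 + A) * (B + β) with hm
  have hm0 : 0 < m := by positivity
  have hMu0 : 0 < CM * (B + β) := by positivity
  have hsol : Sol δ K (CM * (B + β)) R u ut G H a (fun z => f z + K * m) := by
    refine ⟨hj, ha, ?_, fun z => by have := hf0 z; positivity, hfm.add_const _, ?_, ?_⟩
    · intro t ht x hx
      refine (hbd t ht x hx).trans ?_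
      have : 0 ≤ 2 ^ d * (1 + ν) * k * (B + β) := by positivity
      rw [hm, hCM]
      linarith
    · intro t ht x hx
      have h1 := (abs_le.1 (heq t ht x hx)).2
      have h2 := (abs_le.1 (hbG (t, x))).1
      have h3 : c (t, x) * u (t, x) ≤ K * m := by
        calc c (t, x) * u (t, x) ≤ c (t, x) * m := mul_le_mul_of_nonneg_left ((abs_le.1 (hbd t ht x hx)).2) (hc _)
          _ ≤ K * m := mul_le_mul_of_nonneg_right (hcK _) hm0.le
      linarith
    · have hvol : volume (Icc (1 / 2 : ℝ) 2 ×ˢ Metric.closedBall (0 : E d) R) ≤ ENNReal.ofReal ν := by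
        rw [hν, ENNReal.ofReal_toReal hνt]
        exact measure_mono (prod_mono_right (Metric.closedBall_subset_closedBall hR1))
      calc _ ≤ ∫⁻ z in Icc (1 / 2 : ℝ) 2 ×ˢ Metric.closedBall (0 : E d) R, (ENNReal.ofReal (2 ^ d) * ENNReal.ofReal (f z) ^ (d + 1) +
              ENNReal.ofReal (2 ^ d * (K * m) ^ (d + 1))) := by
            refine lintegral_mono fun z => ?_
            have h0 := hf0 z
            rw [← ENNReal.ofReal_pow h0, ← ENNReal.ofReal_pow (by positivity), ← ENNReal.ofReal_mul (by positivity), ← ENNReal.ofReal_add (by positivity) (by positivity)]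
            refine ENNReal.ofReal_le_ofReal ?_
            have := add_pow_le h0 (show 0 ≤ K * m by positivity) (d + 1)
            simp only [Nat.add_sub_cancel] at this
            linarith
        _ = ENNReal.ofReal (2 ^ d) * (∫⁻ z in Icc (1 / 2 : ℝ) 2 ×ˢ Metric.closedBall (0 : E d) R, ENNReal.ofReal (f z) ^ (d + 1)) +
              ENNReal.ofReal (2 ^ d * (K * m) ^ (d + 1)) * volume (Icc (1 / 2 : ℝ) 2 ×ˢ Metric.closedBall (0 : E d) R) := by
            rw [lintegral_add_right _ measurable_const, lintegral_const_mul' _ _ ENNReal.ofReal_ne_top, setLIntegral_const]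
        _ ≤ ENNReal.ofReal (2 ^ d) * ENNReal.ofReal β ^ (d + 1) + ENNReal.ofReal (2 ^ d * (K * m) ^ (d + 1)) * ENNReal.ofReal ν := by
            gcongr
        _ ≤ _ := by
            rw [← ENNReal.ofReal_pow hβ.le, ← ENNReal.ofReal_pow (by positivity), ← ENNReal.ofReal_mul (by positivity),
              ← ENNReal.ofReal_mul (by positivity), ← ENNReal.ofReal_add (by positivity) (by positivity)]
            refine ENNReal.ofReal_le_ofReal ?_
            have e1 : β ≤ k * (B + β) := by
              have : 0 ≤ K * (1 + A) * (B + β) := by positivity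
              rw [hk]; linarith
            have e2 : K * m ≤ k * (B + β) := by rw [hk, hm]; linarith
            have e3 : (2 ^ d * (1 + ν)) ≤ (2 ^ d * (1 + ν)) ^ (d + 1) := by
              refine le_self_pow₀ ?_ (by omega)
              have : (1 : ℝ) ≤ 2 ^ d := one_le_pow₀ (by norm_num)
              nlinarith
            calc 2 ^ d * β ^ (d + 1) + 2 ^ d * (K * m) ^ (d + 1) * ν ≤
                2 ^ d * (k * (B + β)) ^ (d + 1) + 2 ^ d * (k * (B + β)) ^ (d + 1) * ν := by gcongr
              _ = (2 ^ d * (1 + ν)) * (k * (B + β)) ^ (d + 1) := by ring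
              _ ≤ (2 ^ d * (1 + ν)) ^ (d + 1) * (k * (B + β)) ^ (d + 1) := by gcongr
              _ = (2 ^ d * (1 + ν) * k * (B + β)) ^ (d + 1) := by rw [← mul_pow]; ring
              _ ≤ _ := by
                gcongr
                rw [hCM]; linarith
  refine (hmain hMu0 hR hR1 hsol).trans (le_of_eq ?_)
  rw [ENNReal.ofReal_mul hC.le, ENNReal.ofReal_mul hCM0.le, ENNReal.mul_rpow_of_nonneg _ _ hε.le, ← ENNReal.ofReal_rpow_of_pos hCM0]
  ring

lemma smooth_full (d : ℕ) (hd : 1 ≤ d) {δ K : ℝ} (hδ : 0 < δ) (hδ1 : δ ≤ 1) (hK : 0 ≤ K) :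
    ∃ (ε C : ℝ), 0 < ε ∧ ε ≤ 1 / 4 ∧ 0 < C ∧
    ∀ (τ : ℝ) {B β R : ℝ} {u ut : Z d → ℝ} {G : Z d → E d} {H : Z d → Matrix (Fin d) (Fin d) ℝ}
    {a : Z d → Matrix (Fin d) (Fin d) ℝ} {b : Z d → E d} {c f : Z d → ℝ} (_ : 0 ≤ B) (_ : 0 < β) (_ : 0 < R) (_ : R ≤ 1)
    (_ : ∀ z, JetAt u ut G H z) (_ : ∀ z, Ell δ (a z)) (_ : ∀ z, ‖b z‖ + c z ≤ K) (_ : ∀ z, 0 ≤ c z)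
    (_ : ∀ z, 0 ≤ f z) (_ : Measurable f)
    (_ : ∀ t ∈ Icc (1 / 2 - τ : ℝ) (2 - τ), ∀ x ∈ Metric.closedBall (0 : E d) R, |ut (t, x) + ctr (a (t, x)) (H (t, x)) +
      inner ℝ (b (t, x)) (G (t, x)) - c (t, x) * u (t, x)| ≤ f (t, x))
    (_ : ∫⁻ z in Icc (1 / 2 - τ : ℝ) (2 - τ) ×ˢ Metric.closedBall (0 : E d) R, ENNReal.ofReal (f z) ^ (d + 1) ≤ ENNReal.ofReal β ^ (d + 1))
    (_ : ∀ t ∈ Icc (1 / 2 - τ : ℝ) (2 - τ), ∀ x ∈ Metric.sphere (0 : E d) R, |u (t, x)| ≤ B)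
    (_ : ∀ x ∈ Metric.closedBall (0 : E d) R, |u (2 - τ, x)| ≤ B),
    ∫⁻ z in Ioo (1 - τ : ℝ) (2 - τ) ×ˢ Metric.ball (0 : E d) R, ENNReal.ofReal (frobNorm (H z)) ^ ε ≤ ENNReal.ofReal C * ENNReal.ofReal (B + β) ^ ε := by
  obtain ⟨ε, C, hε, hε1, hC, hmain⟩ := smooth_full0 d hd hδ hδ1 hK
  refine ⟨ε, C, hε, hε1, hC, ?_⟩
  intro τ B β R u ut G H a b c f hB hβ hR hR1 hj ha hbc hc hf0 hfm heq hfi hside htop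
  have hdil : ∀ t x, dil (-τ) (0 : E d) 1 (t, x) = (t - τ, x) := by
    intro t x; simp only [dil, one_pow, one_mul, one_smul, zero_add]; congr 1; ring
  have hp1 : ∀ X : Set (E d), dil (-τ) (0 : E d) 1 ⁻¹' (Icc (1 / 2 - τ : ℝ) (2 - τ) ×ˢ X) = Icc (1 / 2 : ℝ) 2 ×ˢ X := by
    intro X; ext ⟨t, x⟩; simp [hdil]
  have hp2 : ∀ X : Set (E d), dil (-τ) (0 : E d) 1 ⁻¹' (Ioo (1 - τ : ℝ) (2 - τ) ×ˢ X) = Ioo (1 : ℝ) 2 ×ˢ X := by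
    intro X; ext ⟨t, x⟩; simp [hdil]
  have hmem : ∀ t ∈ Icc (1 / 2 : ℝ) 2, t - τ ∈ Icc (1 / 2 - τ : ℝ) (2 - τ) := by
    intro t ht; exact ⟨by linarith [ht.1], by linarith [ht.2]⟩
  have key := hmain (u := fun z => u (dil (-τ) 0 1 z)) (ut := fun z => ut (dil (-τ) 0 1 z)) (G := fun z => G (dil (-τ) 0 1 z))
    (H := fun z => H (dil (-τ) 0 1 z)) (a := fun z => a (dil (-τ) 0 1 z)) (b := fun z => b (dil (-τ) 0 1 z)) (c := fun z => c (dil (-τ) 0 1 z))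
    (f := fun z => f (dil (-τ) 0 1 z)) hB hβ hR hR1 (fun z => (hj _).dil.congr rfl (by simp) (by simp) (by simp))
    (fun z => ha _) (fun z => hbc _) (fun z => hc _) (fun z => hf0 _) (hfm.comp (dil_emb _ _ one_pos).measurable)
    (fun t ht x hx => by rw [hdil]; exact heq _ (hmem t ht) x hx)
    (by
      have := dil_lint (-τ) (0 : E d) one_pos (fun z => ENNReal.ofReal (f z) ^ (d + 1)) (Icc (1 / 2 - τ : ℝ) (2 - τ) ×ˢ Metric.closedBall (0 : E d) R)
      rw [hp1] at this
      rw [this]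
      simpa using hfi)
    (fun t ht x hx => by rw [hdil]; exact hside _ (hmem t ht) x hx)
    (fun x hx => by rw [hdil]; exact htop x hx)
  have h2 := dil_lint (-τ) (0 : E d) one_pos (fun z => ENNReal.ofReal (frobNorm (H z)) ^ ε) (Ioo (1 - τ : ℝ) (2 - τ) ×ˢ Metric.ball (0 : E d) R)
  rw [hp2] at h2
  rw [h2] at key
  simpa using key

end LinEst

namespace LinEst
variable {d : ℕ}

lemma translate_small {g : Z d → ℝ} {p : ℝ≥0∞} (hp1 : 1 ≤ p) (hpt : p ≠ ∞) (hg : MemLp g p volume) {θ : ℝ≥0∞} (hθ : 0 < θ) :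
    ∃ r > 0, ∀ y : Z d, ‖y‖ < r → eLpNorm (fun z => g (z - y) - g z) p volume < θ := by
  haveI : Fact (1 ≤ p) := ⟨hp1⟩
  haveI : Fact (p ≠ ∞) := ⟨hpt⟩
  have hmp : ∀ y : Z d, MeasurePreserving (fun z : Z d => z - y) volume volume := fun y => measurePreserving_sub_right volume y
  let T : Z d → C(Z d, Z d) := fun y => ContinuousMap.mk (fun z => z - y) (continuous_id.sub continuous_const)
  have hT : Continuous T := ContinuousMap.continuous_of_continuous_uncurry _ (by
    show Continuous (fun q : Z d × Z d => q.2 - q.1)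
    fun_prop)
  have hcont : Continuous (fun y : Z d => Lp.compMeasurePreserving (T y) (hmp y) (hg.toLp g)) :=
    Continuous.compMeasurePreservingLp continuous_const hT hmp hpt
  have hval : ∀ y, Lp.compMeasurePreserving (T y) (hmp y) (hg.toLp g) = (hg.comp_measurePreserving (hmp y)).toLp _ :=
    fun y => Lp.toLp_compMeasurePreserving hg (hmp y)
  have := (hcont.tendsto 0).eventually (Metric.eball_mem_nhds _ hθ)
  obtain ⟨r, hr, hb⟩ := Metric.eventually_nhds_iff.1 this
  refine ⟨r, hr, fun y hy => ?_⟩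
  have h := hb (y := y) (by simpa using hy)
  rw [hval, hval, Lp.edist_toLp_toLp] at h
  refine lt_of_eq_of_lt (congrArg (fun f => eLpNorm f p volume) ?_) h
  ext z
  simp

lemma jensen_pow {α : Type*} [MeasurableSpace α] {ν : Measure α} [IsProbabilityMeasure ν] {h : α → ℝ≥0∞} (hh : AEMeasurable h ν) (n : ℕ) :
    (∫⁻ y, h y ∂ν) ^ (n + 1) ≤ ∫⁻ y, h y ^ (n + 1) ∂ν := by
  have hn : (0 : ℝ) < (n + 1 : ℕ) := by positivity
  have := eLpNorm'_le_eLpNorm'_of_exponent_le (p := 1) (q := ((n + 1 : ℕ) : ℝ)) one_pos (by push_cast; linarith [Nat.cast_nonneg (α := ℝ) n]) ν (f := h) hh.aestronglyMeasurable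
  simp only [eLpNorm', enorm_eq_self, ENNReal.rpow_one, div_one, ENNReal.rpow_natCast, one_div] at this
  have h2 := pow_le_pow_left' this (n + 1)
  rwa [← ENNReal.rpow_natCast (_ ^ _), ← ENNReal.rpow_mul, inv_mul_cancel₀ hn.ne', ENNReal.rpow_one] at h2

lemma moll_Lp {g : Z d → ℝ} (hgm : Measurable g) (hgi : LocallyIntegrable g) (n : ℕ) (hg : MemLp g (n + 1 : ℕ) volume) {θ : ℝ≥0∞} (hθ : 0 < θ) :
    ∃ r > 0, ∀ φ : ContDiffBump (0 : Z d), φ.rOut < r →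
      ∫⁻ z, ‖(convolution (φ.normed volume) g (ContinuousLinearMap.lsmul ℝ ℝ) volume) z - g z‖ₑ ^ (n + 1) ≤ θ ^ (n + 1) := by
  obtain ⟨r, hr, hb⟩ := translate_small (by exact_mod_cast Nat.le_add_left 1 n) (by simp) hg hθ
  refine ⟨r, hr, fun φ hφ => ?_⟩
  set ρ := φ.normed volume with hρ
  have hρc : Continuous ρ := φ.continuous_normed
  have hρm : Measurable (fun y => ENNReal.ofReal (ρ y)) := hρc.measurable.ennreal_ofReal
  have hρ0 : ∀ y, 0 ≤ ρ y := φ.nonneg_normed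
  have hρi : Integrable ρ := φ.integrable_normed
  set ν : Measure (Z d) := volume.withDensity (fun y => ENNReal.ofReal (ρ y)) with hν
  haveI : IsProbabilityMeasure ν := ⟨by
    rw [hν, withDensity_apply _ MeasurableSet.univ, Measure.restrict_univ, ← ofReal_integral_eq_lintegral_ofReal hρi (Filter.Eventually.of_forall hρ0),
      φ.integral_normed, ENNReal.ofReal_one]⟩
  have hpair : Measurable (fun q : Z d × Z d => ‖g (q.1 - q.2) - g q.1‖ₑ) :=
    ((hgm.comp (measurable_fst.sub measurable_snd)).sub (hgm.comp measurable_fst)).enorm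
  have hpt : ∀ z, ‖(convolution ρ g (ContinuousLinearMap.lsmul ℝ ℝ) volume) z - g z‖ₑ ≤ ∫⁻ y, ‖g (z - y) - g z‖ₑ ∂ν := by
    intro z
    have hex : Integrable (fun y => ρ y * g (z - y)) := by
      have := HasCompactSupport.convolutionExists_left (ContinuousLinearMap.lsmul ℝ ℝ) φ.hasCompactSupport_normed hρc hgi z (μ := volume)
      simpa [ConvolutionExistsAt] using this
    have e : (convolution ρ g (ContinuousLinearMap.lsmul ℝ ℝ) volume) z - g z = ∫ y, ρ y * (g (z - y) - g z) := by
      simp only [mul_sub]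
      rw [integral_sub hex (hρi.mul_const _), integral_mul_const, φ.integral_normed, one_mul]
      simp [convolution]
    have hmz : Measurable (fun y => ‖g (z - y) - g z‖ₑ) := hpair.comp measurable_prodMk_left
    rw [e, hν, lintegral_withDensity_eq_lintegral_mul _ hρm hmz]
    refine (enorm_integral_le_lintegral_enorm _).trans (lintegral_mono fun y => ?_)
    simp only [Pi.mul_apply, Function.comp, enorm_mul, Real.enorm_eq_ofReal (hρ0 y), le_refl]
  calc _ ≤ ∫⁻ z, (∫⁻ y, ‖g (z - y) - g z‖ₑ ^ (n + 1) ∂ν) := by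
        refine lintegral_mono fun z => (pow_le_pow_left' (hpt z) _).trans (jensen_pow ?_ n)
        exact (hpair.comp measurable_prodMk_left).aemeasurable
    _ = ∫⁻ y, (∫⁻ z, ‖g (z - y) - g z‖ₑ ^ (n + 1)) ∂ν :=
        lintegral_lintegral_swap (hpair.pow_const _).aemeasurable
    _ ≤ ∫⁻ y, θ ^ (n + 1) ∂ν := by
        refine lintegral_mono_ae ?_
        rw [hν, ae_withDensity_iff hρm]
        refine Filter.Eventually.of_forall fun y hy => ?_
        have hy' : y ∈ Function.support ρ := by
          intro h; simp [h] at hy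
        rw [hρ, φ.support_normed_eq, mem_ball_zero_iff] at hy'
        have := (hb y (hy'.trans hφ)).le
        rw [eLpNorm_eq_eLpNorm' (by simp) (by simp), eLpNorm'] at this
        simp only [ENNReal.toReal_natCast, ENNReal.rpow_natCast] at this
        have h2 := pow_le_pow_left' this (n + 1)
        rwa [← ENNReal.rpow_natCast (_ ^ _), ← ENNReal.rpow_mul, one_div, inv_mul_cancel₀ (by positivity), ENNReal.rpow_one] at h2
    _ = θ ^ (n + 1) := by simp

end LinEst

namespace LinEst
variable {d : ℕ}

/-- Spatial unit vector in space-time. -/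
def ev (i : Fin d) : Z d := (0, EuclideanSpace.single i (1 : ℝ))

def jt (V : Z d → ℝ) (z : Z d) : ℝ := fderiv ℝ V z ((1 : ℝ), (0 : E d))
def jD (V : Z d → ℝ) (i : Fin d) (z : Z d) : ℝ := fderiv ℝ V z (ev i)
def jG (V : Z d → ℝ) (z : Z d) : E d := WithLp.toLp 2 (fun i => jD V i z)
def jH (V : Z d → ℝ) (z : Z d) : Matrix (Fin d) (Fin d) ℝ := fun i j => jD (jD V i) j z

lemma clm_decomp (L : Z d →L[ℝ] ℝ) (s : ℝ) (x : E d) : L (s, x) = s * L (1, 0) + ∑ i, x i * L (ev i) := by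
  have hx : x = ∑ i, x i • EuclideanSpace.single i (1 : ℝ) := by
    ext j
    simp [Pi.single_apply]
  have : ((s, x) : Z d) = s • ((1 : ℝ), (0 : E d)) + ∑ i, x i • ev i := by
    have e : ∑ i, x i • (ev i : Z d) = (0, ∑ i, x i • EuclideanSpace.single i (1 : ℝ)) := by
      ext1
      · simp [ev, Prod.fst_sum]
      · simp [ev, Prod.snd_sum]
    rw [e, ← hx]
    simp
  rw [this, map_add, map_sum, map_smul, smul_eq_mul]
  simp

lemma jD_contDiff {V : Z d → ℝ} (hV : ContDiff ℝ (⊤ : ℕ∞) V) (i : Fin d) : ContDiff ℝ (⊤ : ℕ∞) (jD V i) := by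
  have := hV.fderiv_right (m := ((⊤ : ℕ∞) : WithTop ℕ∞)) (by simp)
  exact this.clm_apply contDiff_const

lemma jet_smooth {V : Z d → ℝ} (hV : ContDiff ℝ (⊤ : ℕ∞) V) (z : Z d) : JetAt V (jt V) (jG V) (jH V) z := by
  have hdi : ∀ i, DifferentiableAt ℝ (jD V i) z := fun i =>
    ((jD_contDiff hV i).differentiable (by simp)) z
  have hd : DifferentiableAt ℝ V z := (hV.differentiable (by simp)) z
  refine ⟨?_, ⟨WithLp.toLp 2 (fun i => fderiv ℝ (jD V i) z (1, 0)), ?_⟩, ?_⟩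
  · convert hd.hasFDerivAt using 1
    ext1 
    · ext; simp [jt]
    · ext1 x
      simp only [ContinuousLinearMap.comp_apply, ContinuousLinearMap.inr_apply]
      rw [clm_decomp (fderiv ℝ V z)]
      simp [jG, jD, PiLp.inner_apply]
  · rw [← hasFDerivWithinAt_univ, hasFDerivWithinAt_euclidean]
    intro i
    rw [hasFDerivWithinAt_univ]
    refine (hdi i).hasFDerivAt.congr_fderiv ?_
    symm
    ext1
    · ext; simp
    · ext1 x
      simp only [ContinuousLinearMap.comp_apply, ContinuousLinearMap.inr_apply]
      rw [clm_decomp (fderiv ℝ (jD V i) z)]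
      simp [jH, jD, Matrix.mulVec, dotProduct, mul_comm]
  · have hs : IsSymmSndFDerivAt ℝ V z := hV.contDiffAt.isSymmSndFDerivAt (by
      simp only [minSmoothness_of_isRCLikeNormedField]
      exact WithTop.coe_le_coe.2 (le_top : (2 : ℕ∞) ≤ ⊤))
    have hdd : DifferentiableAt ℝ (fderiv ℝ V) z := 
      ((hV.fderiv_right (m := ((⊤ : ℕ∞) : WithTop ℕ∞)) (by simp)).differentiable (by simp)) z
    have e : ∀ i j, jH V z i j = fderiv ℝ (fderiv ℝ V) z (ev j) (ev i) := by
      intro i j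
      have h1 : HasFDerivAt (jD V i) ((ContinuousLinearMap.apply ℝ ℝ (ev i)).comp (fderiv ℝ (fderiv ℝ V) z)) z :=
        (ContinuousLinearMap.apply ℝ ℝ (ev i)).hasFDerivAt.comp z hdd.hasFDerivAt
      show fderiv ℝ (jD V i) z (ev j) = _
      rw [h1.fderiv]
      simp
    ext i j
    rw [Matrix.transpose_apply, e, e]
    exact hs.eq _ _

/-- Mollification. -/
def mol (φ : ContDiffBump (0 : Z d)) (g : Z d → ℝ) : Z d → ℝ :=
  convolution (φ.normed volume) g (ContinuousLinearMap.lsmul ℝ ℝ) volume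

lemma mol_contDiff (φ : ContDiffBump (0 : Z d)) {g : Z d → ℝ} (hg : LocallyIntegrable g) : ContDiff ℝ (⊤ : ℕ∞) (mol φ g) :=
  φ.hasCompactSupport_normed.contDiff_convolution_left _ φ.contDiff_normed hg

lemma mol_fderiv (φ : ContDiffBump (0 : Z d)) {K : Set (Z d)} (hK : MeasurableSet K) {g g' : Z d → ℝ}
    (hg : IntegrableOn g K) (hg' : IntegrableOn g' K) {e z : Z d} (hz : Metric.closedBall z φ.rOut ⊆ K)
    (hder : ∀ w ∈ K, HasLineDerivAt ℝ g (g' w) w e) :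
    fderiv ℝ (mol φ (K.indicator g)) z e = mol φ (K.indicator g') z := by
  have hgi := ((integrable_indicator_iff hK).2 hg)
  have hgi' := ((integrable_indicator_iff hK).2 hg')
  set ρ := φ.normed volume with hρ
  have hρ1 : ContDiff ℝ 1 ρ := φ.contDiff_normed
  have hρc : HasCompactSupport ρ := φ.hasCompactSupport_normed
  set ρe : Z d → ℝ := fun y => fderiv ℝ ρ y e with hρe
  have hρec : HasCompactSupport ρe := hρc.fderiv_apply ℝ e
  have hρecont : Continuous ρe := (hρ1.continuous_fderiv one_ne_zero).clm_apply continuous_const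
  have hts : tsupport ρ = Metric.closedBall 0 φ.rOut := φ.tsupport_normed_eq
  have hoff : ∀ w, w ∉ K → z - w ∉ tsupport ρ := by
    intro w hw h
    rw [hts, mem_closedBall_zero_iff] at h
    exact hw (hz (by rw [Metric.mem_closedBall, dist_comm, dist_eq_norm]; exact h))
  have h1 : fderiv ℝ (mol φ (K.indicator g)) z e = convolution ρe (K.indicator g) (ContinuousLinearMap.lsmul ℝ ℝ) volume z := by
    rw [mol, (hρc.hasFDerivAt_convolution_left (ContinuousLinearMap.lsmul ℝ ℝ) hρ1 hgi.locallyIntegrable z).fderiv]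
    have hex := (hρc.fderiv ℝ).convolutionExists_left ((ContinuousLinearMap.lsmul ℝ ℝ).precompL (Z d)) (hρ1.continuous_fderiv one_ne_zero)
      hgi.locallyIntegrable z (μ := volume)
    rw [convolution_def, convolution_def, ContinuousLinearMap.integral_apply hex]
    simp [hρe]
  have i1 : Integrable (fun w => ρe (z - w) * (K.indicator g) w) := by
    have := (hρec.convolutionExists_left (ContinuousLinearMap.lsmul ℝ ℝ) hρecont hgi.locallyIntegrable z (μ := volume)).integrable_swap
    simpa using this
  have i2 : Integrable (fun w => ρ (z - w) * (K.indicator g) w) := by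
    have := (hρc.convolutionExists_left (ContinuousLinearMap.lsmul ℝ ℝ) hρ1.continuous hgi.locallyIntegrable z (μ := volume)).integrable_swap
    simpa using this
  have i3 : Integrable (fun w => ρ (z - w) * (K.indicator g') w) := by
    have := (hρc.convolutionExists_left (ContinuousLinearMap.lsmul ℝ ℝ) hρ1.continuous hgi'.locallyIntegrable z (μ := volume)).integrable_swap
    simpa using this
  have r1 : ∀ X : Z d → ℝ, (fun w => ρ (z - w) * (K.indicator X) w) = fun w => ρ (z - w) * X w := by
    intro X; ext w
    by_cases hw : w ∈ K
    · simp [hw]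
    · rw [image_eq_zero_of_notMem_tsupport (hoff w hw)]; simp
  have r2 : ∀ X : Z d → ℝ, (fun w => ρe (z - w) * (K.indicator X) w) = fun w => ρe (z - w) * X w := by
    intro X; ext w
    by_cases hw : w ∈ K
    · simp [hw]
    · have : ρe (z - w) = 0 := by
        rw [hρe]; simp only
        rw [fderiv_of_notMem_tsupport ℝ (hoff w hw)]; simp
      rw [this]; simp
  rw [h1, mol, convolution_eq_swap, convolution_eq_swap]
  simp only [ContinuousLinearMap.lsmul_apply, smul_eq_mul]
  rw [r1] at i2 i3
  rw [r2] at i1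
  rw [r2 g, ← hρ, r1 g']
  have := integral_bilinear_hasLineDerivAt_right_eq_neg_left_of_integrable (μ := (volume : Measure (Z d))) (f := g) (f' := g') (g := fun w => ρ (z - w))
    (g' := fun w => - ρe (z - w)) (v := e) (B := ContinuousLinearMap.mul ℝ ℝ) (by simpa [mul_comm] using i3)
    (by simpa [mul_comm] using i1.neg) (by simpa [mul_comm] using i2)
    (by
      intro w hw
      refine hder w ?_
      by_contra hwK
      have hc : closure (Function.support fun w => ρ (z - w)) ⊆ Metric.closedBall z φ.rOut := by
        refine closure_minimal ?_ Metric.isClosed_closedBall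
        intro y hy
        have : z - y ∈ tsupport ρ := subset_tsupport _ hy
        rw [hts, mem_closedBall_zero_iff] at this
        rw [Metric.mem_closedBall, dist_comm, dist_eq_norm]; exact this
      exact hwK (hz (hc hw)))
    (by
      intro w _
      have h2 : HasFDerivAt (fun w => ρ (z - w)) ((fderiv ℝ ρ (z - w)).comp (-ContinuousLinearMap.id ℝ (Z d))) w :=
        ((hρ1.differentiable (by simp)) (z - w)).hasFDerivAt.comp w ((hasFDerivAt_id w).const_sub z)
      have := h2.hasLineDerivAt e
      simpa [hρe] using this)
  simp only [ContinuousLinearMap.mul_apply', mul_neg, integral_neg, neg_inj] at this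
  simpa only [mul_comm] using this

end LinEst

namespace LinEst
variable {d : ℕ}

/-- The open cylinder `C_{2,1}`. -/
def QQ (d : ℕ) : Set (Z d) := Set.Ioo (0 : ℝ) 2 ×ˢ Metric.ball (0 : EuclideanSpace ℝ (Fin d)) 1

structure Sob (u ut : Z d → ℝ) (du : Z d → E d) (d2u : Z d → Matrix (Fin d) (Fin d) ℝ) : Prop where
  mu : Measurable u
  mt : Measurable ut
  mdu : ∀ i, Measurable fun z => du z i
  md2u : ∀ i j, Measurable fun z => d2u z i j
  cont : ContinuousOn u (closure (QQ d))
  dt : ∀ z ∈ QQ d, HasDerivAt (fun s => u (s, z.2)) (ut z) z.1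
  dx : ∀ z ∈ QQ d, ∀ i, HasDerivAt (fun s : ℝ => u (z.1, z.2 + s • EuclideanSpace.single i (1 : ℝ))) (du z i) 0
  dxx : ∀ z ∈ QQ d, ∀ i j, HasDerivAt (fun s : ℝ => du (z.1, z.2 + s • EuclideanSpace.single j (1 : ℝ)) i) (d2u z i j) 0
  loc : ∀ G : Set (Z d), IsCompact G → G ⊆ QQ d →
          IntegrableOn (fun z => |ut z| ^ ((d : ℝ) + 1) + ‖du z‖ ^ ((d : ℝ) + 1) +
            frobNorm (d2u z) ^ ((d : ℝ) + 1)) G volume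

lemma QQ_open : IsOpen (QQ d) := isOpen_Ioo.prod Metric.isOpen_ball

lemma memLp_ind {K : Set (Z d)} (hK : IsCompact K) {F g : Z d → ℝ} (hF : IntegrableOn F K) (hg : Measurable g)
    (hle : ∀ z, |g z| ^ ((d : ℝ) + 1) ≤ F z) : MemLp (K.indicator g) (d + 1 : ℕ) volume ∧ IntegrableOn g K := by
  have h : MemLp g (d + 1 : ℕ) (volume.restrict K) := by
    rw [← integrable_norm_rpow_iff hg.aestronglyMeasurable (by simp) (by simp)]
    refine hF.mono' ((hg.norm.pow_const _).aestronglyMeasurable) (Filter.Eventually.of_forall fun z => ?_)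
    rw [Real.norm_of_nonneg (by positivity)]
    have hq : ((d + 1 : ℕ) : ℝ≥0∞).toReal = (d : ℝ) + 1 := by rw [ENNReal.toReal_natCast]; push_cast; rfl
    rw [hq]
    exact hle z
  haveI : IsFiniteMeasure (volume.restrict K) := ⟨by simpa using hK.measure_lt_top⟩
  exact ⟨(memLp_indicator_iff_restrict hK.measurableSet).2 h, h.integrable (by exact_mod_cast Nat.le_add_left 1 d)⟩

lemma entry_le_frob (m : Matrix (Fin d) (Fin d) ℝ) (i j : Fin d) : |m i j| ≤ frobNorm m := by
  refine Real.abs_le_sqrt ?_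
  calc (m i j) ^ 2 ≤ ∑ j, (m i j) ^ 2 := Finset.single_le_sum (f := fun j => (m i j) ^ 2) (fun _ _ => sq_nonneg _) (Finset.mem_univ j)
    _ ≤ _ := Finset.single_le_sum (f := fun i => ∑ j, (m i j) ^ 2) (fun _ _ => Finset.sum_nonneg fun _ _ => sq_nonneg _) (Finset.mem_univ i)

lemma moll_ev {K D : Set (Z d)} (hDK : D ⊆ K) (hKm : MeasurableSet K) (hD : MeasurableSet D) {g : Z d → ℝ} (hg : Measurable g) (hgi : IntegrableOn g K)
    (hgL : MemLp (K.indicator g) (d + 1 : ℕ) volume) {θ : ℝ} (hθ : 0 < θ) :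
    ∀ᶠ r in nhdsWithin (0 : ℝ) (Ioi 0), ∀ φ : ContDiffBump (0 : Z d), φ.rOut = r →
      ∫⁻ z in D, ENNReal.ofReal |mol φ (K.indicator g) z - g z| ^ (d + 1) ≤ ENNReal.ofReal θ ^ (d + 1) := by
  obtain ⟨r, hr, h⟩ := moll_Lp (hg.indicator hKm) ((integrable_indicator_iff hKm).2 hgi).locallyIntegrable d hgL (ENNReal.ofReal_pos.2 hθ)
  filter_upwards [Ioo_mem_nhdsGT hr] with s hs φ hφ
  refine le_trans ?_ (h φ (by rw [hφ]; exact hs.2))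
  refine le_trans (le_of_eq ?_) (setLIntegral_le_lintegral D _)
  refine setLIntegral_congr_fun hD fun z hz => ?_
  simp only [indicator_of_mem (hDK hz), mol, ← Real.norm_eq_abs, ofReal_norm]

lemma approx {u ut : Z d → ℝ} {du : Z d → E d} {d2u : Z d → Matrix (Fin d) (Fin d) ℝ} (h : Sob u ut du d2u) {D : Set (Z d)} (hD : IsCompact D)
    (hDQ : D ⊆ QQ d) {θ : ℝ} (hθ : 0 < θ) :
    ∃ V : Z d → ℝ, ContDiff ℝ (⊤ : ℕ∞) V ∧ (∀ z ∈ D, |V z - u z| ≤ θ) ∧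
      ∫⁻ z in D, ENNReal.ofReal |jt V z - ut z| ^ (d + 1) ≤ ENNReal.ofReal θ ^ (d + 1) ∧
      (∀ i, ∫⁻ z in D, ENNReal.ofReal |jD V i z - du z i| ^ (d + 1) ≤ ENNReal.ofReal θ ^ (d + 1)) ∧
      (∀ i j, ∫⁻ z in D, ENNReal.ofReal |jH V z i j - d2u z i j| ^ (d + 1) ≤ ENNReal.ofReal θ ^ (d + 1)) := by
  obtain ⟨r0, hr0, hKQ⟩ := hD.exists_cthickening_subset_open QQ_open hDQ
  set K := Metric.cthickening r0 D with hKdef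
  have hK : IsCompact K := hD.cthickening
  have hKm := hK.measurableSet
  have hDK : D ⊆ K := Metric.self_subset_cthickening _
  have hloc := h.loc K hK hKQ
  have hp : (0 : ℝ) ≤ (d : ℝ) + 1 := by positivity
  have hcu : ContinuousOn u K := h.cont.mono (hKQ.trans subset_closure)
  have hui : IntegrableOn u K := hcu.integrableOn_compact hK
  have hfr : ∀ m : Matrix (Fin d) (Fin d) ℝ, 0 ≤ frobNorm m := fun m => Real.sqrt_nonneg _
  obtain ⟨Lt, It⟩ := memLp_ind hK hloc h.mt (fun z => by
    have : 0 ≤ ‖du z‖ ^ ((d : ℝ) + 1) := by positivity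
    have : 0 ≤ frobNorm (d2u z) ^ ((d : ℝ) + 1) := Real.rpow_nonneg (hfr _) _
    linarith)
  have hx := fun i => memLp_ind hK hloc (h.mdu i) (fun z => by
    have h1 : |du z i| ^ ((d : ℝ) + 1) ≤ ‖du z‖ ^ ((d : ℝ) + 1) :=
      Real.rpow_le_rpow (abs_nonneg _) (by simpa using PiLp.norm_apply_le (du z) i) hp
    have : 0 ≤ |ut z| ^ ((d : ℝ) + 1) := by positivity
    have : 0 ≤ frobNorm (d2u z) ^ ((d : ℝ) + 1) := Real.rpow_nonneg (hfr _) _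
    linarith)
  have hxx := fun i j => memLp_ind hK hloc (h.md2u i j) (fun z => by
    have h1 : |d2u z i j| ^ ((d : ℝ) + 1) ≤ frobNorm (d2u z) ^ ((d : ℝ) + 1) :=
      Real.rpow_le_rpow (abs_nonneg _) (entry_le_frob _ i j) hp
    have : 0 ≤ |ut z| ^ ((d : ℝ) + 1) := by positivity
    have : 0 ≤ ‖du z‖ ^ ((d : ℝ) + 1) := by positivity
    linarith)
  have huc := hK.uniformContinuousOn_of_continuous hcu
  obtain ⟨η, hη, huc⟩ := Metric.uniformContinuousOn_iff.1 huc θ hθ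
  have e1 := moll_ev hDK hKm hD.measurableSet h.mt It Lt hθ
  have e2 := Filter.eventually_all.2 fun i => moll_ev hDK hKm hD.measurableSet (h.mdu i) (hx i).2 (hx i).1 hθ
  have e3 := Filter.eventually_all.2 fun i => Filter.eventually_all.2 fun j => moll_ev hDK hKm hD.measurableSet (h.md2u i j) (hxx i j).2 (hxx i j).1 hθ
  have e4 : ∀ᶠ r in nhdsWithin (0 : ℝ) (Ioi 0), r ∈ Ioo 0 (min η (r0 / 2)) := Ioo_mem_nhdsGT (by positivity)
  obtain ⟨r, ⟨⟨f1, f2⟩, f3⟩, hr⟩ := (((e1.and e2).and e3).and e4).exists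
  have hrη : r < η := hr.2.trans_le (min_le_left _ _)
  have hrr : r < r0 / 2 := hr.2.trans_le (min_le_right _ _)
  let φ : ContDiffBump (0 : Z d) := ⟨r / 2, r, by linarith [hr.1], by linarith [hr.1]⟩
  have hφ : φ.rOut = r := rfl
  have hcb : ∀ z ∈ Metric.thickening (r0 / 2) D, Metric.closedBall z φ.rOut ⊆ K := by
    intro z hz w hw
    obtain ⟨y, hy, hzy⟩ := Metric.mem_thickening_iff.1 hz
    refine Metric.mem_cthickening_of_dist_le w y r0 D hy ?_
    have := dist_triangle w z y
    rw [Metric.mem_closedBall, hφ] at hw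
    linarith
  have hDU : D ⊆ Metric.thickening (r0 / 2) D := Metric.self_subset_thickening (by positivity) _
  have hV : ContDiff ℝ (⊤ : ℕ∞) (mol φ (K.indicator u)) := mol_contDiff φ ((integrable_indicator_iff hKm).2 hui).locallyIntegrable
  have g1 : ∀ z ∈ Metric.thickening (r0 / 2) D, jt (mol φ (K.indicator u)) z = mol φ (K.indicator ut) z := by
    intro z hz
    refine mol_fderiv φ hKm hui It (hcb z hz) fun w hw => ?_
    have := h.dt w (hKQ hw)
    rw [HasLineDerivAt]
    have h2 : HasDerivAt (fun t : ℝ => w.1 + t) 1 0 := (hasDerivAt_id (0 : ℝ)).const_add w.1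
    have := HasDerivAt.comp (0 : ℝ) (h₂ := fun s => u (s, w.2)) (h := fun t : ℝ => w.1 + t) (by simpa using this) h2
    refine (this.congr_deriv (by simp)).congr_of_eventuallyEq (Filter.Eventually.of_forall fun t => ?_)
    simp only [Function.comp]
    congr 1
    ext1 <;> simp
  have g2 : ∀ z ∈ Metric.thickening (r0 / 2) D, ∀ i, jD (mol φ (K.indicator u)) i z = mol φ (K.indicator fun z => du z i) z := by
    intro z hz i
    refine mol_fderiv φ hKm hui (hx i).2 (hcb z hz) fun w hw => ?_
    have := h.dx w (hKQ hw) i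
    rw [HasLineDerivAt]
    refine this.congr_of_eventuallyEq (Filter.Eventually.of_forall fun t => ?_)
    simp only
    congr 1
    ext1 <;> simp [ev]
  have g3 : ∀ z ∈ D, ∀ i j, jH (mol φ (K.indicator u)) z i j = mol φ (K.indicator fun z => d2u z i j) z := by
    intro z hz i j
    have hev : jD (mol φ (K.indicator u)) i =ᶠ[nhds z] mol φ (K.indicator fun z => du z i) := by
      filter_upwards [Metric.isOpen_thickening.mem_nhds (hDU hz)] with w hw using g2 w hw i
    show fderiv ℝ (jD (mol φ (K.indicator u)) i) z (ev j) = _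
    rw [hev.fderiv_eq]
    refine mol_fderiv φ hKm (hx i).2 (hxx i j).2 (hcb z (hDU hz)) fun w hw => ?_
    have := h.dxx w (hKQ hw) i j
    rw [HasLineDerivAt]
    refine this.congr_of_eventuallyEq (Filter.Eventually.of_forall fun t => ?_)
    simp only
    have hw2 : w + t • ev j = (w.1, w.2 + t • EuclideanSpace.single j (1 : ℝ)) := by
      ext1 <;> simp [ev]
    rw [hw2]
  refine ⟨mol φ (K.indicator u), hV, ?_, ?_, ?_, ?_⟩
  · intro z hz
    have hzK := hDK hz
    have := φ.dist_normed_convolution_le (μ := volume) (g := K.indicator u) (x₀ := z) (ε := θ) ((h.mu.indicator hKm).aestronglyMeasurable) (by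
      intro x hx
      have hxK : x ∈ K := hcb z (hDU hz) (Metric.ball_subset_closedBall hx)
      rw [indicator_of_mem hxK, indicator_of_mem hzK]
      rw [Metric.mem_ball, hφ] at hx
      exact (huc x hxK z hzK (hx.trans hrη)).le)
    rw [indicator_of_mem hzK, Real.dist_eq] at this
    exact this
  · refine le_trans (le_of_eq (setLIntegral_congr_fun hD.measurableSet fun z hz => ?_)) (f1 φ hφ)
    simp only [g1 z (hDU hz)]
  · intro i
    refine le_trans (le_of_eq (setLIntegral_congr_fun hD.measurableSet fun z hz => ?_)) (f2 i φ hφ)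
    simp only [g2 z (hDU hz) i]
  · intro i j
    refine le_trans (le_of_eq (setLIntegral_congr_fun hD.measurableSet fun z hz => ?_)) (f3 i j φ hφ)
    simp only [g3 z hz i j]

end LinEst

namespace LinEst
variable {d : ℕ}

lemma lp_iff {α : Type*} [MeasurableSpace α] {μ : Measure α} (n : ℕ) (g : α → ℝ) (β : ℝ≥0∞) :
    ∫⁻ z, ENNReal.ofReal |g z| ^ (n + 1) ∂μ ≤ β ^ (n + 1) ↔ eLpNorm g (n + 1 : ℕ) μ ≤ β := by
  have hn : ((n + 1 : ℕ) : ℝ) ≠ 0 := by positivity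
  rw [eLpNorm_eq_eLpNorm' (by simp) (by simp), eLpNorm']
  simp only [ENNReal.toReal_natCast, ENNReal.rpow_natCast, ← Real.norm_eq_abs, ofReal_norm]
  constructor
  · intro h
    have := ENNReal.rpow_le_rpow h (z := 1 / ((n + 1 : ℕ) : ℝ)) (by positivity)
    rwa [← ENNReal.rpow_natCast β, ← ENNReal.rpow_mul, mul_one_div_cancel hn, ENNReal.rpow_one] at this
  · intro h
    have h2 := pow_le_pow_left' h (n + 1)
    rwa [← ENNReal.rpow_natCast (_ ^ _), ← ENNReal.rpow_mul, one_div_mul_cancel hn, ENNReal.rpow_one] at h2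

lemma Ell.entry {δ : ℝ} (hδ : 0 < δ) {a : Matrix (Fin d) (Fin d) ℝ} (ha : Ell δ a) (i j : Fin d) : |a i j| ≤ d * δ⁻¹ := by
  refine (psd_entry (psd_of_quad ha.1 fun ξ => ?_) i j).trans ha.trace_le
  exact le_trans (by positivity) (ha.2 ξ).1

lemma frob_tri (A B : Matrix (Fin d) (Fin d) ℝ) : frobNorm A ≤ frobNorm B + ∑ i, ∑ j, |B i j - A i j| := by
  have e : ∀ m : Matrix (Fin d) (Fin d) ℝ, frobNorm m = ‖(WithLp.toLp 2 (fun p : Fin d × Fin d => m p.1 p.2) : EuclideanSpace ℝ (Fin d × Fin d))‖ := by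
    intro m
    rw [EuclideanSpace.norm_eq, frobNorm, Fintype.sum_prod_type]
    simp
  have h1 : frobNorm A ≤ frobNorm B + frobNorm (A - B) := by
    rw [e, e, e]
    refine le_trans (le_of_eq ?_) (norm_add_le _ _)
    congr 1
    ext p
    simp
  have h2 : frobNorm (A - B) ≤ ∑ i, ∑ j, |B i j - A i j| := by
    have hn : 0 ≤ ∑ i, ∑ j, |B i j - A i j| := Finset.sum_nonneg fun i _ => Finset.sum_nonneg fun j _ => abs_nonneg _
    rw [frobNorm]
    refine Real.sqrt_le_iff.2 ⟨hn, ?_⟩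
    rw [← Fintype.sum_prod_type' (f := fun i j => ((A - B) i j) ^ 2), ← Fintype.sum_prod_type' (f := fun i j => |B i j - A i j|)]
    refine le_trans (le_of_eq ?_) (Finset.sum_sq_le_sq_sum_of_nonneg fun i _ => abs_nonneg _)
    refine Finset.sum_congr rfl fun p _ => ?_
    rw [sq_abs, Matrix.sub_apply]; ring
  linarith

/-- Total derivative error. -/
def Err (V ut : Z d → ℝ) (du : Z d → E d) (d2u : Z d → Matrix (Fin d) (Fin d) ℝ) (θ : ℝ) (z : Z d) : ℝ :=
  |jt V z - ut z| + ∑ i, |jD V i z - du z i| + ∑ i, ∑ j, |jH V z i j - d2u z i j| + θ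

lemma err_lp {u ut : Z d → ℝ} {du : Z d → E d} {d2u : Z d → Matrix (Fin d) (Fin d) ℝ} (h : Sob u ut du d2u) {D : Set (Z d)} (hD : IsCompact D)
    (hDQ : D ⊆ QQ d) : ∃ κ : ℝ, 0 ≤ κ ∧ ∀ θ : ℝ, 0 < θ →
    ∃ V : Z d → ℝ, ContDiff ℝ (⊤ : ℕ∞) V ∧ (∀ z ∈ D, |V z - u z| ≤ θ) ∧ Measurable (Err V ut du d2u θ) ∧
      eLpNorm (Err V ut du d2u θ) (d + 1 : ℕ) (volume.restrict D) ≤ ENNReal.ofReal (κ * θ) := by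
  set w : ℝ := ((volume D) ^ (1 / ((d + 1 : ℕ) : ℝ))).toReal with hw
  have hwt : (volume D) ^ (1 / ((d + 1 : ℕ) : ℝ)) = ENNReal.ofReal w := by
    rw [hw, ENNReal.ofReal_toReal]
    exact ENNReal.rpow_ne_top_of_nonneg (by positivity) hD.measure_lt_top.ne
  have hw0 : 0 ≤ w := ENNReal.toReal_nonneg
  refine ⟨1 + d + d * d + w, by positivity, fun θ hθ => ?_⟩
  obtain ⟨V, hV, h0, h1, h2, h3⟩ := approx h hD hDQ hθ
  have hp1 : (1 : ℝ≥0∞) ≤ (d + 1 : ℕ) := by exact_mod_cast Nat.le_add_left 1 d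
  have m1 : Measurable (fun z => |jt V z - ut z|) := by
    have : Continuous (jt V) := (hV.continuous_fderiv (by simp)).clm_apply continuous_const
    exact (this.measurable.sub h.mt).norm
  have m2 : ∀ i, Measurable (fun z => |jD V i z - du z i|) := fun i =>
    ((jD_contDiff hV i).continuous.measurable.sub (h.mdu i)).norm
  have m3 : ∀ i j, Measurable (fun z => |jH V z i j - d2u z i j|) := fun i j =>
    ((jD_contDiff (jD_contDiff hV i) j).continuous.measurable.sub (h.md2u i j)).norm
  have m2s : Measurable (∑ i, fun z => |jD V i z - du z i|) := by rw [Finset.sum_fn]; exact Finset.measurable_sum _ fun i _ => m2 i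
  have m3s : ∀ i, Measurable (∑ j, fun z => |jH V z i j - d2u z i j|) := fun i => by rw [Finset.sum_fn]; exact Finset.measurable_sum _ fun j _ => m3 i j
  have m3ss : Measurable (∑ i, ∑ j, fun z => |jH V z i j - d2u z i j|) := by rw [Finset.sum_fn]; exact Finset.measurable_sum _ fun i _ => m3s i
  have eE : Err V ut du d2u θ = (fun z => |jt V z - ut z|) + (∑ i, fun z => |jD V i z - du z i|) + (∑ i, ∑ j, fun z => |jH V z i j - d2u z i j|) + (fun _ => θ) := by
    ext z
    simp [Err, Finset.sum_apply]
  refine ⟨V, hV, h0, ?_, ?_⟩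
  · rw [eE]; exact ((m1.add m2s).add m3ss).add measurable_const
  have n1 : eLpNorm (fun z => |jt V z - ut z|) (d + 1 : ℕ) (volume.restrict D) ≤ ENNReal.ofReal θ :=
    (lp_iff d _ _).1 (by simpa only [abs_abs] using h1)
  have n2 : ∀ i, eLpNorm (fun z => |jD V i z - du z i|) (d + 1 : ℕ) (volume.restrict D) ≤ ENNReal.ofReal θ := fun i =>
    (lp_iff d _ _).1 (by simpa only [abs_abs] using h2 i)
  have n3 : ∀ i j, eLpNorm (fun z => |jH V z i j - d2u z i j|) (d + 1 : ℕ) (volume.restrict D) ≤ ENNReal.ofReal θ := fun i j =>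
    (lp_iff d _ _).1 (by simpa only [abs_abs] using h3 i j)
  have n4 : eLpNorm (fun _ : Z d => θ) (d + 1 : ℕ) (volume.restrict D) ≤ ENNReal.ofReal θ * ENNReal.ofReal w := by
    rw [eLpNorm_const' θ (by simp) (by simp), Measure.restrict_apply_univ, ENNReal.toReal_natCast, hwt, Real.enorm_eq_ofReal hθ.le]
  rw [eE]
  refine (eLpNorm_add_le ((m1.add m2s).add m3ss).aestronglyMeasurable measurable_const.aestronglyMeasurable hp1).trans ?_
  have s2 : eLpNorm (∑ i, fun z => |jD V i z - du z i|) (d + 1 : ℕ) (volume.restrict D) ≤ d * ENNReal.ofReal θ := by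
    refine (eLpNorm_sum_le (fun i _ => (m2 i).aestronglyMeasurable) hp1).trans ?_
    refine (Finset.sum_le_sum fun i _ => n2 i).trans (by simp)
  have s3 : eLpNorm (∑ i, ∑ j, fun z => |jH V z i j - d2u z i j|) (d + 1 : ℕ) (volume.restrict D) ≤ d * (d * ENNReal.ofReal θ) := by
    refine (eLpNorm_sum_le (fun i _ => (m3s i).aestronglyMeasurable) hp1).trans ?_
    refine (Finset.sum_le_sum fun i _ => (eLpNorm_sum_le (fun j _ => (m3 i j).aestronglyMeasurable) hp1).trans
      (Finset.sum_le_sum fun j _ => n3 i j)).trans (by simp)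
  have s12 := (eLpNorm_add_le (p := (d + 1 : ℕ)) (μ := volume.restrict D) m1.aestronglyMeasurable m2s.aestronglyMeasurable hp1).trans (add_le_add n1 s2)
  have s123 := (eLpNorm_add_le (p := (d + 1 : ℕ)) (μ := volume.restrict D) (m1.add m2s).aestronglyMeasurable m3ss.aestronglyMeasurable hp1).trans (add_le_add s12 s3)
  refine (add_le_add s123 n4).trans (le_of_eq ?_)
  have hdd : (d : ℝ≥0∞) = ENNReal.ofReal (d : ℝ) := by simp
  rw [hdd, ← ENNReal.ofReal_mul (by positivity), ← ENNReal.ofReal_mul (by positivity), ← ENNReal.ofReal_mul (by positivity),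
    ← ENNReal.ofReal_add (by positivity) (by positivity), ← ENNReal.ofReal_add (by positivity) (by positivity), ← ENNReal.ofReal_add (by positivity) (by positivity)]
  congr 1
  ring

lemma int_pow_small {D : Set (Z d)} (hD : IsCompact D) {ε : ℝ} (hε : 0 < ε) (hε1 : ε ≤ 1) : ∃ c : ℝ≥0∞, c ≠ ∞ ∧
    ∀ (g : Z d → ℝ), Measurable g → ∀ β : ℝ≥0∞, eLpNorm g (d + 1 : ℕ) (volume.restrict D) ≤ β →
      ∫⁻ z in D, ENNReal.ofReal |g z| ^ ε ≤ (β * c) ^ ε := by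
  have h1 : ENNReal.ofReal ε ≤ (d + 1 : ℕ) := by
    refine (ENNReal.ofReal_le_ofReal hε1).trans ?_
    rw [ENNReal.ofReal_one]
    exact_mod_cast Nat.le_add_left 1 d
  refine ⟨(volume D) ^ (1 / ε - 1 / ((d + 1 : ℕ) : ℝ)), ?_, ?_⟩
  · refine ENNReal.rpow_ne_top_of_nonneg ?_ hD.measure_lt_top.ne
    have : (1 : ℝ) ≤ 1 / ε := by rw [le_div_iff₀ hε]; linarith
    have : 1 / ((d + 1 : ℕ) : ℝ) ≤ 1 := by
      rw [div_le_one (by positivity)]; push_cast; linarith [Nat.cast_nonneg (α := ℝ) d]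
    linarith
  intro g hg β hβ
  have := eLpNorm_le_eLpNorm_mul_rpow_measure_univ (μ := volume.restrict D) h1 hg.aestronglyMeasurable
  rw [ENNReal.toReal_ofReal hε.le, ENNReal.toReal_natCast, Measure.restrict_apply_univ] at this
  have h2 := this.trans (mul_le_mul_left hβ _)
  rw [eLpNorm_eq_eLpNorm' (by simpa using hε) (by simp), eLpNorm', ENNReal.toReal_ofReal hε.le] at h2
  have h3 := ENNReal.rpow_le_rpow h2 hε.le
  rw [← ENNReal.rpow_mul, one_div_mul_cancel hε.ne', ENNReal.rpow_one] at h3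
  simpa only [← Real.norm_eq_abs, ofReal_norm] using h3

end LinEst

namespace LinEst
variable {d : ℕ}

def LL (a : Z d → Matrix (Fin d) (Fin d) ℝ) (b : Z d → E d) (c u ut : Z d → ℝ) (du : Z d → E d) (d2u : Z d → Matrix (Fin d) (Fin d) ℝ) (z : Z d) : ℝ :=
  ut z + ctr (a z) (d2u z) + inner ℝ (b z) (du z) - c z * u z

lemma inner_sum (x y : E d) : inner ℝ x y = ∑ i, x i * y i := by
  simp [PiLp.inner_apply, mul_comm]

lemma abs_coord (x : E d) (i : Fin d) : |x i| ≤ ‖x‖ := by simpa using PiLp.norm_apply_le x i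

lemma LL_meas {a : Z d → Matrix (Fin d) (Fin d) ℝ} {b : Z d → E d} {c u ut : Z d → ℝ} {du : Z d → E d} {d2u : Z d → Matrix (Fin d) (Fin d) ℝ}
    (ha : ∀ i j, Measurable fun z => a z i j) (hb : ∀ i, Measurable fun z => b z i) (hc : Measurable c) (h : Sob u ut du d2u) :
    Measurable (LL a b c u ut du d2u) := by
  have h1 : Measurable (fun z => ctr (a z) (d2u z)) := by
    simp only [ctr]
    exact Finset.measurable_sum _ fun i _ => Finset.measurable_sum _ fun j _ => (ha i j).mul (h.md2u i j)
  have h2 : Measurable (fun z => inner ℝ (b z) (du z)) := by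
    simp only [inner_sum]
    exact Finset.measurable_sum _ fun i _ => (hb i).mul (h.mdu i)
  exact ((h.mt.add h1).add h2).sub (hc.mul h.mu)

lemma LL_diff {δ K θ : ℝ} (hδ : 0 < δ) (hK : 0 ≤ K) (hθ : 0 < θ) {a : Z d → Matrix (Fin d) (Fin d) ℝ} {b : Z d → E d} {c u ut V : Z d → ℝ} {du : Z d → E d} {d2u : Z d → Matrix (Fin d) (Fin d) ℝ}
    {z : Z d} (ha : Ell δ (a z)) (hbc : ‖b z‖ + c z ≤ K) (hc : 0 ≤ c z) (hV : |V z - u z| ≤ θ) :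
    |LL a b c V (jt V) (jG V) (jH V) z| ≤ |LL a b c u ut du d2u z| + (1 + d * δ⁻¹ + K) * Err V ut du d2u θ z := by
  have hΛ : 0 ≤ d * δ⁻¹ := by positivity
  have hb : ‖b z‖ ≤ K := by linarith
  have hcK : c z ≤ K := by linarith [norm_nonneg (b z)]
  have e : LL a b c V (jt V) (jG V) (jH V) z = LL a b c u ut du d2u z + ((jt V z - ut z) + ctr (a z) (jH V z - d2u z) + (∑ i, b z i * (jD V i z - du z i)) - c z * (V z - u z)) := by
    simp only [LL, ctr_sub, inner_sum, mul_sub, Finset.sum_sub_distrib, jG]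
    ring
  have t1 : |ctr (a z) (jH V z - d2u z)| ≤ (d * δ⁻¹) * ∑ i, ∑ j, |jH V z i j - d2u z i j| := by
    simp only [ctr, Finset.mul_sum]
    refine (Finset.abs_sum_le_sum_abs _ _).trans (Finset.sum_le_sum fun i _ => (Finset.abs_sum_le_sum_abs _ _).trans (Finset.sum_le_sum fun j _ => ?_))
    rw [abs_mul, Matrix.sub_apply]
    exact mul_le_mul_of_nonneg_right (ha.entry hδ i j) (abs_nonneg _)
  have t2 : |∑ i, b z i * (jD V i z - du z i)| ≤ K * ∑ i, |jD V i z - du z i| := by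
    rw [Finset.mul_sum]
    refine (Finset.abs_sum_le_sum_abs _ _).trans (Finset.sum_le_sum fun i _ => ?_)
    rw [abs_mul]
    exact mul_le_mul_of_nonneg_right ((abs_coord _ i).trans hb) (abs_nonneg _)
  have t3 : |c z * (V z - u z)| ≤ K * θ := by
    rw [abs_mul, abs_of_nonneg hc]
    exact mul_le_mul hcK hV (abs_nonneg _) hK
  have p1 : 0 ≤ |jt V z - ut z| := abs_nonneg _
  have p2 : 0 ≤ ∑ i, |jD V i z - du z i| := Finset.sum_nonneg fun i _ => abs_nonneg _
  have p3 : 0 ≤ ∑ i, ∑ j, |jH V z i j - d2u z i j| := Finset.sum_nonneg fun i _ => Finset.sum_nonneg fun j _ => abs_nonneg _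
  rw [e, Err]
  refine (abs_add_le _ _).trans (add_le_add le_rfl ?_)
  refine (abs_sub _ _).trans ?_
  have q1 := abs_add_le (jt V z - ut z + ctr (a z) (jH V z - d2u z)) (∑ i, b z i * (jD V i z - du z i))
  have q2 := abs_add_le (jt V z - ut z) (ctr (a z) (jH V z - d2u z))
  generalize |jt V z - ut z| = x1 at *
  generalize (∑ i, |jD V i z - du z i|) = x2 at *
  generalize (∑ i, ∑ j, |jH V z i j - d2u z i j|) = x3 at *
  generalize d * δ⁻¹ = Λ at *
  have : 0 ≤ (Λ + K) * x1 + (1 + Λ) * x2 + (1 + K) * x3 + (1 + Λ) * θ := by positivity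
  linarith

lemma step (d : ℕ) (hd : 1 ≤ d) {δ K : ℝ} (hδ : 0 < δ) (hδ1 : δ ≤ 1) (hK : 0 ≤ K) :
    ∃ (ε C : ℝ), 0 < ε ∧ ε ≤ 1 / 4 ∧ 0 < C ∧
    ∀ {a : Z d → Matrix (Fin d) (Fin d) ℝ} {b : Z d → E d} {c u ut : Z d → ℝ} {du : Z d → E d} {d2u : Z d → Matrix (Fin d) (Fin d) ℝ}
    (_ : ∀ i j, Measurable fun z => a z i j) (_ : ∀ i, Measurable fun z => b z i) (_ : Measurable c)
    (_ : ∀ z, Ell δ (a z)) (_ : ∀ z, ‖b z‖ + c z ≤ K) (_ : ∀ z, 0 ≤ c z) (_ : Sob u ut du d2u)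
    {τ : ℝ} (_ : 0 < τ) (_ : τ < 1 / 4) {M b0 : ℝ} (_ : 0 ≤ M) (_ : 0 ≤ b0)
    (_ : ∫⁻ z in QQ d, ENNReal.ofReal |LL a b c u ut du d2u z| ^ (d + 1) ≤ ENNReal.ofReal b0 ^ (d + 1))
    (_ : ∀ t ∈ Icc (1 / 2 - τ : ℝ) (2 - τ), ∀ x ∈ Metric.sphere (0 : E d) (1 - τ), |u (t, x)| ≤ M)
    (_ : ∀ x ∈ Metric.closedBall (0 : E d) (1 - τ), |u (2 - τ, x)| ≤ M),
    ∫⁻ z in Ioo (1 - τ : ℝ) (2 - τ) ×ˢ Metric.ball (0 : E d) (1 - τ), ENNReal.ofReal (frobNorm (d2u z)) ^ ε ≤ ENNReal.ofReal C * ENNReal.ofReal (M + b0) ^ ε := by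
  obtain ⟨ε, C, hε, hε1, hC, hmain⟩ := smooth_full d hd hδ hδ1 hK
  refine ⟨ε, C, hε, hε1, hC, ?_⟩
  intro a b c u ut du d2u ha hb hc hE hbc hc0 h τ hτ hτ1 M b0 hM hb0 hL hside htop
  set D : Set (Z d) := Icc (1 / 2 - τ : ℝ) (2 - τ) ×ˢ Metric.closedBall (0 : E d) (1 - τ) with hDdef
  have hD : IsCompact D := isCompact_Icc.prod (isCompact_closedBall _ _)
  have hDQ : D ⊆ QQ d := by
    rintro ⟨t, x⟩ ⟨ht, hx⟩
    simp only [mem_Icc, Metric.mem_closedBall, dist_zero_right] at ht hx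
    refine ⟨⟨by simp only; linarith, by simp only; linarith⟩, ?_⟩
    simp only [Metric.mem_ball, dist_zero_right]; linarith
  set A : Set (Z d) := Ioo (1 - τ : ℝ) (2 - τ) ×ˢ Metric.ball (0 : E d) (1 - τ) with hAdef
  have hAD : A ⊆ D := by
    rintro ⟨t, x⟩ ⟨ht, hx⟩
    exact ⟨⟨by linarith [ht.1], ht.2.le⟩, Metric.ball_subset_closedBall hx⟩
  have hA : MeasurableSet A := measurableSet_Ioo.prod measurableSet_ball
  obtain ⟨κ, hκ, happ⟩ := err_lp h hD hDQ
  obtain ⟨c1, hc1, hpow⟩ := int_pow_small hD hε (by linarith)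
  set P : ℝ := 1 + d * δ⁻¹ + K with hP
  have hP0 : 0 ≤ P := by positivity
  have hLm := LL_meas ha hb hc h
  have hp1 : (1 : ℝ≥0∞) ≤ (d + 1 : ℕ) := by exact_mod_cast Nat.le_add_left 1 d
  have key : ∀ θ : ℝ, 0 < θ → ∫⁻ z in A, ENNReal.ofReal (frobNorm (d2u z)) ^ ε ≤
      ENNReal.ofReal C * ENNReal.ofReal (M + b0 + (1 + P * κ + 1) * θ) ^ ε + (ENNReal.ofReal (κ * θ) * c1) ^ ε := by
    intro θ hθ
    obtain ⟨V, hV, hVu, hEm, hEL⟩ := happ θ hθ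
    have hE0 : ∀ z, 0 ≤ Err V ut du d2u θ z := by
      intro z
      have : 0 ≤ ∑ i, |jD V i z - du z i| := Finset.sum_nonneg fun i _ => abs_nonneg _
      have : 0 ≤ ∑ i, ∑ j, |jH V z i j - d2u z i j| := Finset.sum_nonneg fun i _ => Finset.sum_nonneg fun j _ => abs_nonneg _
      rw [Err]; positivity
    set f : Z d → ℝ := fun z => |LL a b c u ut du d2u z| + P * Err V ut du d2u θ z with hf
    have hf0 : ∀ z, 0 ≤ f z := fun z => add_nonneg (abs_nonneg _) (mul_nonneg hP0 (hE0 z))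
    have hfm : Measurable f := hLm.norm.add (hEm.const_mul P)
    have hfL : ∫⁻ z in D, ENNReal.ofReal (f z) ^ (d + 1) ≤ ENNReal.ofReal (b0 + P * κ * θ + θ) ^ (d + 1) := by
      have h1 : eLpNorm (fun z => |LL a b c u ut du d2u z|) (d + 1 : ℕ) (volume.restrict D) ≤ ENNReal.ofReal b0 := by
        refine (lp_iff d _ _).1 ?_
        simp only [abs_abs]
        exact (lintegral_mono_set hDQ).trans hL
      have h2 : eLpNorm (fun z => P * Err V ut du d2u θ z) (d + 1 : ℕ) (volume.restrict D) ≤ ENNReal.ofReal (P * (κ * θ)) := by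
        have e : (fun z => P * Err V ut du d2u θ z) = P • Err V ut du d2u θ := by ext z; simp
        rw [e, eLpNorm_const_smul, Real.enorm_eq_ofReal hP0, ENNReal.ofReal_mul hP0]
        exact mul_le_mul_right hEL _
      have h3 : eLpNorm f (d + 1 : ℕ) (volume.restrict D) ≤ ENNReal.ofReal (b0 + P * κ * θ + θ) := by
        refine (eLpNorm_add_le hLm.norm.aestronglyMeasurable (hEm.const_mul P).aestronglyMeasurable hp1).trans ((add_le_add h1 h2).trans ?_)
        rw [← ENNReal.ofReal_add hb0 (by positivity)]
        refine ENNReal.ofReal_le_ofReal (by linarith)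
      have := (lp_iff d _ _).2 h3
      simpa only [abs_of_nonneg (hf0 _)] using this
    have hB : ∀ z ∈ D, |u z| ≤ M → |V z| ≤ M + θ := by
      intro z hz hu
      have := hVu z hz
      have := abs_sub_abs_le_abs_sub (V z) (u z)
      linarith
    have hs := hmain τ (B := M + θ) (β := b0 + P * κ * θ + θ) (R := 1 - τ) (u := V) (ut := jt V) (G := jG V) (H := jH V) (a := a) (b := b) (c := c) (f := f)
      (by positivity) (by positivity) (by linarith) (by linarith) (fun z => jet_smooth hV z) hE hbc hc0 hf0 hfm
      (fun t ht x hx => LL_diff hδ hK hθ (hE _) (hbc _) (hc0 _) (hVu _ ⟨ht, hx⟩)) hfL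
      (fun t ht x hx => hB _ ⟨ht, Metric.sphere_subset_closedBall hx⟩ (hside t ht x hx))
      (fun x hx => hB _ ⟨⟨by linarith, le_rfl⟩, hx⟩ (htop x hx))
    have hsum : M + θ + (b0 + P * κ * θ + θ) = M + b0 + (1 + P * κ + 1) * θ := by ring
    rw [hsum] at hs
    have hEr := hpow _ hEm _ hEL
    simp only [abs_of_nonneg (hE0 _)] at hEr
    calc ∫⁻ z in A, ENNReal.ofReal (frobNorm (d2u z)) ^ ε
        ≤ ∫⁻ z in A, (ENNReal.ofReal (frobNorm (jH V z)) ^ ε + ENNReal.ofReal (Err V ut du d2u θ z) ^ ε) := by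
          refine lintegral_mono fun z => ?_
          have hft : frobNorm (d2u z) ≤ frobNorm (jH V z) + Err V ut du d2u θ z := by
            refine (frob_tri (d2u z) (jH V z)).trans (add_le_add le_rfl ?_)
            have : 0 ≤ ∑ i, |jD V i z - du z i| := Finset.sum_nonneg fun i _ => abs_nonneg _
            rw [Err]
            linarith [abs_nonneg (jt V z - ut z)]
          refine (ENNReal.rpow_le_rpow (ENNReal.ofReal_le_ofReal hft) hε.le).trans ?_
          rw [ENNReal.ofReal_add (show 0 ≤ frobNorm (jH V z) from Real.sqrt_nonneg _) (hE0 z)]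
          exact ENNReal.rpow_add_le_add_rpow _ _ hε.le (by linarith)
      _ = (∫⁻ z in A, ENNReal.ofReal (frobNorm (jH V z)) ^ ε) + ∫⁻ z in A, ENNReal.ofReal (Err V ut du d2u θ z) ^ ε :=
          lintegral_add_right _ (hEm.ennreal_ofReal.pow_const _)
      _ ≤ _ := add_le_add hs ((lintegral_mono_set hAD).trans hEr)
  have hlim : Filter.Tendsto (fun θ : ℝ => ENNReal.ofReal C * ENNReal.ofReal (M + b0 + (1 + P * κ + 1) * θ) ^ ε + (ENNReal.ofReal (κ * θ) * c1) ^ ε)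
      (nhdsWithin 0 (Ioi 0)) (nhds (ENNReal.ofReal C * ENNReal.ofReal (M + b0) ^ ε)) := by
    refine Filter.Tendsto.mono_left ?_ nhdsWithin_le_nhds
    have l1 : Filter.Tendsto (fun θ : ℝ => ENNReal.ofReal (M + b0 + (1 + P * κ + 1) * θ) ^ ε) (nhds 0) (nhds (ENNReal.ofReal (M + b0) ^ ε)) := by
      have : Continuous (fun θ : ℝ => ENNReal.ofReal (M + b0 + (1 + P * κ + 1) * θ) ^ ε) :=
        ENNReal.continuous_rpow_const.comp (ENNReal.continuous_ofReal.comp (by fun_prop))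
      simpa using this.tendsto 0
    have l2 : Filter.Tendsto (fun θ : ℝ => (ENNReal.ofReal (κ * θ) * c1) ^ ε) (nhds 0) (nhds 0) := by
      have c2 : Continuous (fun θ : ℝ => (ENNReal.ofReal (κ * θ) * c1) ^ ε) :=
        ENNReal.continuous_rpow_const.comp ((ENNReal.continuous_mul_const hc1).comp (ENNReal.continuous_ofReal.comp (by fun_prop)))
      have := c2.tendsto 0
      simpa [hε] using this
    simpa using (ENNReal.Tendsto.const_mul l1 (Or.inr ENNReal.ofReal_ne_top)).add l2
  refine ge_of_tendsto hlim ?_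
  filter_upwards [self_mem_nhdsWithin] with θ hθ using key θ hθ

end LinEst

namespace LinEst
variable {d : ℕ}

/-- The parabolic boundary. -/
def PB (d : ℕ) : Set (Z d) := (Set.Icc (0 : ℝ) 2 ×ˢ Metric.sphere (0 : EuclideanSpace ℝ (Fin d)) 1 ∪
                    {(2 : ℝ)} ×ˢ Metric.ball (0 : EuclideanSpace ℝ (Fin d)) 1)

lemma closQ : closure (QQ d) = Icc (0 : ℝ) 2 ×ˢ Metric.closedBall (0 : E d) 1 := by
  rw [QQ, closure_prod_eq, closure_Ioo (by norm_num), closure_ball _ one_ne_zero]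

lemma PB_sub : PB d ⊆ closure (QQ d) := by
  rw [closQ]
  rintro ⟨t, x⟩ (⟨ht, hx⟩ | ⟨ht, hx⟩)
  · exact ⟨ht, Metric.sphere_subset_closedBall hx⟩
  · simp only [mem_singleton_iff] at ht
    subst ht
    exact ⟨⟨by norm_num, le_rfl⟩, Metric.ball_subset_closedBall hx⟩

lemma compQ : IsCompact (closure (QQ d)) := by
  rw [closQ]; exact isCompact_Icc.prod (isCompact_closedBall _ _)

lemma le_sup {u : Z d → ℝ} (hu : ContinuousOn u (closure (QQ d))) {z : Z d} (hz : z ∈ PB d) : |u z| ≤ ⨆ z ∈ PB d, |u z| := by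
  obtain ⟨B, hB⟩ := compQ.exists_bound_of_continuousOn hu
  have hbdd : BddAbove (range fun z => ⨆ (_ : z ∈ PB d), |u z|) := by
    refine ⟨max B 0, ?_⟩
    rintro _ ⟨w, rfl⟩
    simp only
    by_cases hw : w ∈ PB d
    · rw [ciSup_pos hw]; exact le_max_of_le_left (hB w (PB_sub hw))
    · simp [hw]
  refine le_ciSup_of_le hbdd z ?_
  rw [ciSup_pos hz]

lemma final (d : ℕ) (hd : 1 ≤ d) {δ K : ℝ} (hδ : 0 < δ) (hδ1 : δ ≤ 1) (hK : 0 ≤ K) :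
    ∃ (ε C : ℝ), 0 < ε ∧ ε ≤ 1 / 4 ∧ 0 < C ∧
    ∀ {a : Z d → Matrix (Fin d) (Fin d) ℝ} {b : Z d → E d} {c u ut : Z d → ℝ} {du : Z d → E d} {d2u : Z d → Matrix (Fin d) (Fin d) ℝ}
    (_ : ∀ i j, Measurable fun z => a z i j) (_ : ∀ i, Measurable fun z => b z i) (_ : Measurable c)
    (_ : ∀ z, Ell δ (a z)) (_ : ∀ z, ‖b z‖ + c z ≤ K) (_ : ∀ z, 0 ≤ c z) (_ : Sob u ut du d2u)
    {b0 : ℝ} (_ : 0 ≤ b0)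
    (_ : ∫⁻ z in QQ d, ENNReal.ofReal |LL a b c u ut du d2u z| ^ (d + 1) ≤ ENNReal.ofReal b0 ^ (d + 1)),
    ∫⁻ z in Ioo (1 : ℝ) 2 ×ˢ Metric.ball (0 : E d) 1, ENNReal.ofReal (frobNorm (d2u z)) ^ ε ≤ ENNReal.ofReal C * ENNReal.ofReal ((⨆ z ∈ PB d, |u z|) + b0) ^ ε := by
  obtain ⟨ε, C, hε, hε1, hC, hmain⟩ := step d hd hδ hδ1 hK
  refine ⟨ε, C, hε, hε1, hC, ?_⟩
  intro a b c u ut du d2u ha hb hc hE hbc hc0 h b0 hb0 hL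
  set S := ⨆ z ∈ PB d, |u z| with hS
  have hS0 : 0 ≤ S := Real.iSup_nonneg fun z => Real.iSup_nonneg fun _ => abs_nonneg _
  have key : ∀ θ : ℝ, 0 < θ → ∫⁻ z in Ioo (1 : ℝ) 2 ×ˢ Metric.ball (0 : E d) 1, ENNReal.ofReal (frobNorm (d2u z)) ^ ε ≤
      ENNReal.ofReal C * ENNReal.ofReal (S + θ + b0) ^ ε := by
    intro θ hθ
    obtain ⟨η, hη, huc⟩ := Metric.uniformContinuousOn_iff.1 (compQ.uniformContinuousOn_of_continuous h.cont) θ hθ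
    have hnear : ∀ z ∈ closure (QQ d), ∀ w ∈ PB d, dist z w < η → |u z| ≤ S + θ := by
      intro z hz w hw hzw
      have h1 := huc z hz w (PB_sub hw) hzw
      rw [Real.dist_eq] at h1
      have h2 := le_sup h.cont hw
      have h3 := abs_sub_abs_le_abs_sub (u z) (u w)
      linarith
    set τ0 : ℝ := min η (1 / 4) / 2 with hτ0
    have hτ0p : 0 < τ0 := by positivity
    have hτη : τ0 < η := by
      have := min_le_left η (1 / 4); have : 0 < min η (1 / 4) := by positivity
      rw [hτ0]; linarith
    have hτ4 : τ0 < 1 / 4 := by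
      have := min_le_right η (1 / 4); have : 0 < min η (1 / 4) := by positivity
      rw [hτ0]; linarith
    set τ : ℕ → ℝ := fun n => τ0 / (n + 1) with hτdef
    have hτp : ∀ n, 0 < τ n := fun n => by positivity
    have hτle : ∀ n, τ n ≤ τ0 := fun n => div_le_self hτ0p.le (by linarith [Nat.cast_nonneg (α := ℝ) n])
    have hτanti : ∀ m n, m ≤ n → τ n ≤ τ m := fun m n hmn => by
      have : (m : ℝ) ≤ n := by exact_mod_cast hmn
      exact div_le_div_of_nonneg_left hτ0p.le (by positivity) (by linarith)
    set A : ℕ → Set (Z d) := fun n => Ioo (1 : ℝ) (2 - τ n) ×ˢ Metric.ball (0 : E d) (1 - τ n) with hA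
    have hmono : Monotone A := by
      intro m n hmn
      have := hτanti m n hmn
      exact prod_mono (Ioo_subset_Ioo_right (by linarith)) (Metric.ball_subset_ball (by linarith))
    have hU : Ioo (1 : ℝ) 2 ×ˢ Metric.ball (0 : E d) 1 ⊆ ⋃ n, A n := by
      rintro ⟨t, x⟩ ⟨ht, hx⟩
      simp only [mem_Ioo, Metric.mem_ball, dist_zero_right] at ht hx
      have hpos : 0 < min (2 - t) (1 - ‖x‖) / τ0 := by
        have : 0 < min (2 - t) (1 - ‖x‖) := lt_min (by linarith) (by linarith)
        positivity
      obtain ⟨n, hn⟩ := exists_nat_one_div_lt hpos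
      rw [lt_div_iff₀ hτ0p, one_div_mul_eq_div, lt_min_iff] at hn
      refine mem_iUnion.2 ⟨n, ⟨ht.1, ?_⟩, ?_⟩
      · show t < 2 - τ0 / (n + 1); linarith [hn.1]
      · rw [Metric.mem_ball, dist_zero_right]
        show ‖x‖ < 1 - τ0 / (n + 1); linarith [hn.2]
    refine (lintegral_mono_set hU).trans ?_
    rw [setLIntegral_iUnion_of_directed _ hmono.directed_le]
    refine iSup_le fun n => ?_
    have hn4 : τ n < 1 / 4 := (hτle n).trans_lt hτ4
    have hnη : τ n < η := (hτle n).trans_lt hτη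
    have hn0 := hτp n
    refine (lintegral_mono_set ?_).trans (hmain ha hb hc hE hbc hc0 h (hτp n) hn4 (M := S + θ) (by positivity) hb0 hL ?_ ?_)
    · exact prod_mono (Ioo_subset_Ioo_left (by linarith)) subset_rfl
    · intro t ht x hx
      rw [mem_sphere_zero_iff_norm] at hx
      have ht' : t ∈ Icc (0 : ℝ) 2 := ⟨by linarith [ht.1], by linarith [ht.2]⟩
      refine hnear (t, x) ?_ (t, (1 - τ n)⁻¹ • x) ?_ ?_
      · rw [closQ]; exact ⟨ht', by rw [mem_closedBall_zero_iff, hx]; linarith⟩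
      · refine Or.inl ⟨ht', ?_⟩
        rw [mem_sphere_zero_iff_norm, norm_smul, norm_inv, Real.norm_of_nonneg (by linarith), hx, inv_mul_cancel₀ (by linarith)]
      · have hR : (0 : ℝ) < 1 - τ n := by linarith
        have e : x - (1 - τ n)⁻¹ • x = (1 - (1 - τ n)⁻¹) • x := by rw [sub_smul, one_smul]
        have e2 : dist ((t, x) : Z d) (t, (1 - τ n)⁻¹ • x) = dist x ((1 - τ n)⁻¹ • x) := by
          rw [Prod.dist_eq]; simp
        rw [e2, dist_eq_norm, e, norm_smul, hx, Real.norm_eq_abs, ← abs_of_pos hR, ← abs_mul]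
        have e3 : (1 - |1 - τ n|⁻¹) * |1 - τ n| = - τ n := by
          rw [abs_of_pos hR]; field_simp; ring
        rw [abs_of_pos hR] at e3 ⊢
        rw [e3, abs_neg, abs_of_pos hn0]; exact hnη
    · intro x hx
      rw [mem_closedBall_zero_iff] at hx
      refine hnear (2 - τ n, x) ?_ (2, x) ?_ ?_
      · rw [closQ]; exact ⟨⟨by simp only; linarith, by simp only; linarith⟩, by rw [mem_closedBall_zero_iff]; simp only; linarith⟩
      · exact Or.inr ⟨rfl, by rw [mem_ball_zero_iff]; simp only; linarith⟩
      · rw [Prod.dist_eq, dist_self, Real.dist_eq]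
        simp only
        rw [max_eq_left (abs_nonneg _), abs_of_nonpos (by linarith)]
        linarith
  have hlim : Filter.Tendsto (fun θ : ℝ => ENNReal.ofReal C * ENNReal.ofReal (S + θ + b0) ^ ε)
      (nhdsWithin 0 (Ioi 0)) (nhds (ENNReal.ofReal C * ENNReal.ofReal (S + b0) ^ ε)) := by
    refine Filter.Tendsto.mono_left ?_ nhdsWithin_le_nhds
    have l1 : Filter.Tendsto (fun θ : ℝ => ENNReal.ofReal (S + θ + b0) ^ ε) (nhds 0) (nhds (ENNReal.ofReal (S + b0) ^ ε)) := by
      have : Continuous (fun θ : ℝ => ENNReal.ofReal (S + θ + b0) ^ ε) :=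
        ENNReal.continuous_rpow_const.comp (ENNReal.continuous_ofReal.comp (by fun_prop))
      simpa using this.tendsto 0
    exact ENNReal.Tendsto.const_mul l1 (Or.inr ENNReal.ofReal_ne_top)
  refine ge_of_tendsto hlim ?_
  filter_upwards [self_mem_nhdsWithin] with θ hθ using key θ hθ

end LinEst

/-- **Theorem 1.1 (parabolic Lin-type estimate).**
There are constants `γ ∈ (0,1]` and `N`, depending only on `δ`, `K`, `d`, such that for any
operator `L ∈ 𝔏_{δ,K}` (i.e. `L = ∂ₜ + aⁱʲD_{ij} + bⁱDᵢ - c` with measurable coefficients,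
`a` being `S_δ`-valued, `|b| + c ≤ K`, `c ≥ 0`) and any
`u ∈ W^{1,2}_{d+1,loc}(C_{2,1}) ∩ C(C̄_{2,1})` one has
`∫_{C_{1,1}(1,0)} |D²u|^γ ≤ N (∫_{C_{2,1}} |Lu|^{d+1})^{γ/(d+1)} + N sup_{∂'C_{2,1}} |u|^γ`.
Here `C_{2,1} = (0,2) × B₁`, `C_{1,1}(1,0) = (1,2) × B₁`,
`∂'C_{2,1} = ([0,2] × ∂B₁) ∪ ({2} × B₁)`, and the Sobolev membership is expressed through
the pointwise time derivative `ut`, spatial gradient `du` and spatial Hessian `d2u` of `u`,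
together with their measurability and local `L_{d+1}`-integrability. -/
theorem parabolic_second_derivative_estimate
    (d : ℕ) (hd : 1 ≤ d) (δ K : ℝ) (hδ0 : 0 < δ) (hδ1 : δ < 1) (hK : 0 ≤ K) :
    ∃ γ N : ℝ, γ ∈ Set.Ioc (0 : ℝ) 1 ∧ 0 < N ∧
      ∀ (a : ℝ × EuclideanSpace ℝ (Fin d) → Matrix (Fin d) (Fin d) ℝ)
        (b : ℝ × EuclideanSpace ℝ (Fin d) → EuclideanSpace ℝ (Fin d))
        (c : ℝ × EuclideanSpace ℝ (Fin d) → ℝ)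
        (u ut : ℝ × EuclideanSpace ℝ (Fin d) → ℝ)
        (du : ℝ × EuclideanSpace ℝ (Fin d) → EuclideanSpace ℝ (Fin d))
        (d2u : ℝ × EuclideanSpace ℝ (Fin d) → Matrix (Fin d) (Fin d) ℝ),
        -- measurability of the coefficients of `L`
        (∀ i j, Measurable fun z => a z i j) →
        (∀ i, Measurable fun z => b z i) →
        Measurable c →
        -- `a` is `S_δ`-valued
        (∀ z, (a z).IsSymm) →
        (∀ z (ξ : EuclideanSpace ℝ (Fin d)),
          δ * ‖ξ‖ ^ 2 ≤ ∑ i, ∑ j, a z i j * ξ i * ξ j ∧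
          ∑ i, ∑ j, a z i j * ξ i * ξ j ≤ δ⁻¹ * ‖ξ‖ ^ 2) →
        -- `|b| + c ≤ K`, `c ≥ 0`
        (∀ z, ‖b z‖ + c z ≤ K) →
        (∀ z, 0 ≤ c z) →
        -- measurability of `u` and its derivatives
        Measurable u → Measurable ut →
        (∀ i, Measurable fun z => du z i) →
        (∀ i j, Measurable fun z => d2u z i j) →
        -- `u ∈ C(C̄_{2,1})`
        ContinuousOn u (closure (Set.Ioo (0 : ℝ) 2 ×ˢ Metric.ball (0 : EuclideanSpace ℝ (Fin d)) 1)) →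
        -- `ut = ∂ₜu`, `du = Du`, `d2u = D²u` pointwise in `C_{2,1}`
        (∀ z ∈ Set.Ioo (0 : ℝ) 2 ×ˢ Metric.ball (0 : EuclideanSpace ℝ (Fin d)) 1,
          HasDerivAt (fun s => u (s, z.2)) (ut z) z.1) →
        (∀ z ∈ Set.Ioo (0 : ℝ) 2 ×ˢ Metric.ball (0 : EuclideanSpace ℝ (Fin d)) 1, ∀ i,
          HasDerivAt (fun s : ℝ => u (z.1, z.2 + s • EuclideanSpace.single i (1 : ℝ))) (du z i) 0) →
        (∀ z ∈ Set.Ioo (0 : ℝ) 2 ×ˢ Metric.ball (0 : EuclideanSpace ℝ (Fin d)) 1, ∀ i j,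
          HasDerivAt (fun s : ℝ => du (z.1, z.2 + s • EuclideanSpace.single j (1 : ℝ)) i)
            (d2u z i j) 0) →
        -- local `L_{d+1}` integrability of the derivatives (`u ∈ W^{1,2}_{d+1,loc}`)
        (∀ G : Set (ℝ × EuclideanSpace ℝ (Fin d)), IsCompact G →
          G ⊆ Set.Ioo (0 : ℝ) 2 ×ˢ Metric.ball (0 : EuclideanSpace ℝ (Fin d)) 1 →
          IntegrableOn (fun z => |ut z| ^ ((d : ℝ) + 1) + ‖du z‖ ^ ((d : ℝ) + 1) +
            frobNorm (d2u z) ^ ((d : ℝ) + 1)) G volume) →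
        (∫⁻ z in Set.Ioo (1 : ℝ) 2 ×ˢ Metric.ball (0 : EuclideanSpace ℝ (Fin d)) 1,
            ENNReal.ofReal (frobNorm (d2u z)) ^ γ ∂volume)
          ≤ ENNReal.ofReal N *
              (∫⁻ z in Set.Ioo (0 : ℝ) 2 ×ˢ Metric.ball (0 : EuclideanSpace ℝ (Fin d)) 1,
                ENNReal.ofReal
                  |ut z + (∑ i, ∑ j, a z i j * d2u z i j) + (∑ i, b z i * du z i) - c z * u z|
                  ^ ((d : ℝ) + 1) ∂volume) ^ (γ / ((d : ℝ) + 1))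
            + ENNReal.ofReal N *
              ENNReal.ofReal
                ((⨆ z ∈ (Set.Icc (0 : ℝ) 2 ×ˢ Metric.sphere (0 : EuclideanSpace ℝ (Fin d)) 1 ∪
                    {(2 : ℝ)} ×ˢ Metric.ball (0 : EuclideanSpace ℝ (Fin d)) 1), |u z|) ^ γ) := by
  obtain ⟨ε, C, hε, hε1, hC, hmain⟩ := LinEst.final d hd hδ0 hδ1.le hK
  refine ⟨ε, C, ⟨hε, by linarith⟩, hC, ?_⟩
  intro a b c u ut du d2u ha hb hc hs hq hbc hc0 hu hut hdu hd2u hcont hdt hdx hdxx hloc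
  have hE : ∀ z, LinEst.Ell δ (a z) := fun z => ⟨hs z, hq z⟩
  have hS : LinEst.Sob u ut du d2u := ⟨hu, hut, hdu, hd2u, hcont, hdt, hdx, hdxx, hloc⟩
  set I := ∫⁻ z in Set.Ioo (0 : ℝ) 2 ×ˢ Metric.ball (0 : EuclideanSpace ℝ (Fin d)) 1,
                ENNReal.ofReal
                  |ut z + (∑ i, ∑ j, a z i j * d2u z i j) + (∑ i, b z i * du z i) - c z * u z|
                  ^ ((d : ℝ) + 1) ∂volume with hI
  have hd1 : (0 : ℝ) < (d : ℝ) + 1 := by positivity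
  have hIL : ∫⁻ z in LinEst.QQ d, ENNReal.ofReal |LinEst.LL a b c u ut du d2u z| ^ (d + 1) = I := by
    rw [hI, LinEst.QQ]
    refine lintegral_congr fun z => ?_
    rw [LinEst.LL, LinEst.ctr, LinEst.inner_sum, ← ENNReal.rpow_natCast]
    push_cast
    rfl
  by_cases htop : I = ∞
  · rw [htop, ENNReal.top_rpow_of_pos (by positivity), ENNReal.mul_top (by simpa using hC)]
    simp
  set b0 := (I ^ (1 / ((d : ℝ) + 1))).toReal with hb0
  have hb0n : 0 ≤ b0 := ENNReal.toReal_nonneg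
  have hb0e : ENNReal.ofReal b0 = I ^ (1 / ((d : ℝ) + 1)) :=
    ENNReal.ofReal_toReal (ENNReal.rpow_ne_top_of_nonneg (by positivity) htop)
  have hb0p : ENNReal.ofReal b0 ^ (d + 1) = I := by
    rw [hb0e, ← ENNReal.rpow_natCast, ← ENNReal.rpow_mul]
    push_cast
    rw [one_div_mul_cancel hd1.ne', ENNReal.rpow_one]
  have hfin := hmain ha hb hc hE hbc hc0 hS hb0n (by rw [hIL, hb0p])
  have hS0 : 0 ≤ ⨆ z ∈ LinEst.PB d, |u z| :=
    Real.iSup_nonneg fun z => Real.iSup_nonneg fun _ => abs_nonneg _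
  refine hfin.trans ?_
  rw [ENNReal.ofReal_add hS0 hb0n]
  refine (mul_le_mul_right (ENNReal.rpow_add_le_add_rpow _ _ hε.le (by linarith)) _).trans ?_
  rw [mul_add, add_comm]
  refine add_le_add (le_of_eq ?_) (le_of_eq ?_)
  · rw [hb0e, ← ENNReal.rpow_mul, one_div_mul_eq_div]
  · rw [ENNReal.ofReal_rpow_of_nonneg hS0 hε.le, LinEst.PB]
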